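/- Let X be a double cover of ℙ^{n−1} × ℙ¹ over ℂ branched along a very general divisor of bi-degree (2d,2). If 2d ≥ n ≥ 3, then X is not stably rational. -/

import Mathlib

open MvPolynomial

set_option maxHeartbeats 1600000
set_option synthInstance.maxHeartbeats 400000

namespace ConicBundleFormalization

noncomputable section

variable (K : Type) [Field K]

/-! ### The Cox ring and bihomogeneity -/

/-- The Cox ring of an `(m-1)`-dimensional weighted-projective-space bundle over
`ℙ^{n-1}`: variables `u_i` (`i : Fin n`) of bidegree `(1,0)` and fibre variables
`x_j` (`j : Fin m`) of bidegree `(w j, a j)`. -/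
abbrev Cox (n m : ℕ) : Type := MvPolynomial (Fin n ⊕ Fin m) K

/-- `p` is bihomogeneous of bidegree `(α, β)` for the grading `deg u_i = (1,0)`,
`deg x_j = (w j, a j)`. -/
def IsBihom (n m : ℕ) (w : Fin m → ℤ) (a : Fin m → ℕ) (α : ℤ) (β : ℕ)
    (p : Cox K n m) : Prop :=
  ∀ e ∈ p.support,
    ((∑ i : Fin n, (e (Sum.inl i) : ℤ)) + ∑ j : Fin m, (e (Sum.inr j) : ℤ) * w j = α) ∧
    ((∑ j : Fin m, e (Sum.inr j) * a j) = β)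

/-- A polynomial in `u_0, …, u_{n-1}` is homogeneous of degree `d ∈ ℤ`
(for `d < 0` this forces `p = 0`). -/
def IsHomogZ (n : ℕ) (d : ℤ) (p : MvPolynomial (Fin n) K) : Prop :=
  ∀ e ∈ p.support, (∑ i : Fin n, (e i : ℤ)) = d

/-- A polynomial in the fibre variables is weighted-homogeneous of degree `e` for
the weights `a`. -/
def IsWHom (m : ℕ) (a : Fin m → ℕ) (e : ℕ) (q : MvPolynomial (Fin m) K) : Prop :=
  ∀ ex ∈ q.support, (∑ j : Fin m, ex j * a j) = e

/-! ### Genericity: general and very general members of a linear system -/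

/-- Evaluation of a polynomial `D` in the coefficients of `p`; such `D` are the
polynomial functions on the parameter space of the linear system. -/
def evalCoeff {n m : ℕ} (p : Cox K n m)
    (D : MvPolynomial ((Fin n ⊕ Fin m) →₀ ℕ) K) : K :=
  MvPolynomial.eval (fun e => p.coeff e) D

/-- `Pred` holds for a *general* member of the complete linear system of
bihomogeneous polynomials of bidegree `(α,β)`: it holds on a nonempty principal
Zariski-open subset of the parameter space. -/
def GenerallyHolds (n m : ℕ) (w : Fin m → ℤ) (a : Fin m → ℕ) (α : ℤ) (β : ℕ)
    (Pred : Cox K n m → Prop) : Prop :=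
  ∃ D : MvPolynomial ((Fin n ⊕ Fin m) →₀ ℕ) K,
    (∃ p₀, IsBihom K n m w a α β p₀ ∧ evalCoeff K p₀ D ≠ 0) ∧
    ∀ p, IsBihom K n m w a α β p → evalCoeff K p D ≠ 0 → Pred p

/-- `Pred` holds for a *very general* member of the complete linear system of
bihomogeneous polynomials of bidegree `(α,β)`: it holds away from countably many
proper Zariski-closed subsets of the parameter space. -/
def VeryGenerallyHolds (n m : ℕ) (w : Fin m → ℤ) (a : Fin m → ℕ) (α : ℤ) (β : ℕ)
    (Pred : Cox K n m → Prop) : Prop :=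
  ∃ D : ℕ → MvPolynomial ((Fin n ⊕ Fin m) →₀ ℕ) K,
    (∀ i, ∃ p₀, IsBihom K n m w a α β p₀ ∧ evalCoeff K p₀ (D i) ≠ 0) ∧
    ∀ p, IsBihom K n m w a α β p → (∀ i, evalCoeff K p (D i) ≠ 0) → Pred p

/-- Evaluation of a polynomial `D` in the coefficients of a quadruple
`(a,b,c,f)` of polynomials in `u_0,…,u_{n-1}`. -/
def evalCoeff4 {n : ℕ} (abcf : Fin 4 → MvPolynomial (Fin n) K)
    (D : MvPolynomial (Fin 4 × (Fin n →₀ ℕ)) K) : K :=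
  MvPolynomial.eval (fun q => (abcf q.1).coeff q.2) D

/-- `Pred` holds for a *general* quadruple `(a,b,c,f)` of homogeneous polynomials
in `u_0,…,u_{n-1}` of respective degrees `degs 0, …, degs 3`. -/
def GenerallyHolds4 (n : ℕ) (degs : Fin 4 → ℤ)
    (Pred : (Fin 4 → MvPolynomial (Fin n) K) → Prop) : Prop :=
  ∃ D : MvPolynomial (Fin 4 × (Fin n →₀ ℕ)) K,
    (∃ abcf : Fin 4 → MvPolynomial (Fin n) K,
      (∀ i, IsHomogZ K n (degs i) (abcf i)) ∧ evalCoeff4 K abcf D ≠ 0) ∧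
    ∀ abcf : Fin 4 → MvPolynomial (Fin n) K,
      (∀ i, IsHomogZ K n (degs i) (abcf i)) → evalCoeff4 K abcf D ≠ 0 → Pred abcf

/-! ### Points of the bundle: the punctured affine cone and the torus action -/

/-- A point of the affine cone `𝔸^n × 𝔸^m` over the bundle. -/
abbrev Pt (n m : ℕ) : Type := (Fin n → K) × (Fin m → K)

/-- Evaluation of a Cox ring element at a point of the affine cone. -/
def evalPt {n m : ℕ} (p : Pt K n m) (f : Cox K n m) : K :=
  MvPolynomial.eval (Sum.elim p.1 p.2) f

/-- Membership in the complement of the irrelevant locus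
`V(u_0,…,u_{n-1}) ∪ V(x_0,…,x_{m-1})`. -/
def InCone {n m : ℕ} (p : Pt K n m) : Prop := p.1 ≠ 0 ∧ p.2 ≠ 0

/-- Equivalence of two cone points under the action of the torus `𝔾_m²`:
`(s,t)·(u,x) = (s·u_i, s^{w j} t^{a j}·x_j)`.  The points of the bundle are the
equivalence classes of points of the punctured cone. -/
def ToricEq {n m : ℕ} (w : Fin m → ℤ) (a : Fin m → ℕ) (p q : Pt K n m) : Prop :=
  ∃ s t : Kˣ, (∀ i, q.1 i = (s : K) * p.1 i) ∧
    (∀ j, q.2 j = ((s ^ (w j) : Kˣ) : K) * (t : K) ^ (a j) * p.2 j)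

/-- The punctured affine cone over the member `X = {g = 0}`. -/
def XCone {n m : ℕ} (g : Cox K n m) : Set (Pt K n m) :=
  {p | InCone K p ∧ evalPt K p g = 0}

/-! ### Smoothness via the Jacobian criterion on the cone -/

/-- The hypersurface `{g = 0}` is smooth along (the image of) `S ⊆ 𝔸^n × 𝔸^m`: at
every point of `S` lying on the cone over `X` some partial derivative of `g` is
nonzero.  On loci where the torus acts freely this is the Jacobian criterion for
smoothness of `X` itself. -/
def JacobiSmoothOn {n m : ℕ} (g : Cox K n m) (S : Set (Pt K n m)) : Prop :=
  ∀ p ∈ S, evalPt K p g = 0 → ∃ v : Fin n ⊕ Fin m, evalPt K p (pderiv v g) ≠ 0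

/-- The member `X = {g = 0}` of the linear system is smooth (nonsingular). -/
def IsSmoothModel {n m : ℕ} (g : Cox K n m) : Prop :=
  JacobiSmoothOn K g {p | InCone K p}

/-! ### The function field, rationality, and stable rationality -/

/-- The homogeneous coordinate ring `Cox/(g)` of the member `X = {g = 0}`,
i.e. the coordinate ring of the affine cone over `X`. -/
abbrev coneRing {n m : ℕ} (g : Cox K n m) : Type :=
  Cox K n m ⧸ Ideal.span {g}

/-- The total fraction ring of the affine cone over `X`; the function field of the
cone when `g` is prime. -/
def FracCone {n m : ℕ} (g : Cox K n m) : Type := FractionRing (coneRing K g)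

instance {n m : ℕ} (g : Cox K n m) : CommRing (FracCone K g) :=
  inferInstanceAs (CommRing (FractionRing (coneRing K g)))

instance {n m : ℕ} (g : Cox K n m) : Algebra K (FracCone K g) :=
  inferInstanceAs (Algebra K (FractionRing (coneRing K g)))

instance {n m : ℕ} (g : Cox K n m) : Algebra (coneRing K g) (FracCone K g) :=
  inferInstanceAs (Algebra (coneRing K g) (FractionRing (coneRing K g)))

/-- The canonical map from the Cox ring to the fraction ring of the cone over `X`. -/
def toFrac {n m : ℕ} (g : Cox K n m) : Cox K n m →+* FracCone K g :=
  (algebraMap (coneRing K g) (FracCone K g)).comp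
    (Ideal.Quotient.mk (Ideal.span {g}))

/-- The set of degree-`(0,0)` fractions on the cone over `X`: ratios `p/q` of
bihomogeneous elements of equal bidegree (phrased multiplicatively, avoiding
inverses). -/
def ratioSet {n m : ℕ} (w : Fin m → ℤ) (a : Fin m → ℕ) (g : Cox K n m) :
    Set (FracCone K g) :=
  {φ | ∃ (α : ℤ) (β : ℕ) (p q : Cox K n m),
    IsBihom K n m w a α β p ∧ IsBihom K n m w a α β q ∧
    toFrac K g q ≠ 0 ∧ φ * toFrac K g q = toFrac K g p}

/-- The `K`-algebra of rational functions on `X = {g = 0}`: the fractions of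
degree `(0,0)`.  When `g` is prime this is the function field `K(X)`. -/
def functionFieldModel {n m : ℕ} (w : Fin m → ℤ) (a : Fin m → ℕ) (g : Cox K n m) :
    Subalgebra K (FracCone K g) :=
  Algebra.adjoin K (ratioSet K w a g)

/-- `X = {g = 0}` is rational: its function field is `K`-isomorphic to a purely
transcendental extension `K(y_1,…,y_N)` of `K`, i.e. `X` is birational to a
projective space. -/
def IsRationalModel {n m : ℕ} (w : Fin m → ℤ) (a : Fin m → ℕ) (g : Cox K n m) :
    Prop :=
  ∃ N : ℕ, Nonempty
    (functionFieldModel K w a g ≃ₐ[K] FractionRing (MvPolynomial (Fin N) K))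

/-- `X = {g = 0}` is stably rational: `X × ℙ^r` is birational to a projective
space for some `r`, i.e. `K(X)(x_1,…,x_r) ≅_K K(y_1,…,y_s)` for some `r, s`. -/
def IsStablyRationalModel {n m : ℕ} (w : Fin m → ℤ) (a : Fin m → ℕ)
    (g : Cox K n m) : Prop :=
  ∃ r s : ℕ, Nonempty
    ((FractionRing (MvPolynomial (Fin r) (functionFieldModel K w a g)))
      ≃ₐ[K] FractionRing (MvPolynomial (Fin s) K))

/-! ### Normality, terminal singularities, class group, ampleness, fibres -/

/-- A prime of the Cox ring is *relevant* if it does not contain either component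
of the irrelevant ideal `(u_0,…,u_{n-1}) ∩ (x_0,…,x_{m-1})`. -/
def RelevantPrime {n m : ℕ} (P : Ideal (Cox K n m)) : Prop :=
  (∃ i, X (Sum.inl i) ∉ P) ∧ (∃ j, X (Sum.inr j) ∉ P)

/-- `X = {g = 0}` is normal: the local rings of the relevant locus of its affine
cone are integrally closed (the punctured cone is a smooth torsor over `X`, so
this is normality of `X`). -/
def IsNormalModel {n m : ℕ} (g : Cox K n m) : Prop :=
  ∀ P : PrimeSpectrum (coneRing K g),
    ((∃ i, Ideal.Quotient.mk (Ideal.span {g}) (X (Sum.inl i)) ∉ P.asIdeal) ∧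
     (∃ j, Ideal.Quotient.mk (Ideal.span {g}) (X (Sum.inr j)) ∉ P.asIdeal)) →
    IsIntegrallyClosed (Localization.AtPrime P.asIdeal)

/-- The singular locus of `X = {g = 0}` has codimension at least `c`: every
relevant prime of the Cox ring containing `g` and all its partial derivatives has
height at least `c + 1` (the height in the cone exceeds the codimension in `X`
by one). -/
def SingularLocusCodimAtLeast {n m : ℕ} (g : Cox K n m) (c : ℕ) : Prop :=
  ∀ P : PrimeSpectrum (Cox K n m), RelevantPrime K P.asIdeal →
    g ∈ P.asIdeal → (∀ v : Fin n ⊕ Fin m, pderiv v g ∈ P.asIdeal) →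
    ((c + 1 : ℕ) : WithBot (WithTop ℕ)) ≤ ringKrullDim (Localization.AtPrime P.asIdeal)

/-- Rendering of "`X` has only terminal singularities" for the members considered
in the paper: `X` is normal and its singular locus has codimension at least 3
(cf. the proof of Lemma 2.8, where the general members with `2m > d > l+m` have
ordinary double points along a nonsingular center of codimension 3). -/
def HasOnlyTerminalSingularitiesModel {n m : ℕ} (g : Cox K n m) : Prop :=
  IsNormalModel K g ∧ SingularLocusCodimAtLeast K g 3

/-- An ideal of the Cox ring is bihomogeneous if it is generated by its
bihomogeneous elements. -/
def IsBihomIdeal {n m : ℕ} (w : Fin m → ℤ) (a : Fin m → ℕ)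
    (P : Ideal (Cox K n m)) : Prop :=
  P ≤ Ideal.span {f | f ∈ P ∧ ∃ α β, IsBihom K n m w a α β f}

/-- A prime divisor of `X = {g = 0}`: a relevant bihomogeneous prime of the Cox
ring containing `g` of height 2 (height 1 over `(g)`). -/
def IsPrimeDivisorOn {n m : ℕ} (w : Fin m → ℤ) (a : Fin m → ℕ) (g : Cox K n m)
    (P : PrimeSpectrum (Cox K n m)) : Prop :=
  g ∈ P.asIdeal ∧ RelevantPrime K P.asIdeal ∧ IsBihomIdeal K w a P.asIdeal ∧
    ringKrullDim (Localization.AtPrime P.asIdeal) = (2 : WithBot (WithTop ℕ))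

/-- Rendering of "`X` is ℚ-factorial with `ρ(X) = 2`", i.e. the divisor class
group of `X` is spanned up to torsion by the pullback `F` of the hyperplane class
and the tautological class `D`: every prime divisor `P` of `X` carries a
bihomogeneous form `f` vanishing on `P` and on no other prime divisor, so that
`div(f) = k·P` for some `k ≥ 1` and hence `[P] ∈ ℚ⟨F,D⟩` in `Cl(X) ⊗ ℚ`. -/
def ClassGroupSpannedByFD {n m : ℕ} (w : Fin m → ℤ) (a : Fin m → ℕ)
    (g : Cox K n m) : Prop :=
  ∀ P : PrimeSpectrum (Cox K n m), IsPrimeDivisorOn K w a g P →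
    ∃ (α : ℤ) (β : ℕ) (f : Cox K n m),
      f ∉ Ideal.span {g} ∧ IsBihom K n m w a α β f ∧ f ∈ P.asIdeal ∧
      ∀ Q : PrimeSpectrum (Cox K n m), IsPrimeDivisorOn K w a g Q → Q ≠ P →
        f ∉ Q.asIdeal

/-- Rendering of "`ρ(X) ≥ 3`": the divisor class group of `X` is not spanned up to
torsion by the fibre class `F` and the tautological class `D`. -/
def PicardRankAtLeastThree {n m : ℕ} (w : Fin m → ℤ) (a : Fin m → ℕ)
    (g : Cox K n m) : Prop :=
  ¬ ClassGroupSpannedByFD K w a g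

/-- The cone over the fibre of `π : X → ℙ^{n-1}` over the point `[u] ∈ ℙ^{n-1}`. -/
def fibreCone {n m : ℕ} (g : Cox K n m) (u : Fin n → K) : Set (Fin m → K) :=
  {v | v ≠ 0 ∧ evalPt K (u, v) g = 0}

/-- The fibres of `π : X → ℙ^{n-1}` are nonempty and connected: no fibre can be
covered by two disjoint nonempty closed subsets, closed subsets of the fibre
being cut out by weighted-homogeneous polynomials in the fibre variables. -/
def FibresNonemptyAndConnected {n m : ℕ} (a : Fin m → ℕ) (g : Cox K n m) : Prop :=
  ∀ u : Fin n → K, u ≠ 0 →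
    (fibreCone K g u).Nonempty ∧
    ∀ A B : Set (MvPolynomial (Fin m) K),
      (∀ q ∈ A ∪ B, ∃ e, IsWHom K m a e q) →
      (∀ v ∈ fibreCone K g u,
        (∀ q ∈ A, MvPolynomial.eval v q = 0) ∨ (∀ q ∈ B, MvPolynomial.eval v q = 0)) →
      (∀ v ∈ fibreCone K g u,
        ¬ ((∀ q ∈ A, MvPolynomial.eval v q = 0) ∧ (∀ q ∈ B, MvPolynomial.eval v q = 0))) →
      ¬ ((∃ v ∈ fibreCone K g u, ∀ q ∈ A, MvPolynomial.eval v q = 0) ∧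
         (∃ v ∈ fibreCone K g u, ∀ q ∈ B, MvPolynomial.eval v q = 0))

/-- The infinitesimal generator of the first torus factor at a cone point. -/
def orbitVec₁ {n m : ℕ} (w : Fin m → ℤ) (p : Pt K n m) : (Fin n ⊕ Fin m) → K :=
  Sum.elim (fun i => p.1 i) (fun j => (w j : K) * p.2 j)

/-- The infinitesimal generator of the second torus factor at a cone point. -/
def orbitVec₂ {n m : ℕ} (a : Fin m → ℕ) (p : Pt K n m) : (Fin n ⊕ Fin m) → K :=
  Sum.elim (fun _ => 0) (fun j => (a j : K) * p.2 j)

/-- The bihomogeneous forms of bidegree `(α,β)` have no base point on `X`. -/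
def BasePointFreeOnX {n m : ℕ} (w : Fin m → ℤ) (a : Fin m → ℕ) (g : Cox K n m)
    (α : ℤ) (β : ℕ) : Prop :=
  ∀ p ∈ XCone K g, ∃ s, IsBihom K n m w a α β s ∧ evalPt K p s ≠ 0

/-- The bihomogeneous forms of bidegree `(α,β)` separate the points of `X`. -/
def SeparatesPointsOnX {n m : ℕ} (w : Fin m → ℤ) (a : Fin m → ℕ) (g : Cox K n m)
    (α : ℤ) (β : ℕ) : Prop :=
  ∀ p ∈ XCone K g, ∀ q ∈ XCone K g, ¬ ToricEq K w a p q →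
    ∃ s₁ s₂, IsBihom K n m w a α β s₁ ∧ IsBihom K n m w a α β s₂ ∧
      evalPt K p s₁ * evalPt K q s₂ ≠ evalPt K q s₁ * evalPt K p s₂

/-- The bihomogeneous forms of bidegree `(α,β)` separate the tangent vectors of
`X`: for every cone point `p` of `X` and every tangent vector `t` of the cone over
`X` at `p` not tangent to the torus orbit, some form vanishing at `p` has nonzero
derivative along `t`. -/
def SeparatesTangentsOnX {n m : ℕ} (w : Fin m → ℤ) (a : Fin m → ℕ) (g : Cox K n m)
    (α : ℤ) (β : ℕ) : Prop :=
  ∀ p ∈ XCone K g, ∀ t : (Fin n ⊕ Fin m) → K,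
    (∑ v : Fin n ⊕ Fin m, t v * evalPt K p (pderiv v g)) = 0 →
    t ∉ Submodule.span K {orbitVec₁ K w p, orbitVec₂ K a p} →
    ∃ s, IsBihom K n m w a α β s ∧ evalPt K p s = 0 ∧
      (∑ v : Fin n ⊕ Fin m, t v * evalPt K p (pderiv v s)) ≠ 0

/-- The class `𝒪_X(α,β)` is ample on `X = {g = 0}`: some positive multiple is very
ample, i.e. its forms are base point free on `X` and separate points and tangent
vectors. -/
def IsAmpleClassOnX {n m : ℕ} (w : Fin m → ℤ) (a : Fin m → ℕ) (g : Cox K n m)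
    (α : ℤ) (β : ℕ) : Prop :=
  ∃ t : ℕ, 0 < t ∧
    BasePointFreeOnX K w a g (t * α) (t * β) ∧
    SeparatesPointsOnX K w a g (t * α) (t * β) ∧
    SeparatesTangentsOnX K w a g (t * α) (t * β)

/-- The canonical class of the ambient bundle `P`, by the toric formula
`K_P = -Σ deg(variables)`. -/
def ambientCanonicalClass (n m : ℕ) (w : Fin m → ℤ) : ℤ × ℤ :=
  (-(n : ℤ) - ∑ j : Fin m, w j, -(m : ℤ))

/-- The anticanonical class `-K_X = -(K_P + X)|_X` of a member `X ∈ |𝒪_P(α,β)|`,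
by adjunction. -/
def memberAntiCanonicalClass (n m : ℕ) (w : Fin m → ℤ) (α : ℤ) (β : ℕ) : ℤ × ℤ :=
  (-((ambientCanonicalClass n m w).1 + α), -((ambientCanonicalClass n m w).2 + β))

/-- `-K_X` is `π`-ample for the projection `π : X → ℙ^{n-1}`: some twist of `-K_X`
by the pullback of a (sufficiently ample) divisor on the base is ample. -/
def AntiCanonicalIsRelativelyAmple {n m : ℕ} (w : Fin m → ℤ) (a : Fin m → ℕ)
    (g : Cox K n m) (α : ℤ) (β : ℕ) : Prop :=
  ∃ N : ℤ,
    IsAmpleClassOnX K w a g ((memberAntiCanonicalClass n m w α β).1 + N)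
      (memberAntiCanonicalClass n m w α β).2.toNat

/-- Rendering of Definition 2.5 of the paper: the projection
`π : X → ℙ^{n-1}` of the member `X = {g = 0} ∈ |𝒪_P(d,2)|` of the `ℙ²`-bundle
`P = P_n(w 0, w 1, w 2)` over `ℙ^{n-1}` is a *conic bundle*, i.e. a Mori fibre
space of relative dimension one: `X` is an (irreducible, normal, projective)
variety with only terminal singularities, `π` has connected fibres, `-K_X` is
`π`-ample, and `X` is ℚ-factorial of Picard rank `ρ(X) = 2`.  (Being embedded in
`|𝒪_P(d,2)|` of a projectivized split rank-3 bundle, this is an *embedded* conic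
bundle in the sense of Definition 2.6.) -/
structure IsConicBundleModel (n : ℕ) (w : Fin 3 → ℤ) (d : ℤ) (g : Cox K n 3) :
    Prop where
  bihom : IsBihom K n 3 w (fun _ => 1) d 2 g
  integral : (Ideal.span {g} : Ideal (Cox K n 3)).IsPrime
  normal : IsNormalModel K g
  terminal : HasOnlyTerminalSingularitiesModel K g
  connectedFibres : FibresNonemptyAndConnected K (fun _ => 1) g
  antiCanonicalRelAmple :
    AntiCanonicalIsRelativelyAmple K w (fun _ => 1) g d 2
  picardRankTwo : ClassGroupSpannedByFD K w (fun _ => 1) g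

/-! ### The discriminant of a conic bundle -/

/-- The coefficient of the monomial `x^e` (in the fibre variables) of `g`, as a
polynomial on the base. -/
def fibreCoeff {n m : ℕ} (g : Cox K n m) (e : Fin m →₀ ℕ) :
    MvPolynomial (Fin n) K :=
  ((MvPolynomial.sumAlgEquiv K (Fin m) (Fin n))
    (MvPolynomial.rename Sum.swap g)).coeff e

/-- The symmetric matrix of the fibrewise quadratic form of a member
`X = {g = 0} ∈ |𝒪_P(d,2)|` (over a field of characteristic zero). -/
def quadraticMatrix {n : ℕ} (g : Cox K n 3) :
    Matrix (Fin 3) (Fin 3) (MvPolynomial (Fin n) K) :=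
  fun i j =>
    if i = j then fibreCoeff K g (Finsupp.single i 2)
    else MvPolynomial.C ((2 : K)⁻¹) *
      fibreCoeff K g (Finsupp.single i 1 + Finsupp.single j 1)

/-- The equation of the discriminant divisor `Δ ⊂ ℙ^{n-1}` of the conic bundle
`π : X → ℙ^{n-1}`, `X = {g = 0}`: the determinant of the associated symmetric
matrix. -/
def discriminantPoly {n : ℕ} (g : Cox K n 3) : MvPolynomial (Fin n) K :=
  (quadraticMatrix K g).det

/-- The complete linear system `|k·K_{ℙ^{n-1}} + Δ|` is nonempty, where `Δ` is the
discriminant divisor of the conic bundle `X = {g = 0}`: the divisor class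
`𝒪(deg Δ - k·n)` on `ℙ^{n-1}` contains an effective divisor. -/
def KMultipleplusDiscriminantEffective {n : ℕ} (g : Cox K n 3) (k : ℕ) : Prop :=
  discriminantPoly K g ≠ 0 ∧
    ∃ h : MvPolynomial (Fin n) K, h ≠ 0 ∧
      IsHomogZ K n (((discriminantPoly K g).totalDegree : ℤ) - k * n) h

/-- `π : X → ℙ^{n-1}` is flat, i.e. no fibre is two-dimensional: `g` does not
vanish identically on any fibre of the ambient bundle.  Together with smoothness
of `X` this renders a *standard* conic bundle. -/
def ProjectionIsFlat {n m : ℕ} (g : Cox K n m) : Prop :=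
  ∀ u : Fin n → K, u ≠ 0 → ∃ v : Fin m → K, evalPt K (u, v) g ≠ 0

end

end ConicBundleFormalization

namespace ConicBundleFormalization

noncomputable section

variable (K : Type) [Field K]

/-! ### The special members `a x² + b y² + c z² + f x y` and the associated double
cover data in characteristic 2 -/

/-- The special member `X = {a x² + b y² + c z² + f x y = 0}` of
`|𝒪_P(λ+μ+ν, 2)|`, `P = P_n(λ,μ,ν)`, built from a quadruple `(a,b,c,f)` of
polynomials on the base (equation (3.1) of the paper). -/
def specialMemberX {n : ℕ} (abcf : Fin 4 → MvPolynomial (Fin n) K) : Cox K n 3 :=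
  rename Sum.inl (abcf 0) * X (Sum.inr 0) ^ 2 +
  rename Sum.inl (abcf 1) * X (Sum.inr 1) ^ 2 +
  rename Sum.inl (abcf 2) * X (Sum.inr 2) ^ 2 +
  rename Sum.inl (abcf 3) * X (Sum.inr 0) * X (Sum.inr 1)

/-- The hypersurface `Z = {a x² + b y² + c z̄ + f x y = 0}` in the
`ℙ(1,1,2)`-bundle `R` over `ℙ^{n-1}` (with `z̄` the third fibre variable, of
weight 2), the image of `X` under the purely inseparable double cover `P → R` in
characteristic 2. -/
def specialMemberZ {n : ℕ} (abcf : Fin 4 → MvPolynomial (Fin n) K) : Cox K n 3 :=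
  rename Sum.inl (abcf 0) * X (Sum.inr 0) ^ 2 +
  rename Sum.inl (abcf 1) * X (Sum.inr 1) ^ 2 +
  rename Sum.inl (abcf 2) * X (Sum.inr 2) +
  rename Sum.inl (abcf 3) * X (Sum.inr 0) * X (Sum.inr 1)

/-! ### Admissible critical points (Definition 3.5 of the paper) -/

/-- A polynomial `F` in `N` variables over a field of characteristic 2 is in
*admissible normal form* at the origin: its linear part vanishes (a critical
point) and, up to an additive constant and higher-order terms,
`F = α + x₀x₁ + x₂x₃ + ⋯ + x_{N-2}x_{N-1}` if `N` is even, and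
`F = α + βx₀² + x₁x₂ + ⋯ + x_{N-2}x_{N-1} + (nonzero)·x₀³ + ⋯` if `N` is odd. -/
def AdmissibleNormalForm {N : ℕ} (F : MvPolynomial (Fin N) K) : Prop :=
  (∀ i, F.coeff (Finsupp.single i 1) = 0) ∧
  (N % 2 = 0 →
    (∀ i, F.coeff (Finsupp.single i 2) = 0) ∧
    (∀ i j : Fin N, (i : ℕ) < (j : ℕ) →
      F.coeff (Finsupp.single i 1 + Finsupp.single j 1) =
        (if (i : ℕ) % 2 = 0 ∧ (j : ℕ) = (i : ℕ) + 1 then 1 else 0))) ∧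
  (N % 2 = 1 →
    (∀ i : Fin N, (i : ℕ) ≠ 0 → F.coeff (Finsupp.single i 2) = 0) ∧
    (∀ i j : Fin N, (i : ℕ) < (j : ℕ) →
      F.coeff (Finsupp.single i 1 + Finsupp.single j 1) =
        (if (i : ℕ) % 2 = 1 ∧ (j : ℕ) = (i : ℕ) + 1 then 1 else 0)) ∧
    (∀ h0 : 0 < N, F.coeff (Finsupp.single (⟨0, h0⟩ : Fin N) 3) ≠ 0))

/-- A local function `F` (a polynomial in the local coordinates indexed by `ι`,
centred at the origin) has an *admissible critical point* at the origin: after a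
suitable (linear) change of coordinates it is in admissible normal form. -/
def AdmissibleLocalFunction {ι : Type} [Fintype ι] (F : MvPolynomial ι K) : Prop :=
  ∃ (N : ℕ) (e : ι ≃ Fin N) (T : Matrix (Fin N) (Fin N) K), IsUnit T.det ∧
    AdmissibleNormalForm K
      ((aeval (fun i : ι => ∑ j : Fin N, MvPolynomial.C (T (e i) j) * X j)) F)

/-- The local expression of the section `z̄` of `𝓛²` on the chart `x = 1` of `Z`
(multiplied by the square unit `c̃²`, i.e. computed with respect to the local
generator `c̃·ξ` of `𝓛`): the polynomial `c·(a + b·y² + f·y)` in the base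
variables and the remaining fibre variable `y`. -/
def chartPolyX {n : ℕ} (abcf : Fin 4 → MvPolynomial (Fin n) K) :
    MvPolynomial (Fin n ⊕ Fin 1) K :=
  rename Sum.inl (abcf 2) *
    (rename Sum.inl (abcf 0) + rename Sum.inl (abcf 1) * X (Sum.inr 0) ^ 2 +
      rename Sum.inl (abcf 3) * X (Sum.inr 0))

/-- The local expression of the section `z̄` on the chart `y = 1` of `Z`:
the polynomial `c·(a·x² + b + f·x)`. -/
def chartPolyY {n : ℕ} (abcf : Fin 4 → MvPolynomial (Fin n) K) :
    MvPolynomial (Fin n ⊕ Fin 1) K :=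
  rename Sum.inl (abcf 2) *
    (rename Sum.inl (abcf 0) * X (Sum.inr 0) ^ 2 + rename Sum.inl (abcf 1) +
      rename Sum.inl (abcf 3) * X (Sum.inr 0))

/-- Translation of a chart polynomial to local coordinates centred at the point
with base coordinates `u0` (normalized by `u0 i0 = 1`) and fibre coordinate `y0`:
substitute `u_{i0} ↦ 1`, `u_j ↦ u_j + u0 j` and `y ↦ y + y0`.  The variables are
the genuine local coordinates `{u_j : j ≠ i0} ∪ {y}` of `Z` at that point. -/
def localAt {n : ℕ} (i0 : Fin n) (u0 : Fin n → K) (y0 : K)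
    (G : MvPolynomial (Fin n ⊕ Fin 1) K) :
    MvPolynomial ({ j : Fin n // j ≠ i0 } ⊕ Fin 1) K :=
  aeval (Sum.elim
    (fun j => if h : j = i0 then 1 else X (Sum.inl ⟨j, h⟩) + MvPolynomial.C (u0 j))
    (fun _ => X (Sum.inr 0) + MvPolynomial.C y0)) G

/-- The section `z̄` of `𝓛²` on `Z = {gZ = 0}` has a *critical point* at the point
below the normalized cone point `p` (with `u_{i0} = 1` and the fibre coordinate
`jfix ∈ {x, y}` normalized to 1): the differential of `z̄` vanishes on the tangent
space of `Z` at that point, i.e. every chart tangent vector `t` of `Z` has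
vanishing `z̄`-component. -/
def CriticalPointOfZbar {n : ℕ} (gZ : Cox K n 3) (i0 : Fin n) (jfix : Fin 3)
    (p : Pt K n 3) : Prop :=
  ∀ t : (Fin n ⊕ Fin 3) → K, t (Sum.inl i0) = 0 → t (Sum.inr jfix) = 0 →
    (∑ v : Fin n ⊕ Fin 3, t v * evalPt K p (pderiv v gZ)) = 0 →
    t (Sum.inr 2) = 0

/-- `p` is a singular point of the cone over `X = {g = 0}`. -/
def SingularConePoint {n m : ℕ} (g : Cox K n m) (p : Pt K n m) : Prop :=
  p ∈ XCone K g ∧ ∀ v : Fin n ⊕ Fin m, evalPt K p (pderiv v g) = 0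

end

end ConicBundleFormalization

set_option linter.all false

namespace DC

def ty {n : ℕ} : Fin n ⊕ Fin 2 → Fin 2 := Sum.elim (fun _ => 0) (fun _ => 1)

@[simp] lemma ty_inl {n : ℕ} (i : Fin n) : ty (Sum.inl i : Fin n ⊕ Fin 2) = 0 := rfl
@[simp] lemma ty_inr {n : ℕ} (i : Fin 2) : ty (Sum.inr i : Fin n ⊕ Fin 2) = 1 := rfl

lemma chain {k R τ : Type*} [CommRing k] [CommRing R] [Algebra k R] [Fintype τ]
    (D : Derivation k R R) (pt : τ → R) (f : MvPolynomial τ k) :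
    D (aeval pt f) = ∑ v, aeval pt (pderiv v f) * D (pt v) := by
  classical
  induction f using MvPolynomial.induction_on with
  | C a => simp
  | add p q hp hq => simp [hp, hq, add_mul, Finset.sum_add_distrib]
  | mul_X p i hp =>
    rw [map_mul, Derivation.leibniz, hp]
    simp only [aeval_X, Derivation.leibniz, map_add, smul_eq_mul, map_mul, pderiv_X, add_mul,
      Finset.sum_add_distrib, Finset.mul_sum]
    congr 1
    · rw [Finset.sum_eq_single i]
      · simp
      · intro b _ hb
        simp [Pi.single_apply, hb.symm]
      · simp
    · exact Finset.sum_congr rfl fun _ _ => by ring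

section
variable {n : ℕ} [NeZero n] {k R : Type*} [CommRing k] [CommRing R] [Algebra k R]

def mat (D : Fin n → Derivation k R R) (pt ρ : Fin n ⊕ Fin 2 → R) :
    Matrix (Fin n ⊕ Fin 2) (Fin n ⊕ Fin 2) R := fun r v =>
  match r with
  | Sum.inl i => if i = 0 then ρ v else D i (pt v)
  | Sum.inr j => if ty v = j then pt v else 0

noncomputable def bd (b : MvPolynomial (Fin n ⊕ Fin 2) k) (pt : Fin n ⊕ Fin 2 → R)
    (v : Fin n ⊕ Fin 2) : R := aeval pt (pderiv v b)

lemma F1 (D : Fin n → Derivation k R R) (pt ρ : Fin n ⊕ Fin 2 → R)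
    (b : MvPolynomial (Fin n ⊕ Fin 2) k)
    (hD : ∀ i, D i (aeval pt b) = 0)
    (hE : ∀ j : Fin 2, ∑ v, (if ty v = j then pt v else 0) * bd b pt v = 0) (v : Fin n ⊕ Fin 2) :
    (mat D pt ρ).det * bd b pt v
      = (∑ w, ρ w * bd b pt w) * (mat D pt (Pi.single v 1)).det := by
  have h1 : (mat D pt ρ).mulVec (bd b pt) = Pi.single (Sum.inl 0) (∑ w, ρ w * bd b pt w) := by
    ext r
    rcases r with i | j
    · by_cases hi : i = 0
      · subst hi; simp [Matrix.mulVec, dotProduct, mat]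
      · have := hD i
        rw [chain] at this
        simp only [Matrix.mulVec, dotProduct, mat, if_neg hi]
        rw [Pi.single_eq_of_ne (by simpa using hi), ← this]
        exact Finset.sum_congr rfl fun _ _ => by rw [bd]; ring
    · simp only [Matrix.mulVec, dotProduct, mat]
      rw [hE j]; simp
  have h2 : (mat D pt ρ).adjugate.mulVec ((mat D pt ρ).mulVec (bd b pt)) v
      = (mat D pt ρ).det * bd b pt v := by
    rw [Matrix.mulVec_mulVec, Matrix.adjugate_mul, Matrix.smul_mulVec, Matrix.one_mulVec]; rfl
  rw [← h2, h1]
  have h3 : (mat D pt ρ).updateRow (Sum.inl 0) (Pi.single v 1) = mat D pt (Pi.single v 1) := by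
    ext r w
    rcases r with i | j
    · by_cases hi : i = 0
      · subst hi; simp [mat]
      · rw [Matrix.updateRow_ne (by simpa using hi)]; simp [mat, hi]
    · rw [Matrix.updateRow_ne (by simp)]; simp [mat]
  simp [Matrix.mulVec, dotProduct, Matrix.adjugate_apply, h3, Pi.single_apply, mul_comm]

lemma F2 (D : Fin n → Derivation k R R) (pt ρ : Fin n ⊕ Fin 2 → R) (sc : Fin 2 → R) :
    (mat D (fun v => sc (ty v) * pt v) (fun v => sc (ty v) * ρ v)).det
      = sc 0 ^ n * sc 1 ^ 2 * (mat D pt ρ).det := by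
  let W : Matrix (Fin n ⊕ Fin 2) (Fin n ⊕ Fin 2) R :=
    Matrix.fromBlocks 1 0 0 (Matrix.diagonal sc)
  let U : Matrix (Fin n ⊕ Fin 2) (Fin n ⊕ Fin 2) R :=
    Matrix.fromBlocks 1 (Matrix.of fun i j => if i = 0 then 0 else D i (sc j)) 0 1
  let P : Matrix (Fin n) (Fin n ⊕ Fin 2) R :=
    Matrix.of fun i v => sc (ty v) * if i = 0 then ρ v else D i (pt v)
  let Q : Matrix (Fin 2) (Fin n ⊕ Fin 2) R := Matrix.of fun j v => if ty v = j then pt v else 0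
  let T : Matrix (Fin n ⊕ Fin 2) (Fin n ⊕ Fin 2) R := Matrix.fromRows P Q
  have h1 : mat D (fun v => sc (ty v) * pt v) (fun v => sc (ty v) * ρ v) = W * (U * T) := by
    simp only [W, U, T, Matrix.fromBlocks_mul_fromRows, Matrix.one_mul, Matrix.zero_mul, zero_add,
      add_zero]
    ext r v
    rcases r with i | j
    · by_cases hi : i = 0
      · simp [mat, hi, P, Q, Matrix.mul_apply, mul_comm]
      · simp [mat, hi, P, Q, Matrix.mul_apply, mul_comm]; ring
    · simp only [mat, Matrix.fromRows_apply_inr, Matrix.diagonal_mul, Q, Matrix.of_apply]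
      split_ifs with h <;> simp [h]
  have h2 : W * T = mat D pt ρ * Matrix.diagonal (fun v => sc (ty v)) := by
    simp only [W, T, Matrix.fromBlocks_mul_fromRows, Matrix.one_mul, Matrix.zero_mul, zero_add,
      add_zero]
    ext r v
    rw [Matrix.mul_diagonal]
    rcases r with i | j
    · simp [mat, P, mul_comm]
    · simp only [mat, Matrix.fromRows_apply_inr, Matrix.diagonal_mul, Q, Matrix.of_apply]
      split_ifs with h <;> simp [h, mul_comm]
  have hU : U.det = 1 := by simp [U]
  have h3 := congrArg Matrix.det h2
  rw [Matrix.det_mul, Matrix.det_mul, Matrix.det_diagonal, Fintype.prod_sum_type] at h3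
  rw [h1, Matrix.det_mul, Matrix.det_mul, hU, one_mul, h3]
  simp; ring

def BH (dg : Fin 2 → ℕ) (b : MvPolynomial (Fin n ⊕ Fin 2) k) : Prop :=
  ∀ e ∈ b.support, ∀ j, (∑ v, if ty v = j then e v else 0) = dg j

lemma aeval_eq_sum (pt : Fin n ⊕ Fin 2 → R) (b : MvPolynomial (Fin n ⊕ Fin 2) k) :
    aeval pt b = ∑ e ∈ b.support, algebraMap k R (b.coeff e) * ∏ v, pt v ^ e v := by
  rw [aeval_def, eval₂_eq']

lemma prod_sc (sc : Fin 2 → R) (e : Fin n ⊕ Fin 2 →₀ ℕ) (dg : Fin 2 → ℕ)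
    (h : ∀ j, (∑ v, if ty v = j then e v else 0) = dg j) :
    ∏ v, sc (ty v) ^ e v = sc 0 ^ dg 0 * sc 1 ^ dg 1 := by
  rw [← h 0, ← h 1]
  simp [Fintype.prod_sum_type, Finset.prod_pow_eq_pow_sum]

lemma bh_scale {dg : Fin 2 → ℕ} {b : MvPolynomial (Fin n ⊕ Fin 2) k} (hb : BH dg b)
    (sc : Fin 2 → R) (pt : Fin n ⊕ Fin 2 → R) :
    aeval (fun v => sc (ty v) * pt v) b = sc 0 ^ dg 0 * sc 1 ^ dg 1 * aeval pt b := by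
  rw [aeval_eq_sum, aeval_eq_sum, Finset.mul_sum]
  refine Finset.sum_congr rfl fun e he => ?_
  simp only [mul_pow, Finset.prod_mul_distrib]
  rw [prod_sc sc e dg (hb e he)]; ring

lemma euler {dg : Fin 2 → ℕ} {b : MvPolynomial (Fin n ⊕ Fin 2) k} (hb : BH dg b) (j : Fin 2)
    (pt : Fin n ⊕ Fin 2 → R) :
    ∑ v, (if ty v = j then pt v else 0) * bd b pt v = dg j * aeval pt b := by
  have key : ∑ v, (if ty v = j then X v else 0) * pderiv v b = (dg j : MvPolynomial _ k) * b := by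
    conv_rhs => rw [b.as_sum]
    conv_lhs => enter [2, v]; rw [b.as_sum]
    simp only [map_sum, Finset.mul_sum]
    rw [Finset.sum_comm]
    refine Finset.sum_congr rfl fun e he => ?_
    have h1 : ∀ v, (if ty v = j then X v else 0) * pderiv v (monomial e (b.coeff e))
        = ((if ty v = j then e v else 0 : ℕ) : MvPolynomial _ k) * monomial e (b.coeff e) := by
      intro v
      split_ifs with h
      · rw [X_mul_pderiv_monomial, nsmul_eq_mul]
      · simp
    rw [Finset.sum_congr rfl fun v _ => h1 v, ← Finset.sum_mul, ← Nat.cast_sum, hb e he j]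
  have := congrArg (aeval pt) key
  rw [map_sum, map_mul, map_natCast] at this
  rw [← this]
  refine Finset.sum_congr rfl fun v _ => ?_
  rw [map_mul, bd]; split_ifs <;> simp

lemma bd_scale {dg : Fin 2 → ℕ} {b : MvPolynomial (Fin n ⊕ Fin 2) k} (hb : BH dg b)
    (sc : Fin 2 → R) (pt : Fin n ⊕ Fin 2 → R) (v : Fin n ⊕ Fin 2) :
    sc (ty v) * bd b (fun v => sc (ty v) * pt v) v = sc 0 ^ dg 0 * sc 1 ^ dg 1 * bd b pt v := by
  rw [bd, bd]
  conv_lhs => rw [b.as_sum]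
  conv_rhs => rw [b.as_sum]
  simp only [map_sum, Finset.mul_sum]
  refine Finset.sum_congr rfl fun e he => ?_
  rw [pderiv_monomial, aeval_monomial, aeval_monomial]
  by_cases h0 : e v = 0
  · simp [h0]
  have h2 : e = (e - Finsupp.single v 1) + Finsupp.single v 1 := by
    ext w
    by_cases hw : v = w
    · subst hw; simp; omega
    · simp [Finsupp.single_apply, hw]
  rw [← prod_sc sc e dg (hb e he)]
  generalize e - Finsupp.single v 1 = f at *
  subst h2
  rw [Finsupp.prod_fintype _ _ (by simp), Finsupp.prod_fintype _ _ (by simp)]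
  simp only [mul_pow, Finset.prod_mul_distrib, Finsupp.add_apply, pow_add]
  rw [Finset.prod_eq_single (f := fun x => sc (ty x) ^ (Finsupp.single v 1 : _ →₀ ℕ) x) v
    (by intro w _ hw; simp [Finsupp.single_apply, hw.symm]) (by simp)]
  simp; ring

end
end DC

namespace DC

lemma det_border {V R : Type*} [Fintype V] [DecidableEq V] [CommRing R] (N X : Matrix V V R) (p : R)
    (δ w Y : V → R) (a : V → ℕ) (hw : ∀ v, p * w v = p ^ a v * Y v)
    (hN : ∀ r v, N r v = δ r * w v + X r v * p ^ a v) : p ^ (∑ v, a v) ∣ p * N.det := by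
  have h : Matrix.fromBlocks (Matrix.of fun _ _ => p : Matrix Unit Unit R) 0
        (Matrix.of fun r _ => δ r) N
      = Matrix.fromBlocks (Matrix.of fun _ _ => p : Matrix Unit Unit R)
        (Matrix.of fun _ v => - Y v) (Matrix.of fun r _ => δ r) X *
      Matrix.fromBlocks (1 : Matrix Unit Unit R) (Matrix.of fun _ v => w v) 0
        (Matrix.diagonal fun v => p ^ a v) := by
    rw [Matrix.fromBlocks_multiply]
    congr 1
    · ext; simp
    · ext i v; simp [Matrix.mul_apply, hw, Matrix.diagonal_apply]; ring
    · ext; simp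
    · ext r v; simp [Matrix.mul_apply, hN, Matrix.diagonal_apply]
  have h2 := congrArg Matrix.det h
  rw [Matrix.det_fromBlocks_zero₁₂, Matrix.det_mul, Matrix.det_fromBlocks_zero₂₁,
    Matrix.det_diagonal, Finset.prod_pow_eq_pow_sum] at h2
  simp at h2
  exact ⟨_, h2.trans (mul_comm _ _)⟩

lemma det_plain {V R : Type*} [Fintype V] [DecidableEq V] [CommRing R] (N : Matrix V V R) (p : R)
    (a : V → ℕ) (hN : ∀ r v, p ^ a v ∣ N r v) : p ^ (∑ v, a v) ∣ N.det := by
  choose X hX using hN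
  have : N = Matrix.of X * Matrix.diagonal fun v => p ^ a v := by
    ext r v; rw [Matrix.mul_diagonal, hX]; simp [mul_comm]
  rw [this, Matrix.det_mul, Matrix.det_diagonal, Finset.prod_pow_eq_pow_sum]
  exact Dvd.intro_left _ rfl

section
variable {n : ℕ} [NeZero n] {k R : Type*} [CommRing k] [CommRing R] [Algebra k R]

lemma det_local (D : Fin n → Derivation k R R) (pt : Fin n ⊕ Fin 2 → R)
    (B : Fin 2 → Fin n ⊕ Fin 2) (hB : ∀ j, ty (B j) = j)
    (rr : Fin n ⊕ Fin 2 → k) (G : Fin n ⊕ Fin 2 → Fin n ⊕ Fin 2 → k) (η : Fin n ⊕ Fin 2 → R)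
    (hpt : ∀ v, pt v = algebraMap k R (rr v) + ∑ s, algebraMap k R (G s v) * η s)
    (hη : ∀ j, η (B j) = 0) (l : Fin n ⊕ Fin 2) (hl : ∀ j, l ≠ B j) (p : R)
    (a : Fin n ⊕ Fin 2 → ℕ) (hal : a l = 0) (haB : ∀ j, a (B j) = 0) (ha : ∀ s, p ^ a s ∣ η s) :
    p ^ (∑ s, a s) ∣ p * (mat D pt (fun v => algebraMap k R (G l v))).det ∧
    ((∀ i, p ∣ D i p) → p ^ (∑ s, a s) ∣ (mat D pt (fun v => algebraMap k R (G l v))).det) := by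
  let A : Matrix (Fin n ⊕ Fin 2) (Fin n ⊕ Fin 2) R := Matrix.of fun r s => match r with
    | Sum.inl i => if i = 0 then (if s = l then 1 else 0) else D i (η s)
    | Sum.inr j => if s = B j then 1 else 0
  let C : Matrix (Fin n ⊕ Fin 2) (Fin n ⊕ Fin 2) R := Matrix.of fun s v =>
    if s = B (ty s) then (if ty v = ty s then pt v else 0) else algebraMap k R (G s v)
  have hAC : mat D pt (fun v => algebraMap k R (G l v)) = A * C := by
    ext r v
    rw [Matrix.mul_apply]
    rcases r with i | j
    · by_cases hi : i = 0
      · rw [Finset.sum_eq_single l (fun s _ hs => by simp [A, hi, hs]) (by simp)]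
        simp [mat, hi, A, C, hl]
      · simp only [mat, if_neg hi, A, Matrix.of_apply, hpt v, map_add, map_sum,
          Derivation.map_algebraMap, zero_add, Derivation.leibniz, smul_zero, add_zero]
        refine Finset.sum_congr rfl fun s _ => ?_
        by_cases hs : s = B (ty s)
        · rw [hs, hη]; simp
        · simp [C, hs, mul_comm]
    · rw [Finset.sum_eq_single (B j) (fun s _ hs => by simp [A, hs]) (by simp)]
      simp [mat, A, C, hB]
  rw [hAC, Matrix.det_mul]
  choose ζ hζ using ha
  have hDη : ∀ i s, D i (η s) = D i p * (a s * p ^ (a s - 1) * ζ s) + D i (ζ s) * p ^ a s := by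
    intro i s
    rw [hζ, Derivation.leibniz, Derivation.leibniz_pow]
    simp only [smul_eq_mul, nsmul_eq_mul]; ring
  constructor
  · rw [← mul_assoc]
    refine Dvd.dvd.mul_right ?_ _
    refine det_border A (Matrix.of fun r s => match r with
      | Sum.inl i => if i = 0 then (if s = l then 1 else 0) else D i (ζ s)
      | Sum.inr j => if s = B j then 1 else 0) p
      (fun r => match r with | Sum.inl i => if i = 0 then 0 else D i p | Sum.inr j => 0)
      (fun s => a s * p ^ (a s - 1) * ζ s) (fun s => a s * ζ s) a ?_ ?_
    · intro s
      rcases h : a s with _ | m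
      · simp
      · simp [pow_succ]; ring
    · rintro (i | j) s
      · by_cases hi : i = 0
        · by_cases hs : s = l
          · simp [A, hi, hs, hal]
          · simp [A, hi, hs]
        · simp [A, hi, hDη]
      · by_cases hs : s = B j
        · simp [A, hs, haB]
        · simp [A, hs]
  · intro hp
    refine Dvd.dvd.mul_right ?_ _
    refine det_plain A p a ?_
    rintro (i | j) s
    · by_cases hi : i = 0
      · by_cases hs : s = l
        · simp [hs, hal]
        · simp [A, hi, hs]
      · simp only [A, Matrix.of_apply, if_neg hi, hDη]
        refine dvd_add ?_ (Dvd.intro_left _ rfl)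
        obtain ⟨c, hc⟩ := hp i
        rcases h : a s with _ | m
        · simp
        · rw [hc, Nat.add_sub_cancel]
          exact ⟨c * (((m + 1 : ℕ) : R) * ζ s), by ring⟩
    · by_cases hs : s = B j
      · simp [hs, haB]
      · simp [A, hs]

end

section
variable {V k R : Type*} [Fintype V] [DecidableEq V] [Field k] [CommRing R] [Algebra k R]

lemma wt_dvd (p : R) (η : V → R) (w : V → ℕ) (hw : ∀ s, p ^ w s ∣ η s) (N : ℕ)
    (g : MvPolynomial V k) (h : ∀ e, coeff e g ≠ 0 → N ≤ ∑ s, e s * w s) :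
    p ^ N ∣ aeval η g := by
  rw [aeval_def, eval₂_eq']
  refine Finset.dvd_sum fun e he => Dvd.dvd.mul_left ?_ _
  refine (pow_dvd_pow p (h e (mem_support_iff.mp he))).trans ?_
  rw [← Finset.prod_pow_eq_pow_sum]
  refine Finset.prod_dvd_prod_of_dvd _ _ fun s _ => ?_
  rw [mul_comm, pow_mul]
  exact pow_dvd_pow_of_dvd (hw s) _

lemma wt_single (w : V → ℕ) (t : V) (e : V →₀ ℕ) :
    ∑ s, (Finsupp.single t 1 + e : V →₀ ℕ) s * w s = w t + ∑ s, e s * w s := by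
  simp [add_mul, Finset.sum_add_distrib, Finsupp.single_apply]

lemma exists_split (e : V →₀ ℕ) (he : e ≠ 0) : ∃ t e', e = Finsupp.single t 1 + e' := by
  obtain ⟨t, ht⟩ : ∃ t, e t ≠ 0 := by
    by_contra h; push Not at h; exact he (Finsupp.ext h)
  refine ⟨t, e - Finsupp.single t 1, ?_⟩
  ext w
  by_cases hw : t = w
  · subst hw; simp; omega
  · simp [Finsupp.single_apply, hw]

lemma order_case1 (p : R) (f : V → MvPolynomial V k) (η : V → R)
    (S : Finset V) (s0 : V) (hs0 : s0 ∉ S) (hz : ∀ v, v ∉ S → v ≠ s0 → η v = 0)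
    (h1 : ∀ s ∈ S, coeff 0 (f s) = 0)
    (hx : ∀ s ∈ S, coeff (Finsupp.single s0 1) (f s) = 0)
    (hH : (Matrix.of fun s t : S => coeff (Finsupp.single t.1 1) (f s.1)).det ≠ 0)
    (b : ℕ) (hb1 : 1 ≤ b) (hbS : ∀ s ∈ S, p ^ b ∣ η s) (hbn : ∃ s ∈ S, ¬ p ^ (b + 1) ∣ η s)
    (hb0 : p ^ (b / 2 + 1) ∣ η s0) : ∃ l ∈ S, ¬ p ^ (b + 1) ∣ aeval η (f l) := by
  by_contra hcon
  push Not at hcon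
  let w : V → ℕ := fun v => if v ∈ S then b else if v = s0 then b / 2 + 1 else b + 1
  have hw : ∀ s, p ^ w s ∣ η s := by
    intro s
    by_cases h : s ∈ S
    · simpa [w, h] using hbS s h
    · by_cases h' : s = s0
      · subst h'; simpa [w, h] using hb0
      · rw [hz s h h']; exact dvd_zero _
  have hwb : ∀ s, b / 2 + 1 ≤ w s := by intro s; simp only [w]; split_ifs <;> omega
  have key : ∀ l ∈ S, p ^ (b + 1) ∣ ∑ t : S, algebraMap k R (coeff (Finsupp.single t.1 1) (f l)) * η t.1 := by
    intro l hl
    have h2 : p ^ (b + 1) ∣ aeval η (f l - ∑ t : S, C (coeff (Finsupp.single t.1 1) (f l)) * X t.1) := by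
      refine wt_dvd p η w hw _ _ fun e he => ?_
      by_cases he0 : e = 0
      · subst he0
        exfalso; apply he
        rw [coeff_sub, h1 l hl, coeff_sum, Finset.sum_eq_zero]; · simp
        intro t _; rw [coeff_C_mul, coeff_zero_X, mul_zero]
      obtain ⟨t, e', rfl⟩ := exists_split e he0
      rw [wt_single]
      by_cases he1 : e' = 0
      · subst he1
        by_cases ht : t ∈ S
        · exfalso; apply he
          rw [coeff_sub, coeff_sum, Finset.sum_eq_single ⟨t, ht⟩]
          · simp [coeff_C_mul, coeff_X']
          · intro t' _ ht'
            have : t'.1 ≠ t := fun h => ht' (Subtype.ext h)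
            simp [coeff_C_mul, coeff_X', this, Finsupp.single_left_inj]
          · simp
        · by_cases ht0 : t = s0
          · subst ht0
            exfalso; apply he
            rw [add_zero, coeff_sub, coeff_sum, hx l hl, Finset.sum_eq_zero]; · simp
            intro t' _
            have : t'.1 ≠ t := fun h => hs0 (h ▸ t'.2)
            simp [coeff_C_mul, coeff_X', this, Finsupp.single_left_inj]
          · simp [w, ht, ht0]
      · obtain ⟨t', e'', rfl⟩ := exists_split e' he1
        rw [wt_single]
        have := hwb t; have := hwb t'
        omega
    rw [map_sub] at h2
    have h3 := dvd_sub (hcon l hl) h2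
    simpa using h3
  set H : Matrix S S k := Matrix.of fun s t : S => coeff (Finsupp.single t.1 1) (f s.1) with hHdef
  set y : S → R := fun t => η t.1 with hy
  have h4 : ∀ s : S, p ^ (b + 1) ∣ ((H.map (algebraMap k R)).mulVec y) s := by
    intro s
    simpa [Matrix.mulVec, dotProduct, H] using key s.1 s.2
  obtain ⟨s, hs, hns⟩ := hbn
  apply hns
  have h5 : p ^ (b + 1) ∣ ((H.map (algebraMap k R)).adjugate.mulVec ((H.map (algebraMap k R)).mulVec y)) ⟨s, hs⟩ := by
    rw [Matrix.mulVec, dotProduct]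
    exact Finset.dvd_sum fun t _ => Dvd.dvd.mul_left (h4 t) _
  rw [Matrix.mulVec_mulVec, Matrix.adjugate_mul, Matrix.smul_mulVec, Matrix.one_mulVec] at h5
  have h6 : (H.map (algebraMap k R)).det = algebraMap k R H.det := by
    rw [RingHom.map_det]; rfl
  rw [h6, Pi.smul_apply, smul_eq_mul] at h5
  have hu : IsUnit (algebraMap k R H.det) := (IsUnit.mk0 _ hH).map _
  exact (hu.dvd_mul_left).mp h5

lemma order_case2 [IsDomain R] (p : R) (hp : Prime p) (f : MvPolynomial V k) (η : V → R)
    (S : Finset V) (s0 : V) (hs0 : s0 ∉ S) (hz : ∀ v, v ∉ S → v ≠ s0 → η v = 0)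
    (h1 : coeff 0 f = 0)
    (hx : ∀ s, s ∈ S ∨ s = s0 → coeff (Finsupp.single s 1) f = 0)
    (h3 : coeff (Finsupp.single s0 1 + Finsupp.single s0 1) f ≠ 0)
    (a : ℕ) (ha1 : 1 ≤ a) (haS : ∀ s ∈ S, p ^ (2 * a) ∣ η s) (ha0 : p ^ a ∣ η s0)
    (han : ¬ p ^ (a + 1) ∣ η s0) : ¬ p ^ (2 * a + 1) ∣ aeval η f := by
  intro hcon
  let w : V → ℕ := fun v => if v ∈ S then 2 * a else if v = s0 then a else 2 * a + 1
  have hw : ∀ s, p ^ w s ∣ η s := by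
    intro s
    by_cases h : s ∈ S
    · simpa [w, h] using haS s h
    · by_cases h' : s = s0
      · subst h'; simpa [w, h] using ha0
      · rw [hz s h h']; exact dvd_zero _
  have hwa : ∀ s, a ≤ w s := by intro s; simp only [w]; split_ifs <;> omega
  have hwb : ∀ s, s ≠ s0 → 2 * a ≤ w s := by
    intro s hs; simp only [w, if_neg hs]; split_ifs <;> omega
  set c := coeff (Finsupp.single s0 1 + Finsupp.single s0 1) f with hc
  have h2 : p ^ (2 * a + 1) ∣ aeval η (f - monomial (Finsupp.single s0 1 + Finsupp.single s0 1) c) := by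
    refine wt_dvd p η w hw _ _ fun e he => ?_
    rw [coeff_sub, coeff_monomial] at he
    by_cases he0 : e = 0
    · subst he0
      exfalso; apply he
      rw [h1, if_neg (by simp)]; simp
    obtain ⟨t, e', rfl⟩ := exists_split e he0
    rw [wt_single]
    by_cases he1 : e' = 0
    · subst he1
      by_cases ht : t ∈ S ∨ t = s0
      · exfalso; apply he
        rw [add_zero, hx t ht, if_neg]; · simp
        intro h
        have := congrArg (fun e : V →₀ ℕ => ∑ s, e s) h
        simp [Finset.sum_add_distrib, Finsupp.single_apply] at this
      · push Not at ht
        simp [w, ht]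
    · obtain ⟨t', e'', rfl⟩ := exists_split e' he1
      rw [wt_single]
      by_cases ht : t = s0
      · by_cases ht' : t' = s0
        · by_cases he2 : e'' = 0
          · subst ht ht' he2
            simp [hc] at he
          · obtain ⟨t'', e3, rfl⟩ := exists_split e'' he2
            rw [wt_single]
            have := hwa t; have := hwa t'; have := hwa t''
            omega
        · have := hwb t' ht'; have := hwa t; omega
      · have := hwb t ht; have := hwa t'; omega
  rw [map_sub] at h2
  have h4 : p ^ (2 * a + 1) ∣ algebraMap k R c * (η s0 * η s0) := by
    have := dvd_sub hcon h2
    rw [sub_sub_cancel, aeval_monomial] at this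
    rwa [Finsupp.prod_add_index' (by simp) (by intros; rw [pow_add]), Finsupp.prod_single_index (by simp), pow_one] at this
  have hu : IsUnit (algebraMap k R c) := (IsUnit.mk0 _ h3).map _
  rw [hu.dvd_mul_left] at h4
  obtain ⟨ζ, hζ⟩ := ha0
  have hpζ : ¬ p ∣ ζ := by
    rintro ⟨c, rfl⟩
    exact han ⟨c, by rw [hζ]; ring⟩
  obtain ⟨x, hx⟩ := h4
  have : p ^ (2 * a) * (ζ * ζ) = p ^ (2 * a) * (p * x) := by
    calc _ = η s0 * η s0 := by rw [hζ]; ring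
      _ = _ := by rw [hx]; ring
  have h5 := mul_left_cancel₀ (pow_ne_zero _ hp.ne_zero) this
  rcases hp.dvd_or_dvd ⟨x, h5⟩ with h | h <;> exact hpζ h

lemma order [IsDomain R] (p : R) (hp : Prime p)
    (hfin : ∀ x : R, x ≠ 0 → ∃ m, p ^ m ∣ x ∧ ¬ p ^ (m + 1) ∣ x)
    (f : V → MvPolynomial V k) (η : V → R) (hη : ∀ v, p ∣ η v) (hne : ∃ v, η v ≠ 0)
    (S : Finset V) (s0 : V) (hs0 : s0 ∉ S) (hz : ∀ v, v ∉ S → v ≠ s0 → η v = 0)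
    (ex : Prop) (hex : ¬ ex → η s0 = 0)
    (hcard : 3 ≤ S.card ∨ (2 ≤ S.card ∧ ex))
    (h1 : ∀ s, s ∈ S ∨ s = s0 → coeff 0 (f s) = 0)
    (hx : ∀ s ∈ S, coeff (Finsupp.single s0 1) (f s) = 0)
    (hx' : ∀ s, s ∈ S ∨ s = s0 → coeff (Finsupp.single s 1) (f s0) = 0)
    (hH : (Matrix.of fun s t : S => coeff (Finsupp.single t.1 1) (f s.1)).det ≠ 0)
    (h3 : ex → coeff (Finsupp.single s0 1 + Finsupp.single s0 1) (f s0) ≠ 0) :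
    ∃ (l : V) (e : ℕ) (a : V → ℕ), (l ∈ S ∨ (l = s0 ∧ ex)) ∧ (∀ s, p ^ a s ∣ η s) ∧ a l = 0 ∧
      (∀ v, v ∉ S → (ex → v ≠ s0) → a v = 0) ∧ ¬ p ^ (e + 1) ∣ aeval η (f l) ∧
      e + 1 ≤ ∑ s, a s := by
  classical
  have hS : 2 ≤ S.card := by omega
  have c2 : ∀ a, (∀ s ∈ S, p ^ (2 * a) ∣ η s) → p ^ a ∣ η s0 → ¬ p ^ (a + 1) ∣ η s0 →
      ∃ (l : V) (e : ℕ) (a : V → ℕ), (l ∈ S ∨ (l = s0 ∧ ex)) ∧ (∀ s, p ^ a s ∣ η s) ∧ a l = 0 ∧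
      (∀ v, v ∉ S → (ex → v ≠ s0) → a v = 0) ∧ ¬ p ^ (e + 1) ∣ aeval η (f l) ∧
      e + 1 ≤ ∑ s, a s := by
    intro a haS ha0 han
    have ha1 : 1 ≤ a := by
      by_contra h
      have : a = 0 := by omega
      subst this; exact han (by simpa using hη s0)
    have hex' : ex := by
      by_contra h; rw [hex h] at han; exact han (dvd_zero _)
    refine ⟨s0, 2 * a, fun v => if v ∈ S then 2 * a else 0, Or.inr ⟨rfl, hex'⟩, ?_, by simp [hs0],
      ?_, order_case2 p hp (f s0) η S s0 hs0 hz (h1 s0 (Or.inr rfl)) hx' (h3 hex') a ha1 haS ha0 han, ?_⟩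
    · intro s
      by_cases h : s ∈ S
      · simpa [h] using haS s h
      · simp [h]
    · intro v hv _; simp [hv]
    · simp only [Finset.sum_ite_mem, Finset.univ_inter, Finset.sum_const, smul_eq_mul]
      nlinarith
  by_cases hall : ∀ s ∈ S, η s = 0
  · obtain ⟨v, hv⟩ := hne
    have : v = s0 := by
      by_contra h
      by_cases h' : v ∈ S
      · exact hv (hall v h')
      · exact hv (hz v h' h)
    subst this
    obtain ⟨a, ha, ha'⟩ := hfin _ hv
    exact c2 a (fun s hs => by rw [hall s hs]; exact dvd_zero _) ha ha'
  push Not at hall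
  have hP : ∃ m, ∃ s ∈ S, ¬ p ^ (m + 1) ∣ η s := by
    obtain ⟨s, hs, hs'⟩ := hall
    obtain ⟨m, _, hm⟩ := hfin _ hs'
    exact ⟨m, s, hs, hm⟩
  let b := Nat.find hP
  have hbn := Nat.find_spec hP
  have hb1 : 1 ≤ b := by
    by_contra h
    have h0 : b = 0 := by omega
    obtain ⟨s, hs, h'⟩ := hbn
    have h'' : ¬ p ^ (b + 1) ∣ η s := h'
    rw [h0] at h''
    exact h'' (by simpa using hη s)
  have hbS : ∀ s ∈ S, p ^ b ∣ η s := by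
    intro s hs
    have := Nat.find_min hP (m := b - 1) (by show b - 1 < b; omega)
    push Not at this
    have h := this s hs
    rwa [Nat.sub_add_cancel hb1] at h
  by_cases hb0 : p ^ (b / 2 + 1) ∣ η s0
  · obtain ⟨l, hl, hl'⟩ := order_case1 p f η S s0 hs0 hz (fun s hs => h1 s (Or.inl hs)) hx hH b hb1
      hbS hbn hb0
    refine ⟨l, b, fun v => if v ∈ S.erase l then b else if v = s0 ∧ ex then b / 2 + 1 else 0,
      Or.inl hl, ?_, ?_, ?_, hl', ?_⟩
    · intro s
      simp only
      split_ifs with h h'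
      · exact hbS s (Finset.mem_of_mem_erase h)
      · rw [h'.1]; exact hb0
      · simp
    · have : l ≠ s0 := fun h => hs0 (h ▸ hl)
      simp [this]
    · intro v hv hv'
      have : ¬ (v = s0 ∧ ex) := fun h => hv' h.2 h.1
      simp [hv, this]
    · have hc : (S.erase l).card = S.card - 1 := Finset.card_erase_of_mem hl
      by_cases hex' : ex
      · have h7 : ∑ v ∈ insert s0 (S.erase l), (if v ∈ S.erase l then b else if v = s0 ∧ ex then b / 2 + 1 else 0)
          = (b / 2 + 1) + (S.card - 1) * b := by
          rw [Finset.sum_insert (by simp [hs0]), if_neg (by simp [hs0]), if_pos ⟨rfl, hex'⟩,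
            Finset.sum_congr rfl (g := fun _ => b) (by intro x hx; rw [if_pos hx])]
          simp [hc]
        refine le_trans ?_ (Finset.sum_le_sum_of_subset (Finset.subset_univ (insert s0 (S.erase l))))
        rw [h7]
        have : b ≤ (S.card - 1) * b := Nat.le_mul_of_pos_left _ (by omega)
        omega
      · have h8 : 3 ≤ S.card := by tauto
        refine le_trans ?_ (Finset.sum_le_sum_of_subset (Finset.subset_univ (S.erase l)))
        rw [Finset.sum_congr rfl (g := fun _ => b) (by intro x hx; rw [if_pos hx])]
        simp only [Finset.sum_const, hc, smul_eq_mul]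
        have : 2 * b ≤ (S.card - 1) * b := Nat.mul_le_mul_right _ (by omega)
        omega
  · have h0 : η s0 ≠ 0 := by intro h; rw [h] at hb0; exact hb0 (dvd_zero _)
    obtain ⟨a, ha, ha'⟩ := hfin _ h0
    have hab : a ≤ b / 2 := by
      by_contra h
      exact hb0 ((pow_dvd_pow p (by omega)).trans ha)
    exact c2 a (fun s hs => (pow_dvd_pow p (by omega)).trans (hbS s hs)) ha ha'

end

end DC

namespace DC

lemma swap {K0 k F : Type*} {ι : Type} [Finite ι] [Field K0] [Field k] [Field F] [Algebra K0 k]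
    [Algebra k F] [Algebra K0 F] [IsScalarTower K0 k F] [IsAlgClosed k] (c : ι → k)
    (hc : AlgebraicIndependent K0 c) (g : ι → F)
    (hg : ∀ i, algebraMap k F (c i) ∈ Algebra.adjoin K0 (Set.range g)) :
    AlgebraicIndependent K0 g ∧ ∀ i, ∃ r, g i = algebraMap k F r := by
  let A := Algebra.adjoin K0 (Set.range g)
  let c' : ι → A := fun i => ⟨algebraMap k F (c i), hg i⟩
  let g' : ι → A := fun i => ⟨g i, Algebra.subset_adjoin ⟨i, rfl⟩⟩
  have hc1 : AlgebraicIndependent K0 (fun i => algebraMap k F (c i)) :=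
    hc.map' (f := IsScalarTower.toAlgHom K0 k F) (algebraMap k F).injective
  have hc' : AlgebraicIndependent K0 c' := by
    exact (AlgHom.algebraicIndependent_iff A.val Subtype.val_injective).mp hc1
  have htop : Algebra.adjoin K0 (Set.range g') = ⊤ := by
    have : Set.range g' = ((↑) : A → F) ⁻¹' (Set.range g) := by
      ext x; constructor
      · rintro ⟨i, rfl⟩; exact ⟨i, rfl⟩
      · rintro ⟨i, hi⟩; exact ⟨i, Subtype.ext hi⟩
    rw [this]; exact Algebra.adjoin_adjoin_coe_preimage
  have halg : Algebra.IsAlgebraic (Algebra.adjoin K0 (Set.range g')) A := by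
    constructor
    intro a
    have ha : a ∈ Algebra.adjoin K0 (Set.range g') := by rw [htop]; trivial
    exact isAlgebraic_algebraMap (⟨a, ha⟩ : Algebra.adjoin K0 (Set.range g'))
  have hgb : IsTranscendenceBasis K0 g' :=
    Algebra.IsAlgebraic.isTranscendenceBasis_of_lift_le_trdeg_of_finite K0 g'
      hc'.lift_cardinalMk_le_trdeg
  have hcb : IsTranscendenceBasis K0 c' :=
    hc'.isTranscendenceBasis_of_lift_trdeg_le_of_finite hgb.lift_cardinalMk_eq_trdeg.ge
  refine ⟨hgb.1.map' (f := A.val) Subtype.val_injective, fun i => ?_⟩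
  have := hcb.isAlgebraic
  obtain ⟨P, hP0, hP⟩ := this.isAlgebraic (g' i)
  let S := Algebra.adjoin K0 (Set.range c')
  have hS : ∀ s : S, ∃ r : k, ((s : A) : F) = algebraMap k F r := by
    rintro ⟨s, hs⟩
    have h1 : S ≤ ((IsScalarTower.toAlgHom K0 k F).range).comap A.val := by
      refine Algebra.adjoin_le ?_
      rintro _ ⟨i, rfl⟩
      exact ⟨c i, rfl⟩
    obtain ⟨r, hr⟩ := h1 hs
    exact ⟨r, hr.symm⟩
  have : IsAlgebraic k (g i) := by
    choose r hr using hS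
    let φ : S →+* F := (A.val : A →+* F).comp S.subtype
    let Q : Polynomial F := P.map φ
    have hQ0 : Q ≠ 0 := (Polynomial.map_ne_zero_iff (by
      intro a b h; exact Subtype.ext (Subtype.ext h))).mpr hP0
    have hQl : Q ∈ Polynomial.lifts (algebraMap k F) := by
      rw [Polynomial.lifts_iff_coeff_lifts]
      intro m
      exact ⟨r (P.coeff m), by rw [← hr]; simp [Q, φ]⟩
    obtain ⟨P', hP'⟩ := hQl
    refine ⟨P', ?_, ?_⟩
    · rintro rfl
      exact hQ0 (by rw [← hP']; simp)
    · rw [Polynomial.aeval_def, Polynomial.eval₂_eq_eval_map]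
      have hP'' : P'.map (algebraMap k F) = Q := hP'
      rw [hP'', Polynomial.eval_map]
      have := congrArg (fun x : A => (x : F)) hP
      rw [Polynomial.aeval_def] at this
      have h2 := Polynomial.hom_eval₂ P (algebraMap S A) (A.val : A →+* F) (g' i)
      exact h2.symm.trans this
  have hmem := IsAlgClosed.algebraMap_bijective_of_isIntegral (k := k) (K := algebraicClosure k F)
  obtain ⟨r, hr⟩ := hmem.2 ⟨g i, mem_algebraicClosure_iff.mpr this⟩
  exact ⟨r, (congrArg Subtype.val hr).symm⟩

end DC

namespace DC

section normalform
variable {V : Type} [Fintype V] [DecidableEq V] {A A' : Type*} [CommRing A] [CommRing A']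

noncomputable def Hs (f : MvPolynomial V A) (s t : V) : A :=
  constantCoeff (pderiv s (pderiv t f))

noncomputable def cub (f : MvPolynomial V A) (κ : V → A) : A :=
  (aeval (fun v => Polynomial.C (κ v) * Polynomial.X) f : Polynomial A).coeff 3

lemma Hs_symm (f : MvPolynomial V A) (s t : V) : Hs f s t = Hs f t s := by
  rw [Hs, Hs, constantCoeff_eq]
  rw [coeff_pderiv, coeff_pderiv, coeff_pderiv, coeff_pderiv, zero_add, zero_add, add_comm]
  by_cases h : s = t
  · subst h; rfl
  · simp [Finsupp.single_apply, h, Ne.symm h]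

lemma Hs_ne (f : MvPolynomial V A) (s t : V) (h : s ≠ t) :
    Hs f s t = coeff (Finsupp.single s 1 + Finsupp.single t 1) f := by
  rw [Hs, constantCoeff_eq, coeff_pderiv, coeff_pderiv, zero_add]
  simp [Finsupp.single_apply, h]

lemma Hs_self (h2 : (2 : A) = 0) (f : MvPolynomial V A) (s : V) : Hs f s s = 0 := by
  rw [Hs, constantCoeff_eq, coeff_pderiv, coeff_pderiv, zero_add]
  have : ((1:A) + 1) = 0 := by rw [← h2]; norm_num
  simp [this]

lemma coeff_single (f : MvPolynomial V A) (i : V) (m : ℕ) :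
    coeff (Finsupp.single i m) f =
      (aeval (fun v => if v = i then Polynomial.X else 0) f : Polynomial A).coeff m := by
  induction f using MvPolynomial.induction_on' with
  | add p q hp hq => simp [hp, hq]
  | monomial e a =>
    rw [aeval_monomial, coeff_monomial, Finsupp.prod_fintype _ _ (by simp)]
    by_cases he : e = Finsupp.single i (e i)
    · rw [Finset.prod_eq_single i]
      · simp only [if_true]
        have : (algebraMap A (Polynomial A) a) = Polynomial.C a := rfl
        rw [this, Polynomial.coeff_C_mul, Polynomial.coeff_X_pow]
        by_cases hm : m = e i
        · subst hm; rw [if_pos he]; simp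
        · rw [if_neg, if_neg hm]; simp
          intro h; apply hm; rw [h]; simp
      · intro v _ hv
        have : e v = 0 := by rw [he]; simp [Finsupp.single_apply, hv.symm]
        simp [this]
      · simp
    · rw [if_neg (by intro h; apply he; rw [h]; simp)]
      have : ∃ v, v ≠ i ∧ e v ≠ 0 := by
        by_contra hcon
        push Not at hcon
        apply he
        ext v
        by_cases hv : v = i
        · subst hv; simp
        · rw [hcon v hv]; simp [Finsupp.single_apply, Ne.symm hv]
      obtain ⟨v, hv, hev⟩ := this
      rw [Finset.prod_eq_zero (Finset.mem_univ v) (by simp [hv, hev])]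
      simp

lemma Hs_map (φ : A →+* A') (f : MvPolynomial V A) (s t : V) : Hs (map φ f) s t = φ (Hs f s t) := by
  simp only [Hs, pderiv_map, constantCoeff_map]

lemma cub_map (φ : A →+* A') (f : MvPolynomial V A) (κ : V → A) :
    cub (map φ f) (fun v => φ (κ v)) = φ (cub f κ) := by
  rw [cub, cub, ← Polynomial.coeff_map]
  congr 1
  induction f using MvPolynomial.induction_on with
  | C a => simp
  | add p q hp hq => simp only [map_add, Polynomial.map_add, hp, hq]
  | mul_X p i hp => simp [hp]

lemma cub_smul (f : MvPolynomial V A) (κ : V → A) (a : A) :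
    cub f (fun v => a * κ v) = cub f κ * a ^ 3 := by
  rw [cub, cub, ← Polynomial.comp_C_mul_X_coeff]
  congr 1
  induction f using MvPolynomial.induction_on with
  | C a => simp
  | add p q hp hq => simp only [map_add, Polynomial.add_comp, hp, hq]
  | mul_X p i hp =>
    rw [map_mul, map_mul, hp, aeval_X, aeval_X, Polynomial.mul_comp]
    simp; ring

noncomputable def kap (f : MvPolynomial V A) (S : Finset V) (s0 : V) (v : V) : A :=
  if v = s0 then (Matrix.of fun s t : S => Hs f s.1 t.1).det else
  if h : v ∈ S then ((Matrix.of fun s t : S => Hs f s.1 t.1).adjugate.mulVec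
    (fun s => Hs f s.1 s0)) ⟨v, h⟩ else 0

lemma kap_map (φ : A →+* A') (f : MvPolynomial V A) (S : Finset V) (s0 : V) (v : V) :
    kap (map φ f) S s0 v = φ (kap f S s0 v) := by
  have h1 : (Matrix.of fun s t : S => Hs (map φ f) s.1 t.1)
      = φ.mapMatrix (Matrix.of fun s t : S => Hs f s.1 t.1) := by
    ext s t; simp [Hs_map]
  have h2 : (fun s : S => Hs (map φ f) s.1 s0) = φ ∘ (fun s : S => Hs f s.1 s0) := by
    ext s; simp [Hs_map]
  simp only [kap]
  rw [h1, h2, ← RingHom.map_det, ← RingHom.map_adjugate]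
  split_ifs with a b
  · rfl
  · rw [RingHom.map_mulVec]; rfl
  · simp

noncomputable def Gf {k : Type*} [Field k] (f : MvPolynomial V k) (S : Finset V) (s0 : V) (ex : Prop)
    (s v : V) : k := by
  classical
  exact if s ∈ S then (if s = v then 1 else 0) else if s = s0 ∧ ex then
    (Matrix.of fun s t : S => Hs f s.1 t.1).det⁻¹ * kap f S s0 v else 0

lemma normal_form {k : Type*} [Field k] (h2 : (2 : k) = 0) (f : MvPolynomial V k) (S : Finset V)
    (s0 : V) (ex : Prop) (hs0 : s0 ∉ S)
    (hgr : ∀ s, s ∈ S ∨ (s = s0 ∧ ex) → constantCoeff (pderiv s f) = 0)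
    (hdet : (Matrix.of fun s t : S => Hs f s.1 t.1).det ≠ 0)
    (hcub : ex → cub f (kap f S s0) ≠ 0) (ft : MvPolynomial V k)
    (hft : ft = aeval (fun v => ∑ s, C (Gf f S s0 ex s v) * X s) f) :
    (∀ s, s ∈ S ∨ s = s0 → coeff 0 (pderiv s ft) = 0) ∧
    (∀ s ∈ S, coeff (Finsupp.single s0 1) (pderiv s ft) = 0) ∧
    (∀ s, s ∈ S ∨ s = s0 → coeff (Finsupp.single s 1) (pderiv s0 ft) = 0) ∧
    (Matrix.of fun s t : S => coeff (Finsupp.single t.1 1) (pderiv s.1 ft)).det ≠ 0 ∧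
    (ex → coeff (Finsupp.single s0 1 + Finsupp.single s0 1) (pderiv s0 ft) ≠ 0) := by
  classical
  set G := Gf f S s0 ex with hG
  set M := (Matrix.of fun s t : S => Hs f s.1 t.1) with hM
  set L : V → MvPolynomial V k := fun v => ∑ s, C (G s v) * X s with hL
  have hdL : ∀ s v, pderiv s (L v) = C (G s v) := by
    intro s v
    simp only [hL, map_sum, pderiv_C_mul, pderiv_X]
    rw [Finset.sum_eq_single s]
    · simp
    · intro t _ ht; simp [Pi.single_apply, ht]
    · simp
  have hcc : ∀ p : MvPolynomial V k, constantCoeff (aeval L p) = constantCoeff p := by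
    intro p
    induction p using MvPolynomial.induction_on with
    | C a => simp
    | add p q hp hq => simp only [map_add, hp, hq]
    | mul_X p i hp => simp [hp, hL]
  have hd1 : ∀ (p : MvPolynomial V k) s, pderiv s (aeval L p) = ∑ v, aeval L (pderiv v p) * C (G s v) := by
    intro p s
    rw [chain]; simp only [hdL]
  have hc0 : ∀ s, constantCoeff (pderiv s ft) = ∑ v, constantCoeff (pderiv v f) * G s v := by
    intro s
    rw [hft, hd1, map_sum]
    exact Finset.sum_congr rfl fun v _ => by rw [map_mul, hcc, constantCoeff_C]
  have hc1 : ∀ s t, coeff (Finsupp.single t 1) (pderiv s ft)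
      = ∑ v, (∑ w, Hs f w v * G t w) * G s v := by
    intro s t
    have : coeff (Finsupp.single t 1) (pderiv s ft) = constantCoeff (pderiv t (pderiv s ft)) := by
      rw [constantCoeff_eq, coeff_pderiv (pderiv s ft)]; simp
    rw [this, hft, hd1, map_sum, map_sum]
    refine Finset.sum_congr rfl fun v _ => ?_
    rw [mul_comm, pderiv_C_mul, hd1]
    rw [map_mul, map_sum, constantCoeff_C, mul_comm]
    congr 1
    exact Finset.sum_congr rfl fun w _ => by rw [map_mul, hcc, constantCoeff_C, Hs]
  have hGS : ∀ s ∈ S, ∀ v, G s v = if s = v then 1 else 0 := by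
    intro s hs v; simp [hG, Gf, hs]
  have hG0 : ¬ ex → ∀ v, G s0 v = 0 := by
    intro h v; simp [hG, Gf, hs0, h]
  have hG1 : ex → ∀ v, G s0 v = M.det⁻¹ * kap f S s0 v := by
    intro h v; simp [hG, Gf, hs0, h, hM]
  have hsS : ∀ s ∈ S, ∀ y : V → k, ∑ v, y v * G s v = y s := by
    intro s hs y
    rw [Finset.sum_eq_single s]
    · simp [hGS s hs]
    · intro t _ ht; simp [hGS s hs, ht.symm]
    · simp
  have hk1 : ex → ∀ s ∈ S, ∑ w, Hs f w s * G s0 w = 0 := by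
    intro he s hs
    have e1 : ∑ w, Hs f w s * G s0 w = Hs f s0 s * G s0 s0 + ∑ w ∈ S, Hs f w s * G s0 w := by
      rw [← Finset.sum_insert (f := fun w => Hs f w s * G s0 w) hs0]
      symm
      apply Finset.sum_subset (Finset.subset_univ _)
      intro x _ hx
      rw [Finset.mem_insert] at hx; push Not at hx
      rw [hG1 he, kap, if_neg hx.1, dif_neg hx.2]; simp
    have e2 : G s0 s0 = 1 := by
      rw [hG1 he, kap, if_pos rfl]; exact inv_mul_cancel₀ hdet
    have e3 : ∑ w ∈ S, Hs f w s * G s0 w = Hs f s s0 := by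
      have : M.mulVec (M.adjugate.mulVec (fun s => Hs f s.1 s0)) ⟨s, hs⟩ = M.det * Hs f s s0 := by
        rw [Matrix.mulVec_mulVec, Matrix.mul_adjugate, Matrix.smul_mulVec, Matrix.one_mulVec]; rfl
      rw [← Finset.sum_coe_sort]
      have e4 : ∀ w : S, Hs f w s * G s0 w = M.det⁻¹ * (M ⟨s, hs⟩ w *
          (M.adjugate.mulVec (fun s => Hs f s.1 s0)) w) := by
        intro w
        have hw : w.1 ≠ s0 := fun h => hs0 (h ▸ w.2)
        rw [hG1 he, kap, if_neg hw, dif_pos w.2, Hs_symm, hM]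
        simp only [Matrix.of_apply]; ring
      rw [Finset.sum_congr rfl (fun w _ => e4 w), ← Finset.mul_sum]
      have e5 : ∑ w : S, M ⟨s, hs⟩ w * (M.adjugate.mulVec (fun s => Hs f s.1 s0)) w
         = M.det * Hs f s s0 := this
      rw [e5, ← mul_assoc, inv_mul_cancel₀ hdet, one_mul]
    rw [e1, e2, e3, Hs_symm, mul_one, ← two_mul, h2, zero_mul]
  have hx : ∀ s ∈ S, coeff (Finsupp.single s0 1) (pderiv s ft) = 0 := by
    intro s hs
    rw [hc1, hsS s hs]
    by_cases he : ex
    · exact hk1 he s hs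
    · simp [hG0 he]
  refine ⟨?_, hx, ?_, ?_, ?_⟩
  · rintro s (hs | rfl)
    · rw [← constantCoeff_eq, hc0, hsS s hs]; exact hgr s (Or.inl hs)
    · rw [← constantCoeff_eq, hc0]
      by_cases he : ex
      · refine Finset.sum_eq_zero fun v _ => ?_
        by_cases hv : v ∈ S ∨ v = s
        · rw [hgr v (hv.imp id fun h => ⟨h, he⟩), zero_mul]
        · push Not at hv
          rw [hG1 he, kap, if_neg hv.2, dif_neg hv.1]; simp
      · simp [hG0 he]
  · have key : ∀ s t, coeff (Finsupp.single t 1) (pderiv s ft) = Hs ft t s := by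
      intro s t
      rw [Hs, constantCoeff_eq, coeff_pderiv (pderiv s ft)]; simp
    rintro s (hs | rfl)
    · rw [key, Hs_symm, ← key]; exact hx s hs
    · rw [key, Hs_self h2]
  · have : (Matrix.of fun s t : S => coeff (Finsupp.single t.1 1) (pderiv s.1 ft)) = M := by
      ext s t
      rw [Matrix.of_apply, hc1, hsS s.1 s.2, hsS t.1 t.2, Hs_symm]; rfl
    rw [this]; exact hdet
  · intro he
    rw [coeff_pderiv]
    have e1 : (((Finsupp.single s0 1 + Finsupp.single s0 1 : V →₀ ℕ) s0 : k) + 1) = 1 := by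
      simp [one_add_one_eq_two, h2]
    rw [e1, mul_one]
    have e2 : (Finsupp.single s0 1 + Finsupp.single s0 1 + Finsupp.single s0 1 : V →₀ ℕ)
      = Finsupp.single s0 3 := by simp [← Finsupp.single_add]
    rw [e2, coeff_single, hft]
    have e3 : (aeval (fun v => if v = s0 then (Polynomial.X : Polynomial k) else 0) (aeval L f))
      = aeval (fun v => Polynomial.C (G s0 v) * Polynomial.X) f := by
      rw [← AlgHom.comp_apply, comp_aeval]
      congr 2
      ext1 v
      simp only [hL, map_sum, map_mul, aeval_X, mul_ite, mul_zero]
      simp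
    rw [e3]
    intro h0
    apply hcub he
    have e4 : cub f (G s0) = 0 := h0
    have e5 : kap f S s0 = fun v => M.det * G s0 v := by
      ext v; rw [hG1 he, ← mul_assoc, mul_inv_cancel₀ hdet, one_mul]
    rw [e5, cub_smul, e4, zero_mul]

lemma JI_det (S : Finset V) (hS : Even S.card) (M : Matrix S S (ZMod 2))
    (hM : ∀ s t, M s t = if s = t then 0 else 1) : M.det ≠ 0 := by
  have h : M * M = 1 := by
    ext s t
    have e1 : ∀ w : S, M s w * M w t = 1 + (if s = w then 1 else 0) + (if w = t then 1 else 0)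
       + (if s = w then (if w = t then 1 else 0) else 0) := by
      intro w
      rw [hM, hM]; split_ifs <;> decide
    have hc : ((Fintype.card S : ℕ) : ZMod 2) = 0 := by
      rw [Fintype.card_coe]; exact hS.natCast_zmod_two
    rw [Matrix.mul_apply, Finset.sum_congr rfl (fun w _ => e1 w)]
    simp only [Finset.sum_add_distrib, Finset.sum_ite_eq, Finset.sum_ite_eq', Finset.mem_univ, if_true]
    simp only [Finset.sum_const, Finset.card_univ, nsmul_eq_mul, hc, Matrix.one_apply]
    split_ifs <;> decide
  intro h0
  have := congrArg Matrix.det h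
  rw [Matrix.det_mul, h0, Matrix.det_one] at this
  simp at this

end normalform
end DC

namespace DC

def Ms (n : ℕ) (dg : Fin 2 → ℕ) : Type :=
  {e : (Fin n ⊕ Fin 2) →₀ ℕ // ∀ j, (∑ v, if ty v = j then e v else 0) = dg j}

instance (n : ℕ) (dg : Fin 2 → ℕ) : Finite (Ms n dg) := by
  have : Set.Finite {e : (Fin n ⊕ Fin 2) →₀ ℕ | ∀ j, (∑ v, if ty v = j then e v else 0) = dg j} := by
    refine (Set.finite_Iic (Finsupp.equivFunOnFinite.symm fun v => dg (ty v))).subset ?_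
    intro e he
    rw [Set.mem_Iic]
    intro v
    rw [Finsupp.equivFunOnFinite_symm_apply_apply, ← he (ty v)]
    have := Finset.single_le_sum (f := fun w => if ty w = ty v then e w else 0)
      (fun i _ => Nat.zero_le _) (Finset.mem_univ v)
    simpa using this
  exact this.to_subtype

noncomputable instance (n : ℕ) (dg : Fin 2 → ℕ) : Fintype (Ms n dg) := Fintype.ofFinite _
noncomputable instance (n : ℕ) (dg : Fin 2 → ℕ) : DecidableEq (Ms n dg) := Classical.decEq _

noncomputable def bOf {n : ℕ} {dg : Fin 2 → ℕ} {k : Type*} [CommRing k] (c : Ms n dg → k) :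
    MvPolynomial (Fin n ⊕ Fin 2) k := ∑ e, monomial e.1 (c e)

lemma coeff_bOf {n : ℕ} {dg : Fin 2 → ℕ} {k : Type*} [CommRing k] (c : Ms n dg → k) (e : Ms n dg) :
    coeff e.1 (bOf c) = c e := by
  classical
  rw [bOf, coeff_sum, Finset.sum_eq_single e]
  · simp
  · intro b _ hb
    rw [coeff_monomial, if_neg (fun h => hb (Subtype.ext h))]
  · simp

lemma BH_bOf {n : ℕ} {dg : Fin 2 → ℕ} {k : Type*} [CommRing k] (c : Ms n dg → k) :
    BH dg (bOf c) := by
  classical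
  intro e he
  by_contra hcon
  rw [mem_support_iff] at he
  apply he
  rw [bOf, coeff_sum]
  refine Finset.sum_eq_zero fun b _ => ?_
  rw [coeff_monomial, if_neg]
  rintro rfl
  exact hcon b.2

lemma eq_bOf {n : ℕ} {dg : Fin 2 → ℕ} {k : Type*} [CommRing k] {p : MvPolynomial (Fin n ⊕ Fin 2) k}
    (hp : BH dg p) : p = bOf (fun e : Ms n dg => coeff e.1 p) := by
  classical
  ext e
  by_cases he : ∀ j, (∑ v, if ty v = j then e v else 0) = dg j
  · exact (coeff_bOf (fun e : Ms n dg => coeff e.1 p) ⟨e, he⟩).symm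
  · rw [notMem_support_iff.mp (fun h => he (hp e h)),
      notMem_support_iff.mp (fun h => he (BH_bOf _ e h))]

lemma map_bOf {n : ℕ} {dg : Fin 2 → ℕ} {k k' : Type*} [CommRing k] [CommRing k'] (φ : k →+* k')
    (c : Ms n dg → k) : map φ (bOf c) = bOf (fun e => φ (c e)) := by
  simp [bOf, map_monomial]

section
variable {n : ℕ} (B : Fin 2 → Fin n ⊕ Fin 2) {F : Type*} [CommRing F]

noncomputable def fl (e : (Fin n ⊕ Fin 2) →₀ ℕ) : (Fin n ⊕ Fin 2) →₀ ℕ := e.filter (fun v => v ≠ B (ty v))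

noncomputable def sh (q : Fin n ⊕ Fin 2 → F) :
    MvPolynomial (Fin n ⊕ Fin 2) F →ₐ[F] MvPolynomial (Fin n ⊕ Fin 2) F :=
  aeval fun v => if v = B (ty v) then X v else X v + C (q v) * X (B (ty v))

noncomputable def dh : MvPolynomial (Fin n ⊕ Fin 2) F →ₐ[F] MvPolynomial (Fin n ⊕ Fin 2) F :=
  aeval fun v => if v = B (ty v) then 1 else X v

noncomputable def locp (q : Fin n ⊕ Fin 2 → F) :
    MvPolynomial (Fin n ⊕ Fin 2) F →ₐ[F] MvPolynomial (Fin n ⊕ Fin 2) F :=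
  aeval fun v => if v = B (ty v) then 1 else X v + C (q v)

variable (hB : ∀ j, ty (B j) = j)
include hB

lemma BB (j : Fin 2) : B (ty (B j)) = B j := by rw [hB]

lemma dh_sh (q : Fin n ⊕ Fin 2 → F) (p : MvPolynomial (Fin n ⊕ Fin 2) F) :
    dh B (sh B q p) = locp B q p := by
  rw [← AlgHom.comp_apply]
  congr 1
  ext1 v
  simp only [dh, sh, locp, AlgHom.comp_apply, aeval_X]
  split_ifs with h
  · rw [aeval_X, if_pos h]
  · simp [h, hB, algebraMap_eq]

lemma sh_sh (q : Fin n ⊕ Fin 2 → F) (p : MvPolynomial (Fin n ⊕ Fin 2) F) :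
    sh B (fun v => - q v) (sh B q p) = p := by
  rw [← AlgHom.comp_apply]
  conv_rhs => rw [← AlgHom.id_apply (R := F) p]
  congr 1
  ext1 v
  simp only [sh, AlgHom.comp_apply, aeval_X, AlgHom.id_apply]
  split_ifs with h
  · rw [aeval_X, if_pos h]
  · simp [h, hB, algebraMap_eq]

lemma sum_split (e : (Fin n ⊕ Fin 2) →₀ ℕ) (j : Fin 2) :
    (∑ v, if ty v = j then e v else 0) = e (B j) + ∑ v, if ty v = j then fl B e v else 0 := by
  classical
  have : ∀ v, (if ty v = j then e v else 0) =
      (if v = B j then e (B j) else 0) + if ty v = j then fl B e v else 0 := by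
    intro v
    rw [fl, Finsupp.filter_apply]
    by_cases hv : ty v = j
    · subst hv
      by_cases h : v = B (ty v)
      · simp [← h]
      · simp [h]
    · have : v ≠ B j := fun h => hv (by rw [h, hB])
      simp [hv, this]
  rw [Finset.sum_congr rfl (fun v _ => this v), Finset.sum_add_distrib]
  simp

lemma fl_inj {dg : Fin 2 → ℕ} (e e' : Ms n dg) (h : fl B e.1 = fl B e'.1) : e = e' := by
  apply Subtype.ext
  ext v
  by_cases hv : v = B (ty v)
  · have h1 := e.2 (ty v)
    have h2 := e'.2 (ty v)
    rw [sum_split B hB] at h1 h2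
    rw [h] at h1
    rw [hv]; omega
  · have := DFunLike.congr_fun h v
    simpa [fl, Finsupp.filter_apply, hv] using this

lemma exists_hom {dg : Fin 2 → ℕ} (ε : (Fin n ⊕ Fin 2) →₀ ℕ) (h0 : ∀ j, ε (B j) = 0)
    (hε : ∀ j, (∑ v, if ty v = j then ε v else 0) ≤ dg j) : ∃ e : Ms n dg, fl B e.1 = ε := by
  classical
  let e := ε + ∑ j, Finsupp.single (B j) (dg j - ∑ v, if ty v = j then ε v else 0)
  have hBi : ∀ i j, B i = B j ↔ i = j :=
    fun i j => ⟨fun h => by rw [← hB i, h, hB], fun h => h ▸ rfl⟩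
  have he : ∀ j, e (B j) = dg j - ∑ v, if ty v = j then ε v else 0 := by
    intro j
    simp only [e, Finsupp.add_apply, Finsupp.finsetSum_apply, h0, zero_add, Finsupp.single_apply]
    simp [hBi]
  have hf : fl B e = ε := by
    ext v
    rw [fl, Finsupp.filter_apply]
    by_cases hv : v = B (ty v)
    · rw [if_neg (by simpa using hv), hv, h0]
    · rw [if_pos hv]
      simp only [e, Finsupp.add_apply, Finsupp.finsetSum_apply, Finsupp.single_apply]
      rw [Finset.sum_eq_zero]; simp
      intro j _
      rw [if_neg]
      rintro rfl
      exact hv (by rw [hB])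
  refine ⟨⟨e, fun j => ?_⟩, hf⟩
  rw [sum_split B hB, hf, he]
  have := hε j
  omega

lemma dh_monomial (e : (Fin n ⊕ Fin 2) →₀ ℕ) (a : F) : dh B (monomial e a) = monomial (fl B e) a := by
  classical
  rw [dh, aeval_monomial, monomial_eq, Finsupp.prod_fintype _ _ (by simp),
    Finsupp.prod_fintype _ _ (by simp)]
  rw [algebraMap_eq]
  congr 1
  refine Finset.prod_congr rfl fun v _ => ?_
  rw [fl, Finsupp.filter_apply]
  by_cases h : v = B (ty v)
  · rw [if_pos h, if_neg (by simpa using h)]; simp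
  · rw [if_neg h, if_pos h]

lemma BH_sh {dg : Fin 2 → ℕ} (q : Fin n ⊕ Fin 2 → F) {p : MvPolynomial (Fin n ⊕ Fin 2) F}
    (hp : BH dg p) : BH dg (sh B q p) := by
  have key : ∀ j, IsWeightedHomogeneous (fun v : Fin n ⊕ Fin 2 => if ty v = j then 1 else 0)
      (sh B q p) (dg j) := by
    intro j
    rw [p.as_sum, map_sum]
    refine IsWeightedHomogeneous.sum _ _ _ fun e he => ?_
    rw [sh, aeval_monomial, Finsupp.prod_fintype _ _ (by simp), ← hp e he j, algebraMap_eq, ← zero_add (∑ v, _)]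
    refine (isWeightedHomogeneous_C _ _).mul (IsWeightedHomogeneous.prod _ _ _ fun v _ => ?_)
    have h1 : IsWeightedHomogeneous (fun v : Fin n ⊕ Fin 2 => if ty v = j then 1 else 0)
      (if v = B (ty v) then X v else X v + C (q v) * X (B (ty v)) : MvPolynomial (Fin n ⊕ Fin 2) F)
        (if ty v = j then 1 else 0) := by
      split_ifs with h h' h'
      · simpa [h'] using isWeightedHomogeneous_X F (fun v : Fin n ⊕ Fin 2 => if ty v = j then 1 else 0) v
      · simpa [h'] using isWeightedHomogeneous_X F (fun v : Fin n ⊕ Fin 2 => if ty v = j then 1 else 0) v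
      all_goals
        refine IsWeightedHomogeneous.add ?_ ?_
        · simpa [h'] using isWeightedHomogeneous_X F (fun v : Fin n ⊕ Fin 2 => if ty v = j then 1 else 0) v
        · have := (isWeightedHomogeneous_C (fun v : Fin n ⊕ Fin 2 => if ty v = j then 1 else 0) (q v)).mul
            (isWeightedHomogeneous_X F (fun v : Fin n ⊕ Fin 2 => if ty v = j then 1 else 0) (B (ty v)))
          simpa [hB, h'] using this
    convert h1.pow (e v) using 1
    split_ifs <;> simp
  intro e he j
  have := key j (mem_support_iff.mp he)
  rw [← this, Finsupp.weight_apply, Finsupp.sum_fintype _ _ (by simp)]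
  exact Finset.sum_congr rfl fun v _ => by split_ifs <;> simp

end
end DC

namespace DC

lemma coeffs_mem {V K F : Type*} [Fintype V] [Field K] [Field F] [Algebra K F] (A : Subalgebra K F)
    (L : V → MvPolynomial V F) (hL : ∀ v e, coeff e (L v) ∈ A) (p : MvPolynomial V F)
    (hp : ∀ e, coeff e p ∈ A) (e : V →₀ ℕ) : coeff e (aeval L p) ∈ A := by
  have hm : ∀ p : MvPolynomial V F, (∀ e, coeff e p ∈ A) → ∃ P : MvPolynomial V A, map A.val.toRingHom P = p := by
    intro p hp
    refine ⟨∑ e ∈ p.support, monomial e ⟨coeff e p, hp e⟩, ?_⟩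
    rw [map_sum]
    conv_rhs => rw [p.as_sum]
    exact Finset.sum_congr rfl fun e _ => by rw [map_monomial]; rfl
  obtain ⟨P, rfl⟩ := hm p hp
  choose Q hQ using fun v => hm (L v) (hL v)
  have : aeval L (map A.val.toRingHom P) = map A.val.toRingHom (aeval Q P) := by
    clear hp
    induction P using MvPolynomial.induction_on with
    | C a => simp [algebraMap_eq]
    | add p q hp hq => simp only [map_add, hp, hq]
    | mul_X p i hp => simp only [map_mul, hp, map_X, aeval_X, hQ]
  rw [this, coeff_map]
  exact (coeff e (aeval Q P)).2

section
variable {n : ℕ} {dg : Fin 2 → ℕ} (B : Fin 2 → Fin n ⊕ Fin 2)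

def lin (e : Ms n dg) : Prop := ∃ s, fl B e.1 = Finsupp.single s 1

open Classical in
noncomputable def fgen (n : ℕ) (dg : Fin 2 → ℕ) (B : Fin 2 → Fin n ⊕ Fin 2) :
    MvPolynomial (Fin n ⊕ Fin 2) (MvPolynomial (Ms n dg) (ZMod 2)) :=
  ∑ e : Ms n dg, if lin B e then 0 else monomial (fl B e.1) (X e)

variable (hB : ∀ j, ty (B j) = j)
include hB

lemma coeff_fgen (e : Ms n dg) (he : ¬ lin B e) : coeff (fl B e.1) (fgen n dg B) = X e := by
  classical
  rw [fgen, coeff_sum, Finset.sum_eq_single e]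
  · rw [if_neg he, coeff_monomial, if_pos rfl]
  · intro e' _ hne
    split_ifs
    · simp
    · rw [coeff_monomial, if_neg]
      intro h; exact hne (fl_inj B hB _ _ h)
  · simp

lemma lin_grad {F : Type*} [Field F] (b : MvPolynomial (Fin n ⊕ Fin 2) F) (q : Fin n ⊕ Fin 2 → F)
    (hq : ∀ j, q (B j) = 1) (s : Fin n ⊕ Fin 2) (hs : s ≠ B (ty s)) :
    constantCoeff (pderiv s (locp B q b)) = aeval q (pderiv s b) := by
  classical
  rw [locp, chain]
  have hcc : ∀ p : MvPolynomial (Fin n ⊕ Fin 2) F, constantCoeff (aeval (fun v : Fin n ⊕ Fin 2 =>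
      if v = B (ty v) then 1 else X v + C (q v)) p) = aeval q p := by
    intro p
    induction p using MvPolynomial.induction_on with
    | C a => simp [algebraMap_eq]
    | add p q hp hq => simp only [map_add, hp, hq]
    | mul_X p i hp =>
      rw [map_mul, map_mul, map_mul, hp, aeval_X, aeval_X]
      congr 1
      split_ifs with h
      · rw [h, hq]; simp
      · simp
  rw [Finset.sum_eq_single s]
  · rw [if_neg hs]
    simp only [map_mul, hcc, map_add, pderiv_X_self, pderiv_C]
    simp
  · intro v _ hv
    split_ifs
    · simp
    · simp [pderiv_X, Pi.single_apply, hv]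
  · simp

lemma fgen_nondeg (h0 : 3 ≤ dg 0) (h1 : 2 ≤ dg 1) (S : Finset (Fin n ⊕ Fin 2))
    (s0 : Fin n ⊕ Fin 2) (ex : Prop) (hs0 : s0 ∉ S) (hS : Even S.card)
    (hSB : ∀ v, v ∈ S → v ≠ B (ty v)) (hex : ex → s0 ≠ B (ty s0) ∧ ty s0 = 0) :
    (Matrix.of fun s t : S => Hs (fgen n dg B) s.1 t.1).det ≠ 0 ∧
    (ex → cub (fgen n dg B) (kap (fgen n dg B) S s0) ≠ 0) := by
  classical
  have hdg : ∀ j, 2 ≤ dg j := by intro j; fin_cases j <;> simp <;> omega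
  let P := MvPolynomial (Ms n dg) (ZMod 2)
  have hnb : ∀ s, s ≠ B (ty s) → ∀ m j, (Finsupp.single s m : (Fin n ⊕ Fin 2) →₀ ℕ) (B j) = 0 := by
    intro s hs m j
    rw [Finsupp.single_apply, if_neg]
    rintro rfl; exact hs (by rw [hB])
  have hdeg : ∀ (s : Fin n ⊕ Fin 2) m j, (∑ v, if ty v = j then
      (Finsupp.single s m : (Fin n ⊕ Fin 2) →₀ ℕ) v else 0) = if ty s = j then m else 0 := by
    intro s m j
    rw [Finset.sum_eq_single s]
    · simp
    · intro v _ hv; simp [Finsupp.single_apply, hv.symm]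
    · simp
  have hq : ∀ s t, s ≠ t → s ≠ B (ty s) → t ≠ B (ty t) → ∃ e : Ms n dg,
      fl B e.1 = Finsupp.single s 1 + Finsupp.single t 1 ∧ ¬ lin B e := by
    intro s t hst hs ht
    obtain ⟨e, he⟩ := exists_hom (dg := dg) B hB (Finsupp.single s 1 + Finsupp.single t 1)
      (by intro j; rw [Finsupp.add_apply, hnb s hs, hnb t ht])
      (by
        intro j
        have : ∀ v, (if ty v = j then (Finsupp.single s 1 + Finsupp.single t 1 : (Fin n ⊕ Fin 2) →₀ ℕ) v
          else 0) = (if ty v = j then (Finsupp.single s 1 : (Fin n ⊕ Fin 2) →₀ ℕ) v else 0) +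
          (if ty v = j then (Finsupp.single t 1 : (Fin n ⊕ Fin 2) →₀ ℕ) v else 0) := by
          intro v; split_ifs <;> simp
        rw [Finset.sum_congr rfl (fun v _ => this v), Finset.sum_add_distrib, hdeg, hdeg]
        have := hdg j
        split_ifs <;> omega)
    refine ⟨e, he, ?_⟩
    rintro ⟨w, hw⟩
    have h1 := congrArg Finsupp.degree (he.symm.trans hw)
    simp at h1
  let spec : Ms n dg → ZMod 2 := fun e =>
    if (∃ s t, s ∈ S ∧ t ∈ S ∧ s ≠ t ∧ fl B e.1 = Finsupp.single s 1 + Finsupp.single t 1) ∨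
      fl B e.1 = Finsupp.single s0 3 then 1 else 0
  let φ : P →+* ZMod 2 := (aeval spec : P →ₐ[ZMod 2] ZMod 2).toRingHom
  let f1 := map φ (fgen n dg B)
  have hf1 : ∀ e : Ms n dg, ¬ lin B e → coeff (fl B e.1) f1 = spec e := by
    intro e he
    rw [coeff_map, coeff_fgen B hB e he]; exact aeval_X _ _
  have hM : ∀ s t : S, Hs f1 s.1 t.1 = if s = t then 0 else 1 := by
    intro s t
    split_ifs with hst
    · subst hst; exact Hs_self (by decide) _ _
    · have hst' : s.1 ≠ t.1 := fun h => hst (Subtype.ext h)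
      rw [Hs_ne _ _ _ hst']
      obtain ⟨e, he, hl⟩ := hq s t hst' (hSB _ s.2) (hSB _ t.2)
      rw [← he, hf1 e hl]
      simp only [spec]
      rw [if_pos]
      exact Or.inl ⟨s, t, s.2, t.2, hst', he⟩
  have hdet : (Matrix.of fun s t : S => Hs f1 s.1 t.1).det ≠ 0 := JI_det S hS _ hM
  constructor
  · intro h
    apply hdet
    have : (Matrix.of fun s t : S => Hs f1 s.1 t.1)
      = φ.mapMatrix (Matrix.of fun s t : S => Hs (fgen n dg B) s.1 t.1) := by
      ext s t; simp [f1, Hs_map]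
    rw [this, ← RingHom.map_det, h, map_zero]
  · intro he h
    obtain ⟨hs0B, hs0t⟩ := hex he
    have hd1 : (Matrix.of fun s t : S => Hs f1 s.1 t.1).det = 1 := by
      revert hdet
      generalize (Matrix.of fun s t : S => Hs f1 s.1 t.1).det = x
      revert x; decide
    have hh : ∀ s : S, Hs f1 s.1 s0 = 0 := by
      intro s
      have hne : s.1 ≠ s0 := fun h => hs0 (h ▸ s.2)
      rw [Hs_ne _ _ _ hne]
      obtain ⟨e, he, hl⟩ := hq s s0 hne (hSB _ s.2) hs0B
      rw [← he, hf1 e hl]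
      simp only [spec]
      rw [if_neg]
      rintro (⟨a, b, ha, hb, hab, h⟩ | h)
      · rw [he] at h
        have h1 := DFunLike.congr_fun h s0
        have ha' : a ≠ s0 := fun h => hs0 (h ▸ ha)
        have hb' : b ≠ s0 := fun h => hs0 (h ▸ hb)
        simp [Finsupp.single_apply, ha', hb', hne] at h1
      · rw [he] at h
        have h1 := congrArg Finsupp.degree h
        simp at h1
    have hkap : kap f1 S s0 = fun v => if v = s0 then 1 else 0 := by
      ext v
      rw [kap, hd1]
      split_ifs with h1 h2
      · rfl
      · have : (fun s : S => Hs f1 s.1 s0) = 0 := funext hh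
        rw [this, Matrix.mulVec_zero]; rfl
      · rfl
    have hc : cub f1 (kap f1 S s0) = φ (cub (fgen n dg B) (kap (fgen n dg B) S s0)) := by
      rw [← cub_map]
      congr 1
      ext v; rw [kap_map]
    rw [h, map_zero, hkap, cub] at hc
    have e1 : (fun v : Fin n ⊕ Fin 2 => Polynomial.C (if v = s0 then (1 : ZMod 2) else 0) * Polynomial.X)
      = fun v => if v = s0 then Polynomial.X else 0 := by
      ext1 v; split_ifs <;> simp
    rw [e1, ← coeff_single] at hc
    obtain ⟨e, he'⟩ := exists_hom (dg := dg) B hB (Finsupp.single s0 3) (hnb s0 hs0B 3)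
      (by intro j; rw [hdeg]; split_ifs with h
          · rw [← h, hs0t]; exact h0
          · omega)
    have hl : ¬ lin B e := by
      rintro ⟨w, hw⟩
      have h1 := congrArg Finsupp.degree (he'.symm.trans hw)
      simp at h1
    rw [← he', hf1 e hl] at hc
    simp only [spec] at hc
    rw [if_pos (Or.inr he')] at hc
    exact one_ne_zero hc

end
end DC

namespace DC

lemma locp_map {n : ℕ} (B : Fin 2 → Fin n ⊕ Fin 2) {k F : Type*} [CommRing k] [CommRing F] (φ : k →+* F)
    (r : Fin n ⊕ Fin 2 → k) (b : MvPolynomial (Fin n ⊕ Fin 2) k) :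
    locp B (fun v => φ (r v)) (map φ b) = map φ (locp B r b) := by
  induction b using MvPolynomial.induction_on with
  | C a => simp [algebraMap_eq]
  | add p q hp hq => simp only [map_add, hp, hq]
  | mul_X p i hp =>
    rw [map_mul, map_mul, map_mul, map_mul, hp, map_X]
    congr 1
    simp only [locp, aeval_X]
    split_ifs <;> simp

theorem crit {n : ℕ} {dg : Fin 2 → ℕ} (hn : 3 ≤ n) (h0 : 3 ≤ dg 0) (h1 : 2 ≤ dg 1)
    {k F : Type*} [Field k] [Field F] [Algebra (ZMod 2) k] [IsAlgClosed k] [Algebra k F]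
    (c : Ms n dg → k) (hc : AlgebraicIndependent (ZMod 2) c) (B : Fin 2 → Fin n ⊕ Fin 2)
    (hB : ∀ j, ty (B j) = j) (q : Fin n ⊕ Fin 2 → F) (hq : ∀ j, q (B j) = 1)
    (hcrit : ∀ v, aeval q (pderiv v (bOf c)) = 0) :
    ∃ (r : Fin n ⊕ Fin 2 → k) (S : Finset (Fin n ⊕ Fin 2)) (s0 : Fin n ⊕ Fin 2) (ex : Prop),
      (∀ v, q v = algebraMap k F (r v)) ∧ s0 ∉ S ∧ (∀ v, v ∈ S ∨ (v = s0 ∧ ex) ↔ v ≠ B (ty v)) ∧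
      (¬ ex → s0 = B 0) ∧ (3 ≤ S.card ∨ (2 ≤ S.card ∧ ex)) ∧
      (∀ s, s ∈ S ∨ (s = s0 ∧ ex) → constantCoeff (pderiv s (locp B r (bOf c))) = 0) ∧
      (Matrix.of fun s t : S => Hs (locp B r (bOf c)) s.1 t.1).det ≠ 0 ∧
      (ex → cub (locp B r (bOf c)) (kap (locp B r (bOf c)) S s0) ≠ 0) := by
  classical
  letI : Algebra (ZMod 2) F := ((algebraMap k F).comp (algebraMap (ZMod 2) k)).toAlgebra
  haveI : IsScalarTower (ZMod 2) k F := IsScalarTower.of_algebraMap_eq fun x => rfl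
  have hdg : ∀ j, 1 ≤ dg j := by intro j; fin_cases j <;> simp <;> omega
  set bF : MvPolynomial (Fin n ⊕ Fin 2) F := map (algebraMap k F) (bOf c) with hbF
  have hbF' : bF = bOf (fun e => algebraMap k F (c e)) := map_bOf _ _
  set b' := sh B q bF with hb'
  have hb'H : BH dg b' := BH_sh B hB q (by rw [hbF']; exact BH_bOf _)
  have hcF : ∀ s, s ≠ B (ty s) → constantCoeff (pderiv s (locp B q bF)) = 0 := by
    intro s hs
    rw [lin_grad B hB bF q hq s hs, hbF, pderiv_map, aeval_map_algebraMap, hcrit]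
  have hdh : locp B q bF = ∑ e : Ms n dg, monomial (fl B e.1) (coeff e.1 b') := by
    rw [← dh_sh B hB, ← hb', eq_bOf hb'H, bOf, map_sum]
    refine Finset.sum_congr rfl fun e _ => ?_
    rw [dh_monomial B hB]
    congr 1
    exact (coeff_bOf (fun e : Ms n dg => coeff e.1 b') e).symm
  have hflB : ∀ e : Ms n dg, ∀ s, fl B e.1 = Finsupp.single s 1 → s ≠ B (ty s) := by
    intro e s h hs
    have := DFunLike.congr_fun h s
    rw [fl, Finsupp.filter_apply, if_neg (by simpa using hs)] at this
    simp at this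
  have hlin : ∀ e : Ms n dg, lin B e → coeff e.1 b' = 0 := by
    rintro e ⟨s, hs⟩
    have h1 := hcF s (hflB e s hs)
    rw [constantCoeff_eq, coeff_pderiv, zero_add, hdh, coeff_sum, Finset.sum_eq_single e] at h1
    · rw [hs] at h1; simpa using h1
    · intro e' _ hne
      rw [coeff_monomial, if_neg]
      intro h; exact hne (fl_inj B hB _ _ (by rw [h, hs]))
    · simp
  let g : Ms n dg → F := fun e => if h : lin B e then q h.choose else coeff e.1 b'
  have hgl : ∀ (e : Ms n dg) s, fl B e.1 = Finsupp.single s 1 → g e = q s := by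
    intro e s hs
    have hl : lin B e := ⟨s, hs⟩
    have h1 := hs.symm.trans hl.choose_spec
    have : s = hl.choose := by
      have := DFunLike.congr_fun h1 s
      by_contra hne
      simp [Finsupp.single_apply, Ne.symm hne] at this
    simp only [g, dif_pos hl]
    rw [← this]
  have hes : ∀ s, s ≠ B (ty s) → ∃ e : Ms n dg, fl B e.1 = Finsupp.single s 1 := by
    intro s hs
    refine exists_hom B hB _ ?_ ?_
    · intro j
      rw [Finsupp.single_apply, if_neg]
      rintro rfl; exact hs (by rw [hB])
    · intro j
      rw [Finset.sum_eq_single s]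
      · have := hdg j; split_ifs <;> simp <;> omega
      · intro v _ hv; simp [Finsupp.single_apply, hv.symm]
      · simp
  have hmem : ∀ e, algebraMap k F (c e) ∈ Algebra.adjoin (ZMod 2) (Set.range g) := by
    intro e
    have e1 : algebraMap k F (c e) = coeff e.1 (sh B (fun v => - q v) b') := by
      rw [hb', sh_sh B hB, hbF', coeff_bOf]
    rw [e1, sh]
    apply coeffs_mem
    · intro v ε
      split_ifs with hv
      · rw [coeff_X']; split_ifs
        · exact one_mem _
        · exact zero_mem _
      · obtain ⟨e', he'⟩ := hes v hv
        have hqv : q v ∈ Algebra.adjoin (ZMod 2) (Set.range g) :=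
          Algebra.subset_adjoin ⟨e', hgl e' v he'⟩
        rw [coeff_add, coeff_C_mul, coeff_X', coeff_X']
        refine add_mem ?_ (mul_mem (neg_mem hqv) ?_)
        · split_ifs
          · exact one_mem _
          · exact zero_mem _
        · split_ifs
          · exact one_mem _
          · exact zero_mem _
    · intro ε
      by_cases hε : ∀ j, (∑ v, if ty v = j then ε v else 0) = dg j
      · by_cases hl : lin B (⟨ε, hε⟩ : Ms n dg)
        · rw [hlin ⟨ε, hε⟩ hl]; exact zero_mem _
        · refine Algebra.subset_adjoin ⟨⟨ε, hε⟩, ?_⟩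
          simp only [g, dif_neg hl]
      · rw [notMem_support_iff.mp (fun h => hε (hb'H ε h))]; exact zero_mem _
  obtain ⟨hgi, hgk⟩ := swap c hc g hmem
  choose gk hgk using hgk
  have hqr : ∀ v, ∃ r, q v = algebraMap k F r := by
    intro v
    by_cases hv : v = B (ty v)
    · exact ⟨1, by rw [hv, hq, map_one]⟩
    · obtain ⟨e, he⟩ := hes v hv
      exact ⟨gk e, by rw [← hgl e v he, hgk]⟩
  choose r hr using hqr
  have hgki : Function.Injective (aeval gk : MvPolynomial (Ms n dg) (ZMod 2) →ₐ[ZMod 2] k) := by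
    have h2 : AlgebraicIndependent (ZMod 2) gk :=
      (AlgHom.algebraicIndependent_iff (IsScalarTower.toAlgHom (ZMod 2) k F)
        (algebraMap k F).injective).mp (by
          have : (IsScalarTower.toAlgHom (ZMod 2) k F) ∘ gk = g := by
            ext e; exact (hgk e).symm
          rw [this]; exact hgi)
    exact h2
  have hfmap : locp B q bF = map (algebraMap k F) (locp B r (bOf c)) := by
    rw [← locp_map, ← hbF]; congr 2; ext v; exact hr v
  set f := locp B r (bOf c) with hf
  let φ : MvPolynomial (Ms n dg) (ZMod 2) →+* k :=
    (aeval gk : MvPolynomial (Ms n dg) (ZMod 2) →ₐ[ZMod 2] k).toRingHom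
  have hfg : f = map φ (fgen n dg B) := by
    apply map_injective _ (algebraMap k F).injective
    rw [← hfmap, hdh, fgen, map_sum, map_sum]
    refine Finset.sum_congr rfl fun e _ => ?_
    split_ifs with hl
    · rw [hlin e hl]; simp
    · rw [map_monomial, map_monomial]
      congr 1
      have e1 : φ (X e) = gk e := aeval_X _ _
      rw [e1, ← hgk]
      simp only [g, dif_neg hl]
  have hgr : ∀ s, s ≠ B (ty s) → constantCoeff (pderiv s f) = 0 := by
    intro s hs
    have := hcF s hs
    rw [hfmap, pderiv_map, constantCoeff_map] at this
    exact (map_eq_zero _).mp this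
  have hnd : ∀ (S : Finset (Fin n ⊕ Fin 2))
    (s0 : Fin n ⊕ Fin 2) (ex : Prop) (hs0 : s0 ∉ S) (hS : Even S.card)
    (hSB : ∀ v, v ∈ S → v ≠ B (ty v)) (hex : ex → s0 ≠ B (ty s0) ∧ ty s0 = 0),
    (Matrix.of fun s t : S => Hs f s.1 t.1).det ≠ 0 ∧ (ex → cub f (kap f S s0) ≠ 0) := by
    intro S s0 ex hs0 hS hSB hex
    obtain ⟨a1, a2⟩ := fgen_nondeg B hB h0 h1 S s0 ex hs0 hS hSB hex
    constructor
    · have : (Matrix.of fun s t : S => Hs f s.1 t.1)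
        = φ.mapMatrix (Matrix.of fun s t : S => Hs (fgen n dg B) s.1 t.1) := by
        ext s t; simp [hfg, Hs_map]
      rw [this, ← RingHom.map_det]
      exact fun h => a1 (hgki (h.trans (map_zero φ).symm))
    · intro he
      have hcc : cub f (kap f S s0) = φ (cub (fgen n dg B) (kap (fgen n dg B) S s0)) := by
        rw [← cub_map, hfg]
        congr 1
        ext v; rw [kap_map]
      rw [hcc]
      exact fun h => a2 he (hgki (h.trans (map_zero φ).symm))
  let σ : Finset (Fin n ⊕ Fin 2) := Finset.univ.filter fun v => v ≠ B (ty v)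
  have hσ : ∀ v, v ∈ σ ↔ v ≠ B (ty v) := by intro v; simp [σ]
  have hσc : σ.card = n := by
    have e1 : Finset.univ.filter (fun v => v = B (ty v)) = Finset.univ.image B := by
      ext v
      simp only [Finset.mem_filter, Finset.mem_univ, true_and, Finset.mem_image]
      constructor
      · intro h; exact ⟨_, h.symm⟩
      · rintro ⟨j, rfl⟩; rw [hB]
    have e2 : (Finset.univ.filter (fun v => v = B (ty v))).card = 2 := by
      rw [e1, Finset.card_image_of_injective _ (fun i j h => by rw [← hB i, h, hB])]; simp
    have e3 := Finset.card_filter_add_card_filter_not (s := (Finset.univ : Finset (Fin n ⊕ Fin 2)))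
      (fun v => v = B (ty v))
    rw [e2] at e3
    simp at e3
    have e4 : σ.card = (Finset.univ.filter fun v : Fin n ⊕ Fin 2 => ¬ v = B (ty v)).card := rfl
    omega
  rcases Nat.even_or_odd n with hev | hod
  · have hs0 : B 0 ∉ σ := by rw [hσ]; simp [hB]
    obtain ⟨a1, a2⟩ := hnd σ (B 0) False hs0 (by rw [hσc]; exact hev) (fun v hv => (hσ v).mp hv)
      (fun h => h.elim)
    refine ⟨r, σ, B 0, False, hr, hs0, ?_, fun _ => rfl, Or.inl (by omega), ?_, a1, a2⟩
    · intro v; simp [hσ]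
    · rintro s (hs | ⟨_, h⟩)
      · exact hgr s ((hσ s).mp hs)
      · exact h.elim
  · have : ∃ i : Fin n, (Sum.inl i : Fin n ⊕ Fin 2) ≠ B 0 := by
      by_contra hcon
      push Not at hcon
      have := (hcon ⟨0, by omega⟩).trans (hcon ⟨1, by omega⟩).symm
      simp at this
    obtain ⟨i, hi⟩ := this
    let s0 : Fin n ⊕ Fin 2 := Sum.inl i
    have hs0 : s0 ∈ σ := by rw [hσ]; exact hi
    have hcard : (σ.erase s0).card = n - 1 := by rw [Finset.card_erase_of_mem hs0, hσc]
    obtain ⟨a1, a2⟩ := hnd (σ.erase s0) s0 True (by simp) (by rw [hcard]; exact Nat.Odd.sub_odd hod odd_one)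
      (fun v hv => (hσ v).mp (Finset.mem_of_mem_erase hv)) (fun _ => ⟨hi, rfl⟩)
    have hor : ∀ v, v ∈ σ.erase s0 ∨ (v = s0 ∧ True) ↔ v ≠ B (ty v) := by
      intro v
      rw [← hσ, Finset.mem_erase]
      constructor
      · rintro (⟨_, h⟩ | ⟨rfl, _⟩)
        · exact h
        · exact hs0
      · intro h
        by_cases hv : v = s0
        · exact Or.inr ⟨hv, trivial⟩
        · exact Or.inl ⟨hv, h⟩
    refine ⟨r, σ.erase s0, s0, True, hr, by simp, hor, fun h => (h trivial).elim,
      Or.inr ⟨by omega, trivial⟩, fun s hs => hgr s ((hor s).mp hs), a1, a2⟩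

end DC

namespace DC

theorem local_lemma {n : ℕ} [NeZero n] {dg : Fin 2 → ℕ} (hn : 3 ≤ n) (h0 : 3 ≤ dg 0) (h1 : 2 ≤ dg 1)
    {k R : Type*} [Field k] [Algebra (ZMod 2) k] [IsAlgClosed k] [CommRing R] [IsDomain R] [Algebra k R]
    (c : Ms n dg → k) (hc : AlgebraicIndependent (ZMod 2) c) (B : Fin 2 → Fin n ⊕ Fin 2)
    (hB : ∀ j, ty (B j) = j) (p : R) (hp : Prime p) (hu : ∀ x, ¬ p ∣ x → IsUnit x)
    (hfin : ∀ x : R, x ≠ 0 → ∃ m, p ^ m ∣ x ∧ ¬ p ^ (m + 1) ∣ x)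
    (D : Fin n → Derivation k R R) (pt : Fin n ⊕ Fin 2 → R) (hpt : ∀ j, pt (B j) = 1)
    (hne : ∃ v, bd (bOf c) pt v ≠ 0) :
    ∃ (ρ : Fin n ⊕ Fin 2 → R) (e : ℕ), p ^ e ∣ (mat D pt ρ).det ∧
      ¬ p ^ (e + 1) ∣ ∑ v, ρ v * bd (bOf c) pt v ∧
      ((∀ i, p ∣ D i p) → (∀ v, p ∣ bd (bOf c) pt v) → p ^ (e + 1) ∣ (mat D pt ρ).det) := by
  classical
  set b := bOf c with hb
  by_cases hcase : ∃ v, ¬ p ∣ bd b pt v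
  · obtain ⟨v, hv⟩ := hcase
    refine ⟨Pi.single v 1, 0, by simp, ?_, fun _ h => (hv (h v)).elim⟩
    rw [Finset.sum_eq_single v]
    · simpa using hv
    · intro w _ hw; simp [Pi.single_apply, hw]
    · simp
  push Not at hcase
  have h2 : (2 : k) = 0 := by
    have := congrArg (algebraMap (ZMod 2) k) (show (2 : ZMod 2) = 0 by decide)
    rw [map_zero] at this
    rw [← this, map_ofNat]
  have hmax : (Ideal.span {p}).IsMaximal := by
    constructor
    constructor
    · rw [Ne, Ideal.span_singleton_eq_top]; exact hp.not_unit
    · intro J hJ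
      obtain ⟨x, hxJ, hx⟩ := SetLike.exists_of_lt hJ
      rw [Ideal.mem_span_singleton] at hx
      exact Ideal.eq_top_of_isUnit_mem _ hxJ (hu x hx)
  letI : Field (R ⧸ Ideal.span {p}) := Ideal.Quotient.field _
  let mk : R →ₐ[k] (R ⧸ Ideal.span {p}) := Ideal.Quotient.mkₐ k _
  have hmk : ∀ x, mk x = 0 ↔ p ∣ x := by
    intro x
    rw [← Ideal.mem_span_singleton]; exact Ideal.Quotient.eq_zero_iff_mem
  have hk : ∀ a : k, p ∣ algebraMap k R a → a = 0 := by
    intro a ha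
    by_contra hne
    exact hp.not_unit (isUnit_of_dvd_unit ha ((Ne.isUnit hne).map _))
  obtain ⟨r, S, s0, ex, hr, hs0, hnb, hnex, hcard, hgr, hdet, hcub⟩ := crit hn h0 h1 c hc B hB
    (fun v => mk (pt v)) (by intro j; rw [hpt, map_one]) (by
      intro v
      have := (hmk _).mpr (hcase v)
      rw [bd, ← AlgHom.comp_apply, comp_aeval] at this
      exact this)
  set f := locp B r b with hf
  set G := Gf f S s0 ex with hG
  set ft : MvPolynomial (Fin n ⊕ Fin 2) k := aeval (fun v => ∑ s, C (G s v) * X s) f with hft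
  obtain ⟨n1, n2, n3, n4, n5⟩ := normal_form h2 f S s0 ex hs0 hgr hdet hcub ft hft
  let y : Fin n ⊕ Fin 2 → R := fun v => pt v - algebraMap k R (r v)
  have hy : ∀ v, p ∣ y v := by
    intro v
    rw [← hmk, map_sub, hr v, AlgHom.commutes, sub_self]
  have hrB : ∀ j, r (B j) = 1 := by
    intro j
    have := hr (B j)
    rw [hpt, map_one] at this
    exact ((algebraMap k (R ⧸ Ideal.span {p})).injective (by rw [← this, map_one]))
  have hyB : ∀ j, y (B j) = 0 := by
    intro j; simp [y, hpt, hrB]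
  have hGS : ∀ s ∈ S, ∀ v, G s v = if s = v then 1 else 0 := by
    intro s hs v; simp [hG, Gf, hs]
  have hGn : ∀ s, s ∉ S → s ≠ s0 → ∀ v, G s v = 0 := by
    intro s hs hs' v; simp [hG, Gf, hs, hs']
  have hG0 : ¬ ex → ∀ v, G s0 v = 0 := by
    intro h v; simp [hG, Gf, hs0, h]
  have hG1 : ex → ∀ v, G s0 v = (Matrix.of fun s t : S => Hs f s.1 t.1).det⁻¹ * kap f S s0 v := by
    intro h v; simp [hG, Gf, hs0, h]
  have hG2 : ex → G s0 s0 = 1 := by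
    intro h; rw [hG1 h, kap, if_pos rfl, inv_mul_cancel₀ hdet]
  have hG3 : ∀ v, v ∉ S → v ≠ s0 → G s0 v = 0 := by
    intro v hv hv'
    by_cases h : ex
    · rw [hG1 h, kap, if_neg hv', dif_neg hv, mul_zero]
    · exact hG0 h v
  let y0 : R := if ex then y s0 else 0
  let η : Fin n ⊕ Fin 2 → R := fun s => if s ∈ S then y s - algebraMap k R (G s0 s) * y0 else
    if s = s0 then y0 else 0
  have hy0 : p ∣ y0 := by simp only [y0]; split_ifs; exacts [hy _, dvd_zero _]
  have hη : ∀ v, p ∣ η v := by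
    intro v; simp only [η]; split_ifs
    · exact dvd_sub (hy _) (dvd_mul_of_dvd_right hy0 _)
    · exact hy0
    · exact dvd_zero _
  have hηs0 : η s0 = y0 := by simp [η, hs0]
  have hηS : ∀ s ∈ S, η s = y s - algebraMap k R (G s0 s) * y0 := by intro s hs; simp [η, hs]
  have hptη : ∀ v, pt v = algebraMap k R (r v) + ∑ s, algebraMap k R (G s v) * η s := by
    intro v
    have e1 : ∑ s, algebraMap k R (G s v) * η s
        = algebraMap k R (G s0 v) * η s0 + ∑ s ∈ S, algebraMap k R (G s v) * η s := by
      rw [← Finset.sum_insert (f := fun s => algebraMap k R (G s v) * η s) hs0]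
      symm
      apply Finset.sum_subset (Finset.subset_univ _)
      intro x _ hx
      rw [Finset.mem_insert] at hx; push Not at hx
      rw [hGn x hx.2 hx.1]; simp
    have e2 : ∑ s ∈ S, algebraMap k R (G s v) * η s = if v ∈ S then η v else 0 := by
      rw [Finset.sum_congr rfl (fun s hs => by rw [hGS s hs])]
      simp
    rw [e1, e2, hηs0]
    suffices h : y v = algebraMap k R (G s0 v) * y0 + if v ∈ S then η v else 0 by
      rw [← h]; simp [y]
    by_cases hv : v ∈ S
    · rw [if_pos hv, hηS v hv]; ring
    · rw [if_neg hv, add_zero]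
      by_cases hv' : v = s0
      · subst hv'
        by_cases he : ex
        · rw [hG2 he]; simp [y0, he]
        · rw [hG0 he, hnex he, hyB]; simp
      · rw [hG3 v hv hv']
        have : v = B (ty v) := by
          by_contra hcon
          rcases (hnb v).mpr hcon with h | h
          · exact hv h
          · exact hv' h.1
        rw [this, hyB]; simp
  have hηne : ∃ v, η v ≠ 0 := by
    by_contra hcon
    push Not at hcon
    obtain ⟨v, hv⟩ := hne
    apply hv
    have e1 : pt = fun v => algebraMap k R (r v) := by
      ext v; rw [hptη]; simp [hcon]
    have e2 : bd b pt v = algebraMap k R (aeval r (pderiv v b)) := by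
      rw [bd, e1]; exact aeval_algebraMap_apply R r _
    have := hcase v
    rw [e2] at this ⊢
    rw [hk _ this, map_zero]
  obtain ⟨l, e, a, hl, ha, hal, haz, hord, hsum⟩ := order p hp hfin (fun s => pderiv s ft) η hη hηne S s0 hs0
    (by intro v hv hv'; simp [η, hv, hv']) ex (by intro he; rw [hηs0]; simp [y0, he]) hcard n1 n2 n3 n4 n5
  have hBS : ∀ j, B j ∉ S ∧ (ex → B j ≠ s0) := by
    intro j
    have := mt (hnb (B j)).mp (by simp [hB])
    push Not at this
    exact ⟨this.1, fun he h => this.2 h he⟩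
  have hlB : ∀ j, l ≠ B j := by
    rintro j rfl
    exact (hnb (B j)).mp hl (by rw [hB])
  obtain ⟨d1, d2⟩ := det_local D pt B hB r G η hptη
    (by
      intro j
      simp only [η, if_neg (hBS j).1]
      split_ifs with h
      · by_cases he : ex
        · exact ((hBS j).2 he h).elim
        · simp [y0, he]
      · rfl) l hlB p a hal (fun j => haz _ (hBS j).1 (hBS j).2) ha
  refine ⟨fun v => algebraMap k R (G l v), e, ?_, ?_, ?_⟩
  · have := (pow_dvd_pow p hsum).trans d1
    rw [pow_succ, mul_comm] at this
    exact (mul_dvd_mul_iff_left hp.ne_zero).mp this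
  · have e1 : ft = aeval (fun v => C (r v) + ∑ s, C (G s v) * X s) b := by
      rw [hft, hf, ← AlgHom.comp_apply]
      congr 1
      ext1 v
      simp only [locp, AlgHom.comp_apply, aeval_X]
      split_ifs with h
      · rw [map_one, h, hrB, Finset.sum_eq_zero, add_zero, C_1]
        intro s _
        by_cases hs : s ∈ S
        · rw [hGS s hs, if_neg (by rintro rfl; exact (hBS _).1 hs)]; simp
        · by_cases hs' : s = s0
          · rw [hs']
            by_cases he : ex
            · rw [hG3 _ (hBS _).1 ((hBS _).2 he)]; simp
            · rw [hG0 he]; simp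
          · rw [hGn s hs hs']; simp
      · simp [algebraMap_eq, add_comm]
    have e2 : aeval η (pderiv l ft) = ∑ v, algebraMap k R (G l v) * bd b pt v := by
      rw [e1, chain, map_sum]
      refine Finset.sum_congr rfl fun v _ => ?_
      rw [map_mul, mul_comm]
      congr 1
      · have : pderiv l (C (r v) + ∑ s, C (G s v) * X s : MvPolynomial (Fin n ⊕ Fin 2) k) = C (G l v) := by
          simp only [map_add, map_sum, pderiv_C, pderiv_C_mul, pderiv_X, zero_add]
          rw [Finset.sum_eq_single l]
          · simp
          · intro t _ ht; simp [Pi.single_apply, ht]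
          · simp
        rw [this]; simp
      · rw [bd, ← AlgHom.comp_apply, comp_aeval]
        congr 2
        ext1 w
        rw [hptη w]; simp
    rw [← e2]; exact hord
  · intro hD _
    exact (pow_dvd_pow p hsum).trans (d2 hD)

end DC

namespace DC

lemma der_ext {k S T : Type*} [CommRing k] [CommRing S] [CommRing T] [Algebra k S] [Algebra k T]
    [Algebra S T] [IsScalarTower k S T] (M : Submonoid S) [IsLocalization M T] (D : Derivation k S T) :
    ∃ D' : Derivation k T T, ∀ s, D' (algebraMap S T s) = D s := by
  let ℓ : Ω[T⁄k] →ₗ[S] T := IsLocalizedModule.lift M (KaehlerDifferential.map k k S T)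
    D.liftKaehlerDifferential (fun x => by
      rw [Module.End.isUnit_iff]
      have hx : IsUnit (algebraMap S T x) := IsLocalization.map_units T x
      obtain ⟨u, hu⟩ := hx
      constructor
      · intro a b h
        simp only [Module.algebraMap_end_apply, Algebra.smul_def] at h
        rw [← hu] at h
        exact (Units.mul_right_inj u).mp h
      · intro a
        refine ⟨↑u⁻¹ * a, ?_⟩
        simp only [Module.algebraMap_end_apply, Algebra.smul_def]
        rw [← hu, Units.mul_inv_cancel_left])
  refine ⟨(ℓ.extendScalarsOfIsLocalization M T).compDer (KaehlerDifferential.D k T), fun s => ?_⟩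
  have h1 : KaehlerDifferential.D k T (algebraMap S T s) = KaehlerDifferential.map k k S T
      (KaehlerDifferential.D k S s) := by simp
  have h2 := LinearMap.congr_fun (IsLocalizedModule.lift_comp M (KaehlerDifferential.map k k S T)
    D.liftKaehlerDifferential (fun x => by
      rw [Module.End.isUnit_iff]
      have hx : IsUnit (algebraMap S T x) := IsLocalization.map_units T x
      obtain ⟨u, hu⟩ := hx
      constructor
      · intro a b h
        simp only [Module.algebraMap_end_apply, Algebra.smul_def] at h
        rw [← hu] at h
        exact (Units.mul_right_inj u).mp h
      · intro a
        refine ⟨↑u⁻¹ * a, ?_⟩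
        simp only [Module.algebraMap_end_apply, Algebra.smul_def]
        rw [← hu, Units.mul_inv_cancel_left])) (KaehlerDifferential.D k S s)
  change ℓ (KaehlerDifferential.D k T (algebraMap S T s)) = D s
  rw [h1]
  exact h2.trans (by simp)

theorem local_lemma' {n : ℕ} [NeZero n] {dg : Fin 2 → ℕ} (hn : 3 ≤ n) (h0 : 3 ≤ dg 0) (h1 : 2 ≤ dg 1)
    {k R : Type*} [Field k] [Algebra (ZMod 2) k] [IsAlgClosed k] [CommRing R] [IsDomain R] [Algebra k R]
    (c : Ms n dg → k) (hc : AlgebraicIndependent (ZMod 2) c) (B : Fin 2 → Fin n ⊕ Fin 2)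
    (hB : ∀ j, ty (B j) = j) (p : R) (hp : Prime p) (hu : ∀ x, ¬ p ∣ x → IsUnit x)
    (hfin : ∀ x : R, x ≠ 0 → ∃ m, p ^ m ∣ x ∧ ¬ p ^ (m + 1) ∣ x)
    (D : Fin n → Derivation k R R) (pt : Fin n ⊕ Fin 2 → R) (hpt : ∀ j, IsUnit (pt (B j)))
    (hne : ∃ v, bd (bOf c) pt v ≠ 0) :
    ∃ (ρ : Fin n ⊕ Fin 2 → R) (e : ℕ), p ^ e ∣ (mat D pt ρ).det ∧
      ¬ p ^ (e + 1) ∣ ∑ v, ρ v * bd (bOf c) pt v ∧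
      ((∀ i, p ∣ D i p) → (∀ v, p ∣ bd (bOf c) pt v) → p ^ (e + 1) ∣ (mat D pt ρ).det) := by
  choose sc hsc using fun j => (hpt j).exists_left_inv
  have hscu : ∀ j, IsUnit (sc j) := fun j => IsUnit.of_mul_eq_one _ (hsc j)
  set pt' : Fin n ⊕ Fin 2 → R := fun v => sc (ty v) * pt v with hpt'
  have hscal := fun v => bd_scale (BH_bOf c) sc pt v
  have hU : IsUnit (sc 0 ^ dg 0 * sc 1 ^ dg 1) := ((hscu 0).pow _).mul ((hscu 1).pow _)
  have hU2 : IsUnit (sc 0 ^ n * sc 1 ^ 2) := ((hscu 0).pow _).mul ((hscu 1).pow _)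
  obtain ⟨v0, hv0⟩ := hne
  obtain ⟨ρ', e, a1, a2, a3⟩ := local_lemma hn h0 h1 c hc B hB p hp hu hfin D pt'
    (by intro j; simp only [hpt', hB, hsc]) ⟨v0, by
      intro h
      have := hscal v0
      rw [← hpt', h, mul_zero] at this
      exact hv0 ((hU.mul_right_eq_zero).mp this.symm)⟩
  set ρ : Fin n ⊕ Fin 2 → R := fun v => pt (B (ty v)) * ρ' v with hρ
  have hρ' : ρ' = fun v => sc (ty v) * ρ v := by
    ext v; simp only [hρ]; rw [← mul_assoc, hsc, one_mul]
  have hdet : (mat D pt' ρ').det = sc 0 ^ n * sc 1 ^ 2 * (mat D pt ρ).det := by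
    rw [hρ', hpt', F2]
  have hsum : ∑ v, ρ' v * bd (bOf c) pt' v = (sc 0 ^ dg 0 * sc 1 ^ dg 1) * ∑ v, ρ v * bd (bOf c) pt v := by
    rw [Finset.mul_sum]
    refine Finset.sum_congr rfl fun v _ => ?_
    have := hscal v
    rw [hρ']
    linear_combination ρ v * this
  rw [hdet] at a1 a3
  rw [hsum] at a2
  refine ⟨ρ, e, (hU2.dvd_mul_left).mp a1, fun h => a2 (dvd_mul_of_dvd_right h _), fun b1 b2 => ?_⟩
  refine (hU2.dvd_mul_left).mp (a3 b1 fun v => ?_)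
  have := hscal v
  exact ((hscu (ty v)).dvd_mul_left).mp (by rw [this]; exact dvd_mul_of_dvd_right (b2 v) _)

end DC

namespace DC

lemma det_smul_rho {n : ℕ} [NeZero n] {k R : Type*} [CommRing k] [CommRing R] [Algebra k R]
    (D : Fin n → Derivation k R R) (pt ρ : Fin n ⊕ Fin 2 → R) (s : R) :
    (mat D pt (fun v => s * ρ v)).det = s * (mat D pt ρ).det := by
  have h : mat D pt (fun v => s * ρ v) = (mat D pt ρ).updateRow (Sum.inl 0) (s • ρ) := by
    ext r v
    rcases r with i | j
    · by_cases hi : i = 0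
      · subst hi; simp [mat]
      · rw [Matrix.updateRow_ne (by simpa using hi)]; simp [mat, hi]
    · rw [Matrix.updateRow_ne (by simp)]; simp [mat]
  have h2 : mat D pt ρ = (mat D pt ρ).updateRow (Sum.inl 0) ρ := by
    ext r v
    rcases r with i | j
    · by_cases hi : i = 0
      · subst hi; simp [mat]
      · rw [Matrix.updateRow_ne (by simpa using hi)]
    · rw [Matrix.updateRow_ne (by simp)]
  rw [h, Matrix.det_updateRow_smul, ← h2]

lemma map_mat {n : ℕ} [NeZero n] {k R S : Type*} [CommRing k] [CommRing R] [Algebra k R]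
    [CommRing S] [Algebra k S] (f : R →+* S)
    (D : Fin n → Derivation k R R) (D' : Fin n → Derivation k S S)
    (pt ρ : Fin n ⊕ Fin 2 → R) (h : ∀ i v, D' i (f (pt v)) = f (D i (pt v))) :
    (mat D' (fun v => f (pt v)) (fun v => f (ρ v))).det = f (mat D pt ρ).det := by
  rw [RingHom.map_det]
  congr 1
  ext r v
  rcases r with i | j
  · by_cases hi : i = 0
    · subst hi; simp [mat]
    · simp [mat, hi, h]
  · simp only [mat, RingHom.mapMatrix_apply, Matrix.map_apply]; split_ifs <;> simp

lemma map_bd {n : ℕ} {k R S : Type*} [CommRing k] [CommRing R] [Algebra k R]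
    [CommRing S] [Algebra k S] (f : R →ₐ[k] S)
    (b : MvPolynomial (Fin n ⊕ Fin 2) k) (pt : Fin n ⊕ Fin 2 → R) (v) :
    bd b (fun v => f (pt v)) v = f (bd b pt v) := by
  unfold bd
  rw [← AlgHom.comp_apply, comp_aeval]

lemma LP {n : ℕ} [NeZero n] {dg : Fin 2 → ℕ} (hn : 3 ≤ n) (h0 : 3 ≤ dg 0) (h1 : 2 ≤ dg 1)
    {k A : Type*} [Field k] [Algebra (ZMod 2) k] [IsAlgClosed k] [CommRing A] [IsDomain A]
    [IsPrincipalIdealRing A] [Algebra k A]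
    (c : Ms n dg → k) (hc : AlgebraicIndependent (ZMod 2) c) (p : A) (hp : Prime p)
    (D : Fin n → Derivation k A A) (pt : Fin n ⊕ Fin 2 → A)
    (hpt : ∀ j, ∃ v, ty v = j ∧ ¬ p ∣ pt v)
    (hne : ∃ v, bd (bOf c) pt v ≠ 0) :
    ∃ (ρ : Fin n ⊕ Fin 2 → A) (e : ℕ), p ^ e ∣ (mat D pt ρ).det ∧
      ¬ p ^ (e + 1) ∣ ∑ v, ρ v * bd (bOf c) pt v ∧
      ((∀ i, p ∣ D i p) → (∀ v, p ∣ bd (bOf c) pt v) → p ^ (e + 1) ∣ (mat D pt ρ).det) := by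
  choose B hB hBp using hpt
  let I : Ideal A := Ideal.span {p}
  haveI : I.IsPrime := (Ideal.span_singleton_prime hp.ne_zero).mpr hp
  let Rp := Localization.AtPrime I
  let a : A →ₐ[k] Rp := IsScalarTower.toAlgHom k A Rp
  have hinj : Function.Injective a := IsLocalization.injective Rp I.primeCompl_le_nonZeroDivisors
  have hI : ∀ x, x ∈ I.primeCompl ↔ ¬ p ∣ x := fun x => by
    rw [Ideal.mem_primeCompl_iff, Ideal.mem_span_singleton]
  have hunit : ∀ x, ¬ p ∣ x → IsUnit (a x) := fun x hx =>
    IsLocalization.map_units Rp (⟨x, (hI x).mpr hx⟩ : I.primeCompl)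
  have hsurj : ∀ x : Rp, ∃ y s, ¬ p ∣ s ∧ a s * x = a y := fun x => by
    obtain ⟨⟨y, s⟩, h⟩ := IsLocalization.surj I.primeCompl x
    exact ⟨y, s, (hI _).mp s.2, by rw [mul_comm]; exact h⟩
  have hdvd : ∀ e x, a p ^ e ∣ a x ↔ p ^ e ∣ x := fun e x => by
    constructor
    · rintro ⟨z, hz⟩
      obtain ⟨y, s, hs, hy⟩ := hsurj z
      refine hp.pow_dvd_of_dvd_mul_left e hs ⟨y, hinj ?_⟩
      rw [map_mul, map_mul, map_pow, hz, ← hy]; ring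
    · intro h; rw [← map_pow]; exact map_dvd a h
  choose D' hD' using fun i => der_ext (T := Rp) I.primeCompl ((Algebra.linearMap A Rp).compDer (D i))
  have hD'' : ∀ i x, D' i (a x) = a (D i x) := hD'
  have hpR : Prime (a p) := by
    refine ⟨fun h => hp.ne_zero (hinj (by rw [h, map_zero])), fun h => ?_, fun x y h => ?_⟩
    · have := (hdvd 1 1).mp (by rw [pow_one, map_one]; exact h.dvd)
      rw [pow_one] at this
      exact hp.not_unit (isUnit_of_dvd_one this)
    · obtain ⟨x', s, hs, hx⟩ := hsurj x
      obtain ⟨y', s', hs', hy⟩ := hsurj y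
      have : p ∣ x' * y' := by
        have := (hdvd 1 (x' * y')).mp (by
          rw [pow_one, map_mul, ← hx, ← hy]
          exact h.trans ⟨a s * a s', by ring⟩)
        rwa [pow_one] at this
      rcases hp.dvd_or_dvd this with h | h
      · left
        exact ((hunit s hs).dvd_mul_left).mp (by rw [hx]; exact map_dvd a h)
      · right
        exact ((hunit s' hs').dvd_mul_left).mp (by rw [hy]; exact map_dvd a h)
  obtain ⟨v0, hv0⟩ := hne
  obtain ⟨ρ', e, a1, a2, a3⟩ := local_lemma' hn h0 h1 c hc B hB (a p) hpR
    (fun x hx => by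
      obtain ⟨y, s, hs, hy⟩ := hsurj x
      refine isUnit_of_mul_isUnit_right (x := a s) ?_
      rw [hy]
      refine hunit y fun h => hx (((hunit s hs).dvd_mul_left).mp ?_)
      rw [hy]; exact map_dvd a h)
    (fun x hx => by
      obtain ⟨y, s, hs, hy⟩ := hsurj x
      have hy0 : y ≠ 0 := by
        rintro rfl
        rw [map_zero] at hy
        exact hx (((hunit s hs).mul_right_eq_zero).mp hy)
      obtain ⟨c, hc, hc'⟩ := (FiniteMultiplicity.of_prime_left hp hy0).exists_eq_pow_mul_and_not_dvd
      refine ⟨multiplicity p y, ?_, fun h => ?_⟩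
      · refine ((hunit s hs).dvd_mul_left).mp ?_
        rw [hy, hdvd]; exact ⟨c, hc⟩
      · have := dvd_mul_of_dvd_right h (a s)
        rw [hy, hdvd, pow_succ] at this
        obtain ⟨w, hw⟩ := this
        exact hc' ⟨w, mul_left_cancel₀ (pow_ne_zero (multiplicity p y) hp.ne_zero) (by
          rw [← hc, ← mul_assoc]; exact hw)⟩)
    D' (fun v => a (pt v)) (fun j => hunit _ (hBp j)) ⟨v0, by
      rw [map_bd]; exact fun h => hv0 (hinj (by rw [h, map_zero]))⟩
  obtain ⟨s, hs⟩ := IsLocalization.exist_integer_multiples_of_finite I.primeCompl ρ'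
  choose ρ hρ using hs
  have hρ2 : ∀ v, a (ρ v) = a s * ρ' v := fun v => by
    have := hρ v
    rw [Algebra.smul_def] at this
    exact this
  have hsu : IsUnit (a s) := hunit _ ((hI _).mp s.2)
  have hdet : a (mat D pt ρ).det = a s * (mat D' (fun v => a (pt v)) ρ').det := by
    rw [← det_smul_rho]
    have := map_mat a.toRingHom D D' pt ρ (fun i v => hD'' i (pt v))
    exact this.symm.trans (by congr 2; ext v; exact hρ2 v)
  have hsum : a (∑ v, ρ v * bd (bOf c) pt v) = a s * ∑ v, ρ' v * bd (bOf c) (fun v => a (pt v)) v := by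
    rw [map_sum, Finset.mul_sum]
    refine Finset.sum_congr rfl fun v _ => ?_
    rw [map_mul, hρ2, map_bd, mul_assoc]
  refine ⟨ρ, e, ?_, ?_, fun b1 b2 => ?_⟩
  · rw [← hdvd, hdet]; exact dvd_mul_of_dvd_right a1 _
  · rw [← hdvd, hsum, hsu.dvd_mul_left]; exact a2
  · rw [← hdvd, hdet]
    refine dvd_mul_of_dvd_right (a3 (fun i => ?_) fun v => ?_) _
    · rw [hD'']; exact map_dvd a (b1 i)
    · rw [map_bd]; exact map_dvd a (b2 v)

theorem thmC' {n : ℕ} [NeZero n] {dg : Fin 2 → ℕ} (hn : 3 ≤ n) (h0 : 3 ≤ dg 0) (h1 : 2 ≤ dg 1)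
    (hev : ∀ j, Even (dg j))
    {k A : Type*} [Field k] [Algebra (ZMod 2) k] [IsAlgClosed k] [CommRing A] [IsDomain A]
    [IsPrincipalIdealRing A] [Algebra k A]
    (c : Ms n dg → k) (hc : AlgebraicIndependent (ZMod 2) c)
    (D : Fin n → Derivation k A A) (pt : Fin n ⊕ Fin 2 → A)
    (hpt : ∀ p, Prime p → ∀ j, ∃ v, ty v = j ∧ ¬ p ∣ pt v)
    (hD : ∀ i, D i (aeval pt (bOf c)) = 0)
    (hne : ∃ v, bd (bOf c) pt v ≠ 0) :
    ∃ l : A, (∀ v, (mat D pt (Pi.single v 1)).det = l * bd (bOf c) pt v) ∧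
      ∀ p, Prime p → (∀ i, p ∣ D i p) → (∀ v, p ∣ bd (bOf c) pt v) → p ∣ l := by
  classical
  have hE : ∀ j : Fin 2, ∑ v, (if ty v = j then pt v else 0) * bd (bOf c) pt v = 0 := by
    intro j
    rw [euler (BH_bOf c)]
    obtain ⟨r, hr⟩ := hev j
    haveI : CharP k 2 := by
      haveI := (inferInstance : Fact (Nat.Prime 2))
      exact charP_of_injective_algebraMap (algebraMap (ZMod 2) k).injective 2
    have h2 : ((dg j : ℕ) : A) = 0 := by
      rw [hr]
      have : ((r + r : ℕ) : A) = algebraMap k A ((2 * r : ℕ) : k) := by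
        rw [map_natCast]; congr 1; ring
      rw [this, Nat.cast_mul, CharP.cast_eq_zero k 2, zero_mul, map_zero]
    rw [h2, zero_mul]
  have key := fun ρ v => F1 D pt ρ (bOf c) hD hE v
  obtain ⟨v0, hv0⟩ := id hne
  set β := bd (bOf c) pt
  set Δ := fun v => (mat D pt (Pi.single v 1)).det with hΔ
  have hΔβ : ∀ w v, Δ w * β v = β w * Δ v := fun w v => by
    have := key (Pi.single w 1) v
    rw [Finset.sum_eq_single w (fun x _ hx => by simp [Pi.single_apply, hx]) (by simp),
      Pi.single_eq_same, one_mul] at this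
    exact this
  have hl : ∃ l, ∀ v, Δ v = l * β v := by
    suffices h : β v0 ∣ Δ v0 by
      obtain ⟨l, hl⟩ := h
      refine ⟨l, fun v => mul_left_cancel₀ hv0 ?_⟩
      rw [← hΔβ, hl]; ring
    obtain ⟨D', N', g, hrel, hDd, hN⟩ :=
      UniqueFactorizationMonoid.exists_reduced_factors (β v0) hv0 (Δ v0)
    have hg : g ≠ 0 := fun h => hv0 (by rw [← hDd, h, zero_mul])
    have hD0 : D' ≠ 0 := fun h => hv0 (by rw [← hDd, h, mul_zero])
    have hDu : IsUnit D' := by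
      by_contra hu
      obtain ⟨p, hpi, hpD⟩ := WfDvdMonoid.exists_irreducible_factor hu hD0
      have hp := hpi.prime
      obtain ⟨ρ, e, a1, a2, a3⟩ := LP hn h0 h1 c hc p hp D pt (hpt p hp) hne
      have h3 : (mat D pt ρ).det * D' = (∑ w, ρ w * β w) * N' := by
        refine mul_left_cancel₀ hg ?_
        have := key ρ v0
        change _ * β v0 = _ * Δ v0 at this
        rw [← hDd, ← hN] at this
        linear_combination this
      have h4 : p ^ (e + 1) ∣ (∑ w, ρ w * β w) * N' := by
        rw [← h3, pow_succ]; exact mul_dvd_mul a1 hpD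
      exact a2 (hp.pow_dvd_of_dvd_mul_right _ (fun h => hpi.not_isUnit (hrel hpD h)) h4)
    rw [← hDd, ← hN]
    exact mul_dvd_mul_left g hDu.dvd
  obtain ⟨l, hl⟩ := hl
  refine ⟨l, hl, fun p hp b1 b2 => ?_⟩
  obtain ⟨ρ, e, a1, a2, a3⟩ := LP hn h0 h1 c hc p hp D pt (hpt p hp) hne
  have h3 := a3 b1 b2
  have h4 : (mat D pt ρ).det = (∑ w, ρ w * β w) * l := by
    refine mul_right_cancel₀ hv0 ?_
    rw [key, mul_assoc, ← hl]
  by_contra hpl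
  rw [h4] at h3
  exact a2 (hp.pow_dvd_of_dvd_mul_right _ hpl h3)
end DC

namespace DC

lemma polyDer {k m : Type*} [CommRing k] [CommRing m] [Algebra k m] (D : Derivation k m m) :
    ∃ D' : Derivation k (Polynomial m) (Polynomial m), ∀ f l, (D' f).coeff l = D (f.coeff l) := by
  let D0 : Derivation k (Polynomial m) (PolynomialModule m m) := D.mapCoeffs
  refine ⟨PolynomialModule.equivPolynomialSelf.toLinearMap.compDer D0, fun f l => ?_⟩
  change (PolynomialModule.equivPolynomialSelf (D0 f)).coeff l = _
  rw [PolynomialModule.equivPolynomialSelf_apply_eq]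
  rfl

def NZ {n : ℕ} [NeZero n] {k m : Type*} [CommRing k] [CommRing m] [Algebra k m]
    (D : Fin n → Derivation k m m) (b : MvPolynomial (Fin n ⊕ Fin 2) k) (q : Fin n ⊕ Fin 2 → m) :
    Prop := ∃ v, bd b q v ≠ 0 ∧ (mat D q (Pi.single v 1)).det ≠ 0

lemma det_scale {n : ℕ} [NeZero n] {k m : Type*} [CommRing k] [CommRing m] [Algebra k m]
    (D : Fin n → Derivation k m m) (q : Fin n ⊕ Fin 2 → m) (sc : Fin 2 → m) (v) :
    sc (ty v) * (mat D (fun v => sc (ty v) * q v) (Pi.single v 1)).det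
      = sc 0 ^ n * sc 1 ^ 2 * (mat D q (Pi.single v 1)).det := by
  classical
  rw [← F2, ← det_smul_rho]
  congr 2
  ext w
  by_cases h : w = v
  · subst h; simp
  · simp [Pi.single_apply, h]

lemma NZ_scale {n : ℕ} [NeZero n] {k m : Type*} [CommRing k] [Field m] [Algebra k m]
    {dg : Fin 2 → ℕ} (D : Fin n → Derivation k m m) {b : MvPolynomial (Fin n ⊕ Fin 2) k}
    (hb : BH dg b) (q : Fin n ⊕ Fin 2 → m) (sc : Fin 2 → m) (hsc : ∀ j, sc j ≠ 0) (h : NZ D b q) :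
    NZ D b (fun v => sc (ty v) * q v) := by
  obtain ⟨v, h1, h2⟩ := h
  refine ⟨v, fun h => ?_, fun h => ?_⟩
  · have := bd_scale hb sc q v
    rw [h, mul_zero, eq_comm, mul_eq_zero] at this
    exact this.elim (mul_ne_zero (pow_ne_zero _ (hsc _)) (pow_ne_zero _ (hsc _))) h1
  · have := det_scale D q sc v
    rw [h, mul_zero, eq_comm, mul_eq_zero] at this
    exact this.elim (mul_ne_zero (pow_ne_zero _ (hsc _)) (pow_ne_zero _ (hsc _))) h2

lemma NZ_ne {n : ℕ} [NeZero n] {k m : Type*} [CommRing k] [CommRing m] [Algebra k m]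
    (D : Fin n → Derivation k m m) {b : MvPolynomial (Fin n ⊕ Fin 2) k}
    (q : Fin n ⊕ Fin 2 → m) (h : NZ D b q) (j : Fin 2) : ∃ v, ty v = j ∧ q v ≠ 0 := by
  by_contra hc
  push Not at hc
  obtain ⟨v, -, h2⟩ := h
  refine h2 (Matrix.det_eq_zero_of_row_eq_zero (Sum.inr j) fun w => ?_)
  simp only [mat]
  split_ifs with hw
  · exact hc w hw
  · rfl

lemma sq_of {A : Type*} [CommRing A] [IsDomain A] [IsIntegrallyClosed A] {x y w : A} (hx : x ≠ 0)
    (h : x ^ 2 * y = w ^ 2) : ∃ z, y = z ^ 2 := by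
  obtain ⟨z, rfl⟩ := (IsIntegrallyClosed.pow_dvd_pow_iff two_ne_zero).mp ⟨y, h.symm⟩
  exact ⟨z, mul_left_cancel₀ (pow_ne_zero 2 hx) (by rw [h]; ring)⟩

lemma prim {n : ℕ} [NeZero n] {k A : Type*} [CommRing k] [CommRing A] [IsDomain A] [IsPrincipalIdealRing A]
    [Algebra k A] {dg : Fin 2 → ℕ} (hev : ∀ j, Even (dg j)) {b : MvPolynomial (Fin n ⊕ Fin 2) k}
    (hb : BH dg b) (pt : Fin n ⊕ Fin 2 → A) (hne : ∀ j, ∃ v, ty v = j ∧ pt v ≠ 0)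
    (hZ : ∃ Z, aeval pt b = Z ^ 2) : ∃ (g : Fin 2 → A) (pt' : Fin n ⊕ Fin 2 → A),
      (∀ j, g j ≠ 0) ∧ (∀ v, pt v = g (ty v) * pt' v) ∧
      (∀ p, Prime p → ∀ j, ∃ v, ty v = j ∧ ¬ p ∣ pt' v) ∧ ∃ Z, aeval pt' b = Z ^ 2 := by
  let I : Fin 2 → Ideal A := fun j => Ideal.span (pt '' {v | ty v = j})
  let g : Fin 2 → A := fun j => Submodule.IsPrincipal.generator (I j)
  have hg : ∀ j, Ideal.span {g j} = I j := fun j => Ideal.span_singleton_generator (I j)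
  have hmem : ∀ v, g (ty v) ∣ pt v := fun v => by
    rw [← Ideal.mem_span_singleton, hg]
    exact Ideal.subset_span ⟨v, rfl, rfl⟩
  choose pt' hpt' using hmem
  have hg0 : ∀ j, g j ≠ 0 := fun j h => by
    obtain ⟨v, rfl, hv⟩ := hne j
    exact hv (by rw [hpt', h, zero_mul])
  refine ⟨g, pt', hg0, hpt', fun p hp j => ?_, ?_⟩
  · by_contra hc
    push Not at hc
    have h1 : I j ≤ Ideal.span {g j * p} := by
      refine Ideal.span_le.mpr ?_
      rintro _ ⟨v, hv, rfl⟩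
      have hv' : ty v = j := hv
      refine Ideal.mem_span_singleton.mpr ?_
      rw [hpt' v, hv']
      exact mul_dvd_mul_left _ (hc v hv)
    rw [← hg, Ideal.span_singleton_le_span_singleton] at h1
    obtain ⟨w, hw⟩ := h1
    refine hp.not_unit (IsUnit.of_mul_eq_one w (mul_left_cancel₀ (hg0 j) ?_))
    rw [mul_one, ← mul_assoc]; exact hw.symm
  · obtain ⟨Z, hZ⟩ := hZ
    have h1 := bh_scale hb g pt'
    have h2 : (fun v => g (ty v) * pt' v) = pt := by ext v; exact (hpt' v).symm
    rw [h2, hZ] at h1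
    obtain ⟨r0, hr0⟩ := hev 0
    obtain ⟨r1, hr1⟩ := hev 1
    refine sq_of (x := g 0 ^ r0 * g 1 ^ r1) (w := Z)
      (mul_ne_zero (pow_ne_zero _ (hg0 _)) (pow_ne_zero _ (hg0 _))) ?_
    rw [h1, hr0, hr1]; ring
end DC

namespace DC

lemma low1 {n : ℕ} {m : Type*} [Field m] (pt pt1 : Fin n ⊕ Fin 2 → Polynomial m)
    (g : Fin 2 → Polynomial m) (hg : ∀ j, g j ≠ 0) (h : ∀ v, pt v = g (ty v) * pt1 v)
    (hprim : ∀ j, ∃ v, ty v = j ∧ ¬ Polynomial.X ∣ pt1 v) (L : Fin 2 → ℕ)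
    (hL : ∀ v, ∀ l < L (ty v), (pt v).coeff l = 0)
    (hne : ∀ j, ∃ v, ty v = j ∧ (pt v).coeff (L j) ≠ 0) :
    ∃ s : Fin 2 → m, (∀ j, s j ≠ 0) ∧ ∀ v, (pt v).coeff (L (ty v)) = s (ty v) * (pt1 v).coeff 0 := by
  have hf : ∀ j, ∃ g', g j = Polynomial.X ^ (L j) * g' ∧ ¬ Polynomial.X ∣ g' := fun j => by
    obtain ⟨g', h1, h2⟩ :=
      (FiniteMultiplicity.of_prime_left Polynomial.prime_X (hg j)).exists_eq_pow_mul_and_not_dvd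
    set o := multiplicity Polynomial.X (g j)
    have hco : ∀ v, ty v = j → pt v = Polynomial.X ^ o * (g' * pt1 v) := fun v hv => by
      rw [h v, hv, h1, mul_assoc]
    have e1 : L j ≤ o := by
      by_contra hlt
      push Not at hlt
      obtain ⟨v, hv, hv2⟩ := hprim j
      have := hL v o (by rw [hv]; exact hlt)
      rw [hco v hv, Polynomial.coeff_X_pow_mul', if_pos le_rfl, Nat.sub_self,
        Polynomial.mul_coeff_zero, mul_eq_zero, ← Polynomial.X_dvd_iff, ← Polynomial.X_dvd_iff] at this
      exact this.elim h2 hv2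
    have e2 : o ≤ L j := by
      by_contra hlt
      obtain ⟨v, hv, hv2⟩ := hne j
      rw [hco v hv, Polynomial.coeff_X_pow_mul', if_neg hlt] at hv2
      exact hv2 rfl
    exact ⟨g', by rw [le_antisymm e1 e2]; exact h1, h2⟩
  choose g' h1 h2 using hf
  refine ⟨fun j => (g' j).coeff 0, fun j hj => h2 j (Polynomial.X_dvd_iff.mpr hj), fun v => ?_⟩
  rw [h v, h1, mul_assoc, Polynomial.coeff_X_pow_mul', if_pos le_rfl, Nat.sub_self,
    Polynomial.mul_coeff_zero]

noncomputable def ev0 (k m : Type*) [CommRing k] [CommRing m] [Algebra k m] : Polynomial m →ₐ[k] m :=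
  { Polynomial.constantCoeff with
    commutes' := fun r => by
      rw [IsScalarTower.algebraMap_apply k m (Polynomial m)]
      simp }

lemma ev0_apply {k m : Type*} [CommRing k] [CommRing m] [Algebra k m] (f : Polynomial m) :
    ev0 k m f = f.coeff 0 := rfl

lemma ev0_det {n : ℕ} [NeZero n] {k R S : Type*} [CommRing k] [CommRing R] [Algebra k R]
    [CommRing S] [Algebra k S] (f : R →+* S)
    (D : Fin n → Derivation k R R) (D' : Fin n → Derivation k S S)
    (pt : Fin n ⊕ Fin 2 → R) (w : Fin n ⊕ Fin 2) (h : ∀ i v, D' i (f (pt v)) = f (D i (pt v))) :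
    (mat D' (fun v => f (pt v)) (Pi.single w 1)).det = f (mat D pt (Pi.single w 1)).det := by
  rw [← map_mat f D D' pt _ h]
  congr 2
  ext v
  by_cases hv : v = w
  · subst hv; simp
  · simp [Pi.single_apply, hv]

theorem thmC {n : ℕ} [NeZero n] {dg : Fin 2 → ℕ} (hn : 3 ≤ n) (h0 : 3 ≤ dg 0) (h1 : 2 = dg 1)
    (hev : ∀ j, Even (dg j)) (hdn : n ≤ dg 0)
    {k m : Type*} [Field k] [Algebra (ZMod 2) k] [IsAlgClosed k] [Field m] [Algebra k m]
    (c : Ms n dg → k) (hc : AlgebraicIndependent (ZMod 2) c)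
    (D : Fin n → Derivation k m m) (pt : Fin n ⊕ Fin 2 → Polynomial m)
    (hZ : ∃ Z, aeval pt (bOf c) = Z ^ 2) (L N : Fin 2 → ℕ)
    (hL : ∀ v, ∀ l < L (ty v), (pt v).coeff l = 0)
    (hN : ∀ v, (pt v).natDegree ≤ N (ty v))
    (hlow : NZ D (bOf c) (fun v => (pt v).coeff (L (ty v))))
    (htop : ∀ j, ∃ v, ty v = j ∧ (pt v).coeff (N j) ≠ 0) :
    NZ D (bOf c) (fun v => (pt v).coeff (N (ty v))) := by
  haveI : CharP k 2 := charP_of_injective_algebraMap (algebraMap (ZMod 2) k).injective 2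
  haveI : CharP (Polynomial m) 2 :=
    charP_of_injective_algebraMap (algebraMap k (Polynomial m)).injective 2
  choose Dp hDp using fun i => polyDer (D i)
  have hDpX : ∀ i, Dp i Polynomial.X = 0 := fun i => by
    ext l; rw [hDp, Polynomial.coeff_X]; split_ifs <;> simp
  have hDsq : ∀ i (Z : Polynomial m), Dp i (Z ^ 2) = 0 := fun i Z => by
    rw [Derivation.leibniz_pow]
    rw [← Nat.cast_smul_eq_nsmul (Polynomial m), CharP.cast_eq_zero, zero_smul]
  have hev0 : ∀ i (f : Polynomial m), D i (ev0 k m f) = ev0 k m (Dp i f) := fun i f => (hDp i f 0).symm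
  have main : ∀ pt' : Fin n ⊕ Fin 2 → Polynomial m,
      (∀ p, Prime p → ∀ j, ∃ v, ty v = j ∧ ¬ p ∣ pt' v) → (∃ Z, aeval pt' (bOf c) = Z ^ 2) →
      (∃ v, bd (bOf c) pt' v ≠ 0) →
      ∃ l : Polynomial m, (∀ v, (mat Dp pt' (Pi.single v 1)).det = l * bd (bOf c) pt' v) ∧
       (¬ Polynomial.X ∣ l → ∃ v, ¬ Polynomial.X ∣ bd (bOf c) pt' v) := by
    rintro pt' a1 ⟨Z, a2⟩ a3
    obtain ⟨l, hl, hl'⟩ := thmC' hn h0 h1.le hev c hc Dp pt' a1 (fun i => by rw [a2, hDsq]) a3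
    refine ⟨l, hl, fun hX => ?_⟩
    by_contra hcon
    push Not at hcon
    exact hX (hl' _ Polynomial.prime_X (fun i => by rw [hDpX]; exact dvd_zero _) hcon)
  have hlne := fun j => NZ_ne D _ hlow j
  have hLne : ∀ j, ∃ v, ty v = j ∧ (pt v).coeff (L j) ≠ 0 := fun j => by
    obtain ⟨v, hv, h⟩ := hlne j
    exact ⟨v, hv, by rw [← hv]; exact h⟩
  have hptne : ∀ j, ∃ v, ty v = j ∧ pt v ≠ 0 := fun j => by
    obtain ⟨v, hv, h⟩ := hlne j
    exact ⟨v, hv, fun hh => h (by simp only [hh, Polynomial.coeff_zero])⟩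
  obtain ⟨g1, pt1, hg1, hpt1, hprim1, hZ1⟩ := prim hev (BH_bOf c) pt hptne hZ
  obtain ⟨s1, hs1, hs1'⟩ := low1 pt pt1 g1 hg1 hpt1 (hprim1 _ Polynomial.prime_X) L hL hLne
  have hNZ1 : NZ D (bOf c) (fun v => (pt1 v).coeff 0) := by
    have := NZ_scale D (BH_bOf c) _ (fun j => (s1 j)⁻¹) (fun j => inv_ne_zero (hs1 j)) hlow
    convert this using 2 with v
    rw [hs1', inv_mul_cancel_left₀ (hs1 _)]
  have hbd0 : ∀ (q : Fin n ⊕ Fin 2 → Polynomial m) v,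
      bd (bOf c) (fun v => (q v).coeff 0) v = (bd (bOf c) q v).coeff 0 := fun q v =>
    map_bd (ev0 k m) (bOf c) q v
  have hdet0 : ∀ (q : Fin n ⊕ Fin 2 → Polynomial m) v,
      (mat D (fun v => (q v).coeff 0) (Pi.single v 1)).det = (mat Dp q (Pi.single v 1)).det.coeff 0 :=
    fun q v => ev0_det (ev0 k m).toRingHom Dp D q v (fun i w => hev0 i _)
  obtain ⟨v1, hv1, hv1'⟩ := hNZ1
  rw [hbd0] at hv1
  rw [hdet0] at hv1'
  have hb1 : bd (bOf c) pt1 v1 ≠ 0 := fun h => hv1 (by rw [h, Polynomial.coeff_zero])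
  obtain ⟨l1, hl1, -⟩ := main pt1 hprim1 hZ1 ⟨v1, hb1⟩
  have hl10 : l1 ≠ 0 := by
    rintro rfl
    rw [hl1, zero_mul] at hv1'
    exact hv1' rfl
  let K := FractionRing (Polynomial m)
  let a : Polynomial m →ₐ[k] K := IsScalarTower.toAlgHom k (Polynomial m) K
  have hinj : Function.Injective a := IsFractionRing.injective (Polynomial m) K
  let τ : K := a Polynomial.X
  have hτ : τ ≠ 0 := fun h => Polynomial.X_ne_zero (hinj (h.trans (map_zero a).symm))
  let φ : Polynomial m →ₐ[k] K := (Polynomial.aeval (R := m) τ⁻¹).restrictScalars k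
  have hφ : ∀ f M, f.natDegree ≤ M → φ f * τ ^ M = a (Polynomial.reflect M f) := fun f M hM => by
    letI : Invertible τ⁻¹ := invertibleOfNonzero (inv_ne_zero hτ)
    have := Polynomial.eval₂_reflect_mul_pow (algebraMap m K) τ⁻¹ M f hM
    have h2 : Polynomial.eval₂ (algebraMap m K) (⅟τ⁻¹) (Polynomial.reflect M f)
        = a (Polynomial.reflect M f) := by
      rw [invOf_eq_inv, inv_inv, ← Polynomial.aeval_def]
      exact Polynomial.aeval_algebraMap_apply K Polynomial.X (Polynomial.reflect M f) |>.trans (by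
        rw [Polynomial.aeval_X_left_apply]; rfl)
    rw [h2] at this
    change Polynomial.eval₂ (algebraMap m K) τ⁻¹ f * τ ^ M = _
    rw [← this, mul_assoc, ← mul_pow, inv_mul_cancel₀ hτ, one_pow, mul_one]
  have hφr : ∀ f : Polynomial m, φ f * τ ^ f.natDegree = a f.reverse := fun f => hφ f _ le_rfl
  have hφ0 : ∀ f, f ≠ 0 → φ f ≠ 0 := fun f hf h => by
    have := hφr f
    rw [h, zero_mul] at this
    exact hf (Polynomial.reverse_eq_zero.mp (hinj (this.symm.trans (map_zero a).symm)))
  choose DK hDK using fun i => der_ext (T := K) (nonZeroDivisors (Polynomial m))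
    ((Algebra.linearMap (Polynomial m) K).compDer (Dp i))
  have hDKa : ∀ i f, DK i (a f) = a (Dp i f) := hDK
  have hDKφ : ∀ i f, DK i (φ f) = φ (Dp i f) := fun i f => by
    have hτ' : DK i τ⁻¹ = 0 := by
      rw [Derivation.leibniz_inv]
      rw [show DK i τ = a (Dp i Polynomial.X) from hDKa i _, hDpX, map_zero, smul_zero]
    have hφX : φ Polynomial.X = τ⁻¹ := Polynomial.aeval_X _
    have hφC : ∀ x, φ (Polynomial.C x) = a (Polynomial.C x) := fun x => by
      refine (Polynomial.aeval_C _ _).trans ?_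
      rw [IsScalarTower.algebraMap_apply m (Polynomial m) K]; rfl
    have hDC : ∀ x, Dp i (Polynomial.C x) = Polynomial.C (D i x) := fun x => by
      ext l; rw [hDp, Polynomial.coeff_C, Polynomial.coeff_C]; split_ifs <;> simp
    induction f using Polynomial.induction_on with
    | C x => rw [hφC, hDKa, hDC, hφC]
    | add p q hp hq => simp only [map_add, hp, hq]
    | monomial l x ih =>
      rw [pow_succ, ← mul_assoc]
      generalize Polynomial.C x * Polynomial.X ^ l = f0 at ih
      rw [map_mul φ, Derivation.leibniz, Derivation.leibniz, hDpX, hφX, hτ',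
        smul_zero, smul_zero, zero_add, zero_add, ih, smul_eq_mul, smul_eq_mul, map_mul φ, hφX]
  set ptr : Fin n ⊕ Fin 2 → Polynomial m := fun v => Polynomial.reflect (N (ty v)) (pt v) with hptr
  have hptr0 : ∀ v, (ptr v).coeff 0 = (pt v).coeff (N (ty v)) := fun v => by
    rw [hptr, Polynomial.coeff_reflect, Polynomial.revAt_le (Nat.zero_le _), Nat.sub_zero]
  have hrne : ∀ j, ∃ v, ty v = j ∧ (ptr v).coeff 0 ≠ 0 := fun j => by
    obtain ⟨v, hv, h⟩ := htop j
    exact ⟨v, hv, by rw [hptr0, hv]; exact h⟩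
  have haeval : ∀ (f : Polynomial m →ₐ[k] K) q, f (aeval q (bOf c)) = aeval (fun v => f (q v)) (bOf c) :=
    fun f q => by rw [← AlgHom.comp_apply, comp_aeval]
  have hZr : ∃ Z, aeval ptr (bOf c) = Z ^ 2 := by
    obtain ⟨Z, hZ⟩ := hZ
    have e1 := bh_scale (BH_bOf c) (fun j => τ ^ N j) (fun v => φ (pt v))
    have e2 : (fun v => τ ^ N (ty v) * φ (pt v)) = fun v => a (ptr v) := by
      ext v; rw [mul_comm]; exact hφ _ _ (hN v)
    rw [e2, ← haeval, ← haeval, hZ] at e1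
    obtain ⟨r0, hr0⟩ := hev 0
    obtain ⟨r1, hr1⟩ := hev 1
    refine sq_of (x := Polynomial.X ^ Z.natDegree)
      (w := Polynomial.X ^ (N 0 * r0 + N 1 * r1) * Z.reverse) (pow_ne_zero _ Polynomial.X_ne_zero) (hinj ?_)
    rw [map_mul a, e1]
    simp only [map_mul, map_pow]
    rw [← hφr, hr0, hr1]
    change (τ ^ _) ^ 2 * _ = (τ ^ _ * _) ^ 2
    ring
  obtain ⟨g2, pt2, hg2, hpt2, hprim2, hZ2⟩ := prim hev (BH_bOf c) ptr (fun j => by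
    obtain ⟨v, hv, h⟩ := hrne j
    exact ⟨v, hv, fun hh => h (by rw [hh, Polynomial.coeff_zero])⟩) hZr
  obtain ⟨s2, hs2, hs2'⟩ := low1 ptr pt2 g2 hg2 hpt2 (hprim2 _ Polynomial.prime_X) (fun _ => 0)
    (fun v l hl => absurd hl (Nat.not_lt_zero l)) hrne
  let sc : Fin 2 → K := fun j => τ ^ N j * φ (g1 j) / a (g2 j)
  have hag2 : ∀ j, a (g2 j) ≠ 0 := fun j h => hg2 j (hinj (h.trans (map_zero a).symm))
  have hsc0 : ∀ j, sc j ≠ 0 := fun j =>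
    div_ne_zero (mul_ne_zero (pow_ne_zero _ hτ) (hφ0 _ (hg1 j))) (hag2 j)
  have hscp : ∀ v, sc (ty v) * φ (pt1 v) = a (pt2 v) := fun v => by
    have e1 := hφ _ _ (hN v)
    change _ = a (ptr v) at e1
    rw [hpt2, map_mul, hpt1, map_mul] at e1
    change τ ^ N (ty v) * φ (g1 (ty v)) / a (g2 (ty v)) * φ (pt1 v) = _
    rw [div_mul_eq_mul_div, div_eq_iff (hag2 _)]
    linear_combination e1
  have hscf : (fun v => sc (ty v) * φ (pt1 v)) = fun v => a (pt2 v) := funext hscp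
  have hbdK : ∀ v, sc (ty v) * a (bd (bOf c) pt2 v) = sc 0 ^ dg 0 * sc 1 ^ dg 1 * φ (bd (bOf c) pt1 v) :=
    fun v => by
      have := bd_scale (BH_bOf c) sc (fun v => φ (pt1 v)) v
      rw [hscf, map_bd, map_bd] at this
      exact this
  have hdetK : ∀ v, sc (ty v) * a (mat Dp pt2 (Pi.single v 1)).det
      = sc 0 ^ n * sc 1 ^ 2 * φ (mat Dp pt1 (Pi.single v 1)).det := fun v => by
    have := det_scale DK (fun v => φ (pt1 v)) sc v
    rw [hscf] at this
    have e1 := ev0_det a.toRingHom Dp DK pt2 v (fun i w => hDKa i _)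
    have e2 := ev0_det φ.toRingHom Dp DK pt1 v (fun i w => hDKφ i _)
    exact (congrArg (sc (ty v) * ·) e1.symm).trans (this.trans (congrArg (sc 0 ^ n * sc 1 ^ 2 * ·) e2))
  have hφb1 : φ (bd (bOf c) pt1 v1) ≠ 0 := hφ0 _ hb1
  have hb2 : bd (bOf c) pt2 v1 ≠ 0 := fun h => by
    have := hbdK v1
    rw [h, map_zero, mul_zero] at this
    exact mul_ne_zero (mul_ne_zero (pow_ne_zero _ (hsc0 _)) (pow_ne_zero _ (hsc0 _))) hφb1 this.symm
  obtain ⟨l2, hl2, hl2'⟩ := main pt2 hprim2 hZ2 ⟨v1, hb2⟩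
  obtain ⟨e, he⟩ := Nat.exists_eq_add_of_le hdn
  have hrel : a l2 * sc 0 ^ e = φ l1 := by
    have e1 := hdetK v1
    rw [hl2, hl1, map_mul, map_mul] at e1
    have e2 := hbdK v1
    rw [← h1, he] at e2
    refine mul_right_cancel₀ (mul_ne_zero (mul_ne_zero (pow_ne_zero n (hsc0 0)) (pow_ne_zero 2 (hsc0 1))) hφb1) ?_
    linear_combination e1 - a l2 * e2
  have hγ : (g1 0).natDegree ≤ N 0 := by
    obtain ⟨v, hv, h⟩ := hptne 0
    refine le_trans (Polynomial.natDegree_le_of_dvd ⟨pt1 v, ?_⟩ h) (hv ▸ hN v)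
    rw [hpt1, hv]
  obtain ⟨w, hw⟩ := Nat.exists_eq_add_of_le hγ
  have hfin : l2 * (g1 0).reverse ^ e * Polynomial.X ^ (w * e + l1.natDegree) = l1.reverse * g2 0 ^ e := by
    apply hinj
    simp only [map_mul, map_pow]
    rw [← hφr, ← hφr, ← hrel]
    change a l2 * _ * τ ^ _ = _ * τ ^ _ * _
    have : sc 0 * a (g2 0) = τ ^ w * (φ (g1 0) * τ ^ (g1 0).natDegree) := by
      change τ ^ N 0 * φ (g1 0) / a (g2 0) * a (g2 0) = _
      rw [div_mul_cancel₀ _ (hag2 0), hw]; ring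
    have h3 : (sc 0 * a (g2 0)) ^ e = (τ ^ w * (φ (g1 0) * τ ^ (g1 0).natDegree)) ^ e := by rw [this]
    rw [mul_pow, mul_pow (τ ^ w)] at h3
    rw [pow_add τ, pow_mul τ]
    linear_combination (-a l2 * τ ^ l1.natDegree) * h3
  have hXl2 : ¬ Polynomial.X ∣ l2 := fun h => by
    have h3 : Polynomial.X ∣ l1.reverse * g2 0 ^ e := by
      rw [← hfin, mul_assoc]; exact dvd_mul_of_dvd_left h _
    rcases Polynomial.prime_X.dvd_or_dvd h3 with h | h
    · rw [Polynomial.X_dvd_iff, Polynomial.coeff_zero_reverse] at h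
      exact hl10 (Polynomial.leadingCoeff_eq_zero.mp h)
    · have h4 := Polynomial.prime_X.dvd_of_dvd_pow h
      obtain ⟨v, hv, h5⟩ := hrne 0
      refine h5 (Polynomial.X_dvd_iff.mp ?_)
      rw [hpt2, hv]; exact dvd_mul_of_dvd_left h4 _
  obtain ⟨v2, hv2⟩ := hl2' hXl2
  rw [Polynomial.X_dvd_iff] at hv2 hXl2
  have hNZ2 : NZ D (bOf c) (fun v => (pt2 v).coeff 0) := by
    refine ⟨v2, by rw [hbd0]; exact hv2, ?_⟩
    rw [hdet0, hl2, Polynomial.mul_coeff_zero]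
    exact mul_ne_zero hXl2 hv2
  have := NZ_scale D (BH_bOf c) _ s2 hs2 hNZ2
  convert this using 2 with v
  rw [← hptr0, hs2']
end DC

namespace DC

lemma chain_step {Γ : Type*} [LinearOrderedCommGroupWithZero Γ] (A : Fin 2 → ℕ → Γ) (N J : Fin 2 → ℕ)
    (hJ : ∀ j, A j (J j) ≠ 0) (hN : ∀ j l, N j < l → A j l = 0) (hNn : ∀ j, A j (N j) ≠ 0) (w : Γ)
    (hgt : ∀ j l, J j < l → w ^ l * A j l < w ^ J j * A j (J j))
    (hlt : ∀ j l, l < J j → w ^ l * A j l ≤ w ^ J j * A j (J j)) (S : Set Γ)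
    (root : ∀ j l, J j < l → A j l ≠ 0 → ∃ x ∈ S, x ^ (l - J j) * A j l = A j (J j))
    (hne : ∃ j, J j ≠ N j) : ∃ w' ∈ S, w' ≠ 0 ∧ ∃ J' : Fin 2 → ℕ, (∀ j, J j ≤ J' j) ∧
      (∃ j, J j < J' j) ∧ (∀ j l, w' ^ l * A j l ≤ w' ^ J j * A j (J j)) ∧
      (∀ j l, l < J j → w' ^ l * A j l < w' ^ J j * A j (J j)) ∧
      (∀ j l, J' j < l → w' ^ l * A j l < w' ^ J j * A j (J j)) ∧
      ∀ j, w' ^ J' j * A j (J' j) = w' ^ J j * A j (J j) := by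
  classical
  have hJN : ∀ j, J j ≤ N j := fun j => by
    by_contra h; exact hJ j (hN j _ (not_le.mp h))
  let T : Finset (Fin 2 × ℕ) := (Finset.univ ×ˢ Finset.range (N 0 + N 1 + 1)).filter
    (fun x => J x.1 < x.2 ∧ A x.1 x.2 ≠ 0)
  have hbnd : ∀ j, N j ≤ N 0 + N 1 := fun j => by fin_cases j <;> simp
  have hT : ∀ j l, J j < l → A j l ≠ 0 → (j, l) ∈ T := fun j l h1 h2 => by
    refine Finset.mem_filter.mpr ⟨Finset.mem_product.mpr ⟨Finset.mem_univ _, Finset.mem_range.mpr ?_⟩, h1, h2⟩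
    have : l ≤ N j := by by_contra h; exact h2 (hN j l (not_le.mp h))
    have := hbnd j
    change l < _
    omega
  have hr : ∀ x : Fin 2 × ℕ, ∃ y, x ∈ T → y ∈ S ∧ y ^ (x.2 - J x.1) * A x.1 x.2 = A x.1 (J x.1) := fun x => by
    by_cases hx : x ∈ T
    · obtain ⟨-, h1, h2⟩ := Finset.mem_filter.mp hx
      obtain ⟨y, hy, hy'⟩ := root x.1 x.2 h1 h2
      exact ⟨y, fun _ => ⟨hy, hy'⟩⟩
    · exact ⟨0, fun h => absurd h hx⟩
  choose ρ hρ using hr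
  obtain ⟨j0, hj0⟩ := hne
  obtain ⟨⟨js, ls⟩, hs, hmin⟩ := T.exists_min_image ρ ⟨(j0, N j0), hT _ _
    (lt_of_le_of_ne (hJN j0) hj0) (hNn j0)⟩
  obtain ⟨-, hs1, hs2⟩ := Finset.mem_filter.mp hs
  obtain ⟨hs3, hs4⟩ := hρ _ hs
  simp only at hs1 hs2 hs4
  set w' := ρ (js, ls) with hw'
  have hw0 : w' ≠ 0 := by
    intro h
    rw [h, zero_pow (by omega), zero_mul] at hs4
    exact hJ js hs4.symm
  have hpos : ∀ (x : Γ), x ≠ 0 → 0 < x := fun x hx => zero_lt_iff.mpr hx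
  have hle : ∀ j l, J j < l → w' ^ l * A j l ≤ w' ^ J j * A j (J j) := fun j l hl => by
    by_cases hA : A j l = 0
    · rw [hA, mul_zero]; exact zero_le'
    · have h1 := hmin (j, l) (hT j l hl hA)
      obtain ⟨-, h2⟩ := hρ _ (hT j l hl hA)
      simp only at h1 h2
      rw [← h2]
      conv_lhs => rw [show w' ^ l = w' ^ J j * w' ^ (l - J j) by rw [← pow_add]; congr 1; omega, mul_assoc]
      gcongr
  have hww : w < w' := by
    have h1 := hgt js ls hs1
    by_cases hw : w = 0
    · rw [hw]; exact hpos _ hw0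
    · rw [← hs4, show ls = J js + (ls - J js) by omega, pow_add, mul_assoc, Nat.add_sub_cancel_left,
        mul_lt_mul_iff_right₀ (hpos _ (pow_ne_zero _ hw)),
        mul_lt_mul_iff_left₀ (hpos _ (by rw [show J js + (ls - J js) = ls by omega]; exact hs2))] at h1
      exact lt_of_pow_lt_pow_left₀ _ zero_le' h1
  have hl : ∀ j l, l < J j → w' ^ l * A j l < w' ^ J j * A j (J j) := fun j l hl => by
    have hw : w ≠ 0 := by
      intro h
      have := hgt j (J j + 1) (Nat.lt_succ_self _)
      rw [h, zero_pow (by omega), zero_mul, zero_pow (by omega), zero_mul] at this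
      exact lt_irrefl _ this
    have h1 := hlt j l hl
    obtain ⟨d, hd⟩ := Nat.exists_eq_add_of_lt hl
    have e : J j = l + (d + 1) := by omega
    have ha := hJ j
    generalize A j (J j) = a at h1 ha ⊢
    rw [e, pow_add, mul_assoc, mul_le_mul_iff_right₀ (hpos _ (pow_ne_zero _ hw))] at h1
    rw [e, pow_add, mul_assoc, mul_lt_mul_iff_right₀ (hpos _ (pow_ne_zero _ hw0))]
    refine lt_of_le_of_lt h1 ?_
    rw [mul_lt_mul_iff_left₀ (hpos _ ha)]
    exact pow_lt_pow_left₀ hww zero_le' (by omega)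
  have hall : ∀ j l, w' ^ l * A j l ≤ w' ^ J j * A j (J j) := fun j l => by
    rcases lt_trichotomy l (J j) with h | h | h
    · exact (hl j l h).le
    · rw [h]
    · exact hle j l h
  let P : Fin 2 → ℕ → Prop := fun j l => w' ^ l * A j l = w' ^ J j * A j (J j)
  have hPb : ∀ j l, P j l → l ≤ N j := fun j l h => by
    by_contra hc
    have : w' ^ l * A j l = w' ^ J j * A j (J j) := h
    rw [hN j l (not_le.mp hc), mul_zero] at this
    exact mul_ne_zero (pow_ne_zero _ hw0) (hJ j) this.symm
  have hPJ : ∀ j, P j (J j) := fun j => rfl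
  have hPs : P js ls := by
    change w' ^ ls * A js ls = _
    rw [← hs4]
    conv_lhs => rw [show ls = J js + (ls - J js) by omega, pow_add, mul_assoc]
    rw [show J js + (ls - J js) = ls by omega]
  refine ⟨w', hs3, hw0, fun j => Nat.findGreatest (P j) (N j), fun j => ?_, ⟨js, ?_⟩, hall, hl, ?_, fun j => ?_⟩
  · exact Nat.le_findGreatest (hJN j) (hPJ j)
  · exact lt_of_lt_of_le hs1 (Nat.le_findGreatest (hPb _ _ hPs) hPs)
  · intro j l h
    refine lt_of_le_of_ne (hall j l) fun h2 => ?_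
    exact absurd (Nat.le_findGreatest (hPb j l h2) h2) (not_le.mpr h)
  · exact Nat.findGreatest_spec (P := P j) (hJN j) (hPJ j)

lemma map_aeval_bOf {n : ℕ} {dg : Fin 2 → ℕ} {k1 k2 R S : Type*} [CommRing k1] [CommRing k2]
    [CommRing R] [CommRing S] [Algebra k1 R] [Algebra k2 S] (f : R →+* S) (c1 : Ms n dg → k1)
    (c2 : Ms n dg → k2) (h : ∀ e, f (algebraMap k1 R (c1 e)) = algebraMap k2 S (c2 e))
    (q : Fin n ⊕ Fin 2 → R) : f (aeval q (bOf c1)) = aeval (fun v => f (q v)) (bOf c2) := by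
  simp only [bOf, map_sum, aeval_monomial, map_mul, h]
  refine Finset.sum_congr rfl fun e _ => ?_
  congr 1
  simp only [Finsupp.prod, map_prod, map_pow]

lemma int_sq {M : Type*} [Field M] (O : ValuationSubring M) (W : Polynomial M) (P : Polynomial O)
    (h : P.map (algebraMap O M) = W ^ 2) : ∃ W' : Polynomial O, W'.map (algebraMap O M) = W := by
  letI := (Polynomial.mapRingHom (algebraMap O M)).toAlgebra
  have h1 : IsIntegral (Polynomial O) W := by
    refine IsIntegral.of_pow two_pos ?_
    rw [← h]
    exact isIntegral_algebraMap (R := Polynomial O) (A := Polynomial M) (x := P)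
  have h2 := Polynomial.isIntegral_iff_isIntegral_coeff.mp h1
  have h3 : W ∈ Polynomial.lifts (algebraMap O M) := by
    rw [Polynomial.lifts_iff_coeff_lifts]
    intro l
    obtain ⟨y, hy⟩ := IsIntegrallyClosed.isIntegral_iff.mp (h2 l)
    exact ⟨y, hy⟩
  exact (Polynomial.mem_lifts _).mp h3
end DC

namespace DC

def NZM {n : ℕ} [NeZero n] {k m M : Type*} [CommRing k] [CommRing m] [Algebra k m] [Field M]
    (O : ValuationSubring M) (π : O →+* m)
    (D : Fin n → Derivation k m m) (b : MvPolynomial (Fin n ⊕ Fin 2) k) (q : Fin n ⊕ Fin 2 → M) : Prop :=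
  ∃ (sc : Fin 2 → M) (q' : Fin n ⊕ Fin 2 → O), (∀ j, sc j ≠ 0) ∧
    (∀ v, (q' v : M) = sc (ty v) * q v) ∧ NZ D b (fun v => π (q' v))

noncomputable def Am {n : ℕ} {M : Type*} [Field M] (O : ValuationSubring M)
    (pt : Fin n ⊕ Fin 2 → Polynomial M) (j : Fin 2) (l : ℕ) : O.ValueGroup :=
  (Finset.univ.filter (fun v : Fin n ⊕ Fin 2 => ty v = j)).sup (fun v => O.valuation ((pt v).coeff l))

lemma le_Am {n : ℕ} {M : Type*} [Field M] (O : ValuationSubring M)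
    (pt : Fin n ⊕ Fin 2 → Polynomial M) (v : Fin n ⊕ Fin 2) (l : ℕ) :
    O.valuation ((pt v).coeff l) ≤ Am O pt (ty v) l :=
  Finset.le_sup (f := fun v => O.valuation ((pt v).coeff l)) (by simp)

lemma Am_eq {n : ℕ} [NeZero n] {M : Type*} [Field M] (O : ValuationSubring M)
    (pt : Fin n ⊕ Fin 2 → Polynomial M) (j : Fin 2) (l : ℕ) :
    ∃ v, ty v = j ∧ Am O pt j l = O.valuation ((pt v).coeff l) := by
  have hne : (Finset.univ.filter (fun v : Fin n ⊕ Fin 2 => ty v = j)).Nonempty := by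
    fin_cases j
    · exact ⟨Sum.inl 0, by simp⟩
    · exact ⟨Sum.inr 0, by simp⟩
  obtain ⟨v, hv, h⟩ := Finset.exists_mem_eq_sup _ hne (fun v => O.valuation ((pt v).coeff l))
  exact ⟨v, (Finset.mem_filter.mp hv).2, h⟩

lemma pi_ne {M m : Type*} [Field M] [Field m] (O : ValuationSubring M) (π : O →+* m) (x : O)
    (hx : O.valuation (x : M) = 1) : π x ≠ 0 := by
  have : IsUnit x := (O.valuation_eq_one_iff x).mpr hx
  exact (this.map π).ne_zero

lemma newton_step {n : ℕ} [NeZero n] {dg : Fin 2 → ℕ} (hn : 3 ≤ n) (h0 : 3 ≤ dg 0) (h1 : 2 = dg 1)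
    (hev : ∀ j, Even (dg j)) (hdn : n ≤ dg 0)
    {k m M : Type*} [Field k] [Algebra (ZMod 2) k] [IsAlgClosed k] [Field m] [Algebra k m] [Field M]
    (O : ValuationSubring M) (π : O →+* m) (hπ : ∀ x : O, O.valuation (x : M) < 1 → π x = 0)
    (cO : Ms n dg → O) (c : Ms n dg → k) (hc : AlgebraicIndependent (ZMod 2) c)
    (hcO : ∀ e, π (cO e) = algebraMap k m (c e))
    (D : Fin n → Derivation k m m) (pt : Fin n ⊕ Fin 2 → Polynomial M) (Z : Polynomial M)
    (hZ : aeval pt (bOf (fun e => (cO e : M))) = Z ^ 2) (L N : Fin 2 → ℕ) (γ : M) (hγ : γ ≠ 0)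
    (hall : ∀ j l, O.valuation γ ^ l * Am O pt j l ≤ O.valuation γ ^ L j * Am O pt j (L j))
    (hlow : ∀ j l, l < L j → O.valuation γ ^ l * Am O pt j l < O.valuation γ ^ L j * Am O pt j (L j))
    (hhigh : ∀ j l, N j < l → O.valuation γ ^ l * Am O pt j l < O.valuation γ ^ L j * Am O pt j (L j))
    (hLN : ∀ j, O.valuation γ ^ N j * Am O pt j (N j) = O.valuation γ ^ L j * Am O pt j (L j))
    (h : NZM O π D (bOf c) (fun v => (pt v).coeff (L (ty v)))) :
    NZM O π D (bOf c) (fun v => (pt v).coeff (N (ty v))) := by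
  obtain ⟨sc, q', hsc, hq', hNZ⟩ := h
  have hnorm : ∀ j, O.valuation (sc j) * Am O pt j (L j) = 1 := fun j => by
    refine le_antisymm ?_ ?_
    · obtain ⟨v, hv, hv2⟩ := Am_eq O pt j (L j)
      rw [hv2, ← map_mul]
      subst hv
      rw [← hq']
      exact O.valuation_le_one _
    · obtain ⟨v, hv, hv2⟩ := NZ_ne D _ hNZ j
      subst hv
      have : ¬ O.valuation (q' v : M) < 1 := fun h => hv2 (hπ _ h)
      rw [not_lt, hq', map_mul] at this
      exact this.trans (mul_le_mul_right (le_Am O pt v _) _)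
  let σ : Fin 2 → M := fun j => sc j / γ ^ L j
  have hγp : ∀ l : ℕ, γ ^ l ≠ 0 := fun l => pow_ne_zero l hγ
  have hσ0 : ∀ j, σ j ≠ 0 := fun j => div_ne_zero (hsc j) (hγp _)
  have hσ1 : ∀ j, O.valuation (σ j) * (O.valuation γ ^ L j * Am O pt j (L j)) = 1 := fun j => by
    rw [← hnorm j, ← map_pow, ← mul_assoc, ← map_mul, div_mul_cancel₀ _ (hγp _)]
  have hσpos : ∀ j, 0 < O.valuation (σ j) := fun j => zero_lt_iff.mpr ((map_ne_zero _).mpr (hσ0 j))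
  let F : Fin n ⊕ Fin 2 → Polynomial M := fun v =>
    Polynomial.C (σ (ty v)) * (pt v).comp (Polynomial.C γ * Polynomial.X)
  have hFc : ∀ v l, (F v).coeff l = σ (ty v) * ((pt v).coeff l * γ ^ l) := fun v l => by
    simp only [F]
    rw [Polynomial.coeff_C_mul, Polynomial.comp_C_mul_X_coeff]
  have hFle : ∀ v l, O.valuation ((F v).coeff l)
      ≤ O.valuation (σ (ty v)) * (O.valuation γ ^ l * Am O pt (ty v) l) := fun v l => by
    rw [hFc, map_mul, map_mul, map_pow, mul_comm (O.valuation ((pt v).coeff l))]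
    exact mul_le_mul_right (mul_le_mul_right (le_Am O pt v l) _) _
  have hF1 : ∀ v l, O.valuation ((F v).coeff l) ≤ 1 := fun v l => by
    refine (hFle v l).trans ?_
    rw [← hσ1 (ty v)]
    exact mul_le_mul_right (hall _ _) _
  have hFlt : ∀ v l, O.valuation γ ^ l * Am O pt (ty v) l < O.valuation γ ^ L (ty v) * Am O pt (ty v) (L (ty v))
      → O.valuation ((F v).coeff l) < 1 := fun v l hlt => by
    refine lt_of_le_of_lt (hFle v l) ?_
    rw [← hσ1 (ty v)]
    exact (mul_lt_mul_iff_right₀ (hσpos _)).mpr hlt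
  have hlift : ∀ v, ∃ P : Polynomial O, P.map (algebraMap O M) = F v := fun v => by
    refine (Polynomial.mem_lifts _).mp ((Polynomial.lifts_iff_coeff_lifts _).mpr fun l => ?_)
    exact ⟨⟨(F v).coeff l, (O.valuation_le_one_iff _).mp (hF1 v l)⟩, rfl⟩
  choose P hP using hlift
  have hPc : ∀ v l, (((P v).coeff l : O) : M) = (F v).coeff l := fun v l => by
    rw [← hP v, Polynomial.coeff_map]; rfl
  have hinj : Function.Injective (Polynomial.mapRingHom (algebraMap O M)) :=
    Polynomial.map_injective _ (IsFractionRing.injective O M)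
  obtain ⟨r0, hr0⟩ := hev 0
  obtain ⟨r1, hr1⟩ := hev 1
  let W : Polynomial M := Polynomial.C (σ 0 ^ r0 * σ 1 ^ r1) * Z.comp (Polynomial.C γ * Polynomial.X)
  have hW : (aeval P (bOf cO)).map (algebraMap O M) = W ^ 2 := by
    have e1 := map_aeval_bOf (Polynomial.mapRingHom (algebraMap O M)) cO (fun e => (cO e : M))
      (fun e => by
        rw [Polynomial.algebraMap_apply, Polynomial.algebraMap_apply]
        simp) P
    change (Polynomial.mapRingHom (algebraMap O M)) _ = _
    rw [e1]
    have e2 := map_aeval_bOf (Polynomial.compRingHom (Polynomial.C γ * Polynomial.X))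
      (fun e => (cO e : M)) (fun e => (cO e : M)) (fun e => by
        rw [Polynomial.algebraMap_apply]; simp) pt
    rw [hZ] at e2
    have e3 := bh_scale (BH_bOf (fun e => (cO e : M))) (fun j => Polynomial.C (σ j))
      (fun v => (pt v).comp (Polynomial.C γ * Polynomial.X))
    have e4 : (fun v => Polynomial.mapRingHom (algebraMap O M) (P v)) = fun v =>
      Polynomial.C (σ (ty v)) * (pt v).comp (Polynomial.C γ * Polynomial.X) := funext fun v => hP v
    rw [e4, e3]
    have e5 : aeval (fun v => (pt v).comp (Polynomial.C γ * Polynomial.X)) (bOf (fun e => (cO e : M)))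
      = (Z.comp (Polynomial.C γ * Polynomial.X)) ^ 2 := by
      rw [← Polynomial.pow_comp]; exact e2.symm
    rw [e5, hr0, hr1]
    simp only [W, map_mul, map_pow]
    ring
  obtain ⟨W', hW'⟩ := int_sq O W _ hW
  have hsq : aeval P (bOf cO) = W' ^ 2 := hinj (by
    rw [map_pow]
    change (aeval P (bOf cO)).map (algebraMap O M) = (W'.map (algebraMap O M)) ^ 2
    rw [hW, hW'])
  have hsq' : aeval (fun v => (P v).map π) (bOf c) = (W'.map π) ^ 2 := by
    have e1 := map_aeval_bOf (Polynomial.mapRingHom π) cO c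
      (fun e => by
        rw [Polynomial.algebraMap_apply, IsScalarTower.algebraMap_apply k m (Polynomial m),
          Polynomial.algebraMap_apply]
        simp [hcO]) P
    rw [hsq, map_pow] at e1
    exact e1.symm
  have hcoef : ∀ v l, ((P v).map π).coeff l = π ((P v).coeff l) := fun v l => Polynomial.coeff_map _ _
  have hres := thmC hn h0 h1 hev hdn c hc D (fun v => (P v).map π) ⟨_, hsq'⟩ L N
    (fun v l hl => by
      rw [hcoef]
      exact hπ _ (by rw [hPc]; exact hFlt v l (hlow _ _ hl)))
    (fun v => by
      refine Polynomial.natDegree_le_iff_coeff_eq_zero.mpr fun l hl => ?_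
      rw [hcoef]
      exact hπ _ (by rw [hPc]; exact hFlt v l (hhigh _ _ hl)))
    (by
      convert hNZ using 2 with v
      rw [hcoef]
      congr 1
      apply Subtype.ext
      rw [hPc, hFc, hq']
      change sc (ty v) / γ ^ L (ty v) * _ = _
      field_simp)
    (fun j => by
      obtain ⟨v, hv, hv2⟩ := Am_eq O pt j (N j)
      refine ⟨v, hv, ?_⟩
      rw [hcoef]
      apply pi_ne
      rw [hPc, hFc, map_mul, map_mul, ← hv2, hv, map_pow, mul_comm (Am O pt j (N j)), hLN, hσ1])
  refine ⟨fun j => σ j * γ ^ N j, fun v => (P v).coeff (N (ty v)), fun j => mul_ne_zero (hσ0 j) (hγp _),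
    fun v => ?_, ?_⟩
  · rw [hPc, hFc]; ring
  · convert hres using 2 with v
    rw [hcoef]

theorem newton {n : ℕ} [NeZero n] {dg : Fin 2 → ℕ} (hn : 3 ≤ n) (h0 : 3 ≤ dg 0) (h1 : 2 = dg 1)
    (hev : ∀ j, Even (dg j)) (hdn : n ≤ dg 0)
    {k m M C : Type*} [Field k] [Algebra (ZMod 2) k] [IsAlgClosed k] [Field m] [Algebra k m] [Field M]
    [Field C] [IsAlgClosed C] [Algebra C M]
    (O : ValuationSubring M) (π : O →+* m) (hπ : ∀ x : O, O.valuation (x : M) < 1 → π x = 0)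
    (hval : ∀ x : M, x ≠ 0 → ∃ a : C, O.valuation (algebraMap C M a) = O.valuation x)
    (cO : Ms n dg → O) (c : Ms n dg → k) (hc : AlgebraicIndependent (ZMod 2) c)
    (hcO : ∀ e, π (cO e) = algebraMap k m (c e))
    (D : Fin n → Derivation k m m) (pt : Fin n ⊕ Fin 2 → Polynomial M) (Z : Polynomial M)
    (hZ : aeval pt (bOf (fun e => (cO e : M))) = Z ^ 2) (N : Fin 2 → ℕ)
    (hN : ∀ v, (pt v).natDegree ≤ N (ty v)) (hNn : ∀ j, ∃ v, ty v = j ∧ (pt v).coeff (N j) ≠ 0)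
    (h : NZM O π D (bOf c) (fun v => (pt v).coeff 0)) :
    NZM O π D (bOf c) (fun v => (pt v).coeff (N (ty v))) := by
  classical
  set A := Am O pt with hA
  have hAz : ∀ j l, N j < l → A j l = 0 := fun j l hl => by
    obtain ⟨v, hv, h2⟩ := Am_eq O pt j l
    rw [hA, h2, Polynomial.coeff_eq_zero_of_natDegree_lt (lt_of_le_of_lt (hN v) (by rw [hv]; exact hl)), map_zero]
  have hAne : ∀ j l, (∃ v, ty v = j ∧ (pt v).coeff l ≠ 0) → A j l ≠ 0 := by
    rintro j l ⟨v, rfl, hv⟩ h0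
    have := le_Am O pt v l
    rw [← hA, h0, le_zero_iff, map_eq_zero] at this
    exact hv this
  have hAN : ∀ j, A j (N j) ≠ 0 := fun j => hAne j _ (hNn j)
  have hNZA : ∀ J : Fin 2 → ℕ, NZM O π D (bOf c) (fun v => (pt v).coeff (J (ty v))) → ∀ j, A j (J j) ≠ 0 := by
    rintro J ⟨sc, q', -, hq, hNZ⟩ j
    obtain ⟨v, hv, h2⟩ := NZ_ne D _ hNZ j
    refine hAne j _ ⟨v, hv, fun h3 => h2 ?_⟩
    have : q' v = 0 := Subtype.ext (by
      have := hq v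
      simp only [hv, h3, mul_zero] at this
      exact this)
    rw [this, map_zero]
  let S : Set O.ValueGroup := Set.range fun a : C => O.valuation (algebraMap C M a)
  let St : (Fin 2 → ℕ) → Prop := fun J => (∃ w, (∀ j l, J j < l → w ^ l * A j l < w ^ J j * A j (J j)) ∧
    (∀ j l, l < J j → w ^ l * A j l ≤ w ^ J j * A j (J j))) ∧
    NZM O π D (bOf c) (fun v => (pt v).coeff (J (ty v)))
  have key : ∀ r (J : Fin 2 → ℕ), St J → N 0 + N 1 - (J 0 + J 1) ≤ r → St N := by
    intro r
    induction r with
    | zero =>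
      intro J hJ hr
      have hJ0 := hNZA J hJ.2
      have hle : ∀ j, J j ≤ N j := fun j => by by_contra hh; exact hJ0 j (hAz j _ (not_le.mp hh))
      have : J = N := by
        have a0 := hle 0
        have a1 := hle 1
        ext j
        fin_cases j
        · change J 0 = N 0; omega
        · change J 1 = N 1; omega
      rw [← this]; exact hJ
    | succ r ih =>
      intro J hJ hr
      by_cases hne : ∃ j, J j ≠ N j
      swap
      · push Not at hne
        have : J = N := funext hne
        rw [← this]; exact hJ
      obtain ⟨⟨w, hw1, hw2⟩, hJN⟩ := hJ
      obtain ⟨w', ⟨a, ha⟩, hw0, J', b1, ⟨j1, b2⟩, b3, b4, b5, b6⟩ := chain_step A N J (hNZA J hJN) hAz hAN w hw1 hw2 S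
        (fun j l hl hAl => by
          have e1 : ∃ a : C, O.valuation (algebraMap C M a) = A j l := by
            obtain ⟨v, hv, h2⟩ := Am_eq O pt j l
            rw [hA, h2]
            exact hval _ fun h3 => hAl (by rw [hA, h2, h3, map_zero])
          have e2 : ∃ a : C, O.valuation (algebraMap C M a) = A j (J j) := by
            obtain ⟨v, hv, h2⟩ := Am_eq O pt j (J j)
            rw [hA, h2]
            exact hval _ fun h3 => hNZA J hJN j (by rw [hA, h2, h3, map_zero])
          obtain ⟨a, ha⟩ := e1
          obtain ⟨b, hb⟩ := e2
          obtain ⟨z, hz⟩ := IsAlgClosed.exists_pow_nat_eq (b / a) (n := l - J j) (by omega)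
          refine ⟨_, ⟨z, rfl⟩, ?_⟩
          have ha0 : a ≠ 0 := fun h3 => hAl (by rw [← ha, h3, map_zero, map_zero])
          rw [← ha, ← hb, ← map_pow, ← map_pow, ← map_mul, ← map_mul, hz, div_mul_cancel₀ _ ha0]) hne
      simp only at ha
      rw [← ha] at b3 b4 b5 b6
      have hγ : algebraMap C M a ≠ 0 := fun h3 => hw0 (by rw [← ha, h3, map_zero])
      have hstep := newton_step hn h0 h1 hev hdn O π hπ cO c hc hcO D pt Z hZ J J' (algebraMap C M a) hγ b3 b4 b5 b6 hJN
      refine ih J' ⟨⟨O.valuation (algebraMap C M a), fun j l hl => ?_, fun j l hl => ?_⟩, hstep⟩ ?_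
      · rw [b6]; exact b5 j l hl
      · rw [b6]; exact b3 j l
      · have hJ0' := hNZA J' hstep
        have hle : ∀ j, J' j ≤ N j := fun j => by by_contra hh; exact hJ0' j (hAz j _ (not_le.mp hh))
        have a0 := hle 0
        have a1 := hle 1
        have c0 := b1 0
        have c1 := b1 1
        have : j1 = 0 ∨ j1 = 1 := by omega
        rcases this with rfl | rfl <;> omega
  refine (key _ (fun _ => 0) ⟨⟨0, fun j l hl => ?_, fun j l hl => absurd hl (Nat.not_lt_zero l)⟩, h⟩ le_rfl).2
  rw [zero_pow (by omega), zero_mul, pow_zero, one_mul]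
  exact zero_lt_iff.mpr (hNZA (fun _ => 0) h j)
end DC

namespace DC

lemma val {R K F : Type*} [CommRing R] [Field K] [CommRing F] [IsDomain F] (f : R →+* K)
    (hf : Function.Injective f) (φ : R →+* F) :
    ∃ O : ValuationSubring K, ∀ r, f r ∈ O ∧ (O.valuation (f r) < 1 ↔ φ r = 0) := by
  have hP : (RingHom.ker φ).IsPrime := RingHom.ker_isPrime φ
  have hu : ∀ y : (RingHom.ker φ).primeCompl, IsUnit (f y) := by
    intro y
    rw [isUnit_iff_ne_zero]
    intro h
    have h2 : (y : R) = 0 := hf (by rw [h, map_zero])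
    exact y.2 (by rw [h2]; exact Ideal.zero_mem _)
  obtain ⟨O, h, hl⟩ := IsLocalRing.exists_factor_valuationRing
    (IsLocalization.lift hu : Localization.AtPrime (RingHom.ker φ) →+* K)
  refine ⟨O, fun r => ?_⟩
  have e : f r = (IsLocalization.lift hu : Localization.AtPrime (RingHom.ker φ) →+* K)
      (algebraMap R _ r) := by simp
  have hm : f r ∈ O := by rw [e]; exact h _
  refine ⟨hm, ?_⟩
  rw [← not_iff_not]
  have h1 : (¬ O.valuation (f r) < 1) ↔ IsUnit (⟨f r, hm⟩ : O) := by
    rw [O.valuation_eq_one_iff]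
    have := O.valuation_le_one ⟨f r, hm⟩
    constructor
    · intro h; exact le_antisymm this (not_lt.1 h)
    · intro h; rw [← h]; exact lt_irrefl _
  rw [h1]
  have h2 : IsUnit (⟨f r, hm⟩ : O) ↔ IsUnit (algebraMap R (Localization.AtPrime (RingHom.ker φ)) r) := by
    constructor
    · intro hh
      apply hl.1
      have e2 : (IsLocalization.lift hu : Localization.AtPrime (RingHom.ker φ) →+* K).codRestrict O.toSubring h (algebraMap R _ r) = (⟨f r, hm⟩ : O) := Subtype.ext e.symm
      rw [e2]; exact hh
    · intro hh
      have e2 : (IsLocalization.lift hu : Localization.AtPrime (RingHom.ker φ) →+* K).codRestrict O.toSubring h (algebraMap R _ r) = (⟨f r, hm⟩ : O) := Subtype.ext e.symm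
      have := hh.map ((IsLocalization.lift hu : Localization.AtPrime (RingHom.ker φ) →+* K).codRestrict O.toSubring h)
      rw [e2] at this; exact this
  rw [h2, IsLocalization.AtPrime.isUnit_to_map_iff _ (RingHom.ker φ)]
  exact Iff.rfl

lemma res_algClosed {K : Type*} [Field K] [IsAlgClosed K] (O : ValuationSubring K) :
    IsAlgClosed (IsLocalRing.ResidueField O) := by
  apply IsAlgClosed.of_exists_root
  intro p hp hirr
  have hd : p.degree ≠ 0 := (Polynomial.degree_pos_of_irreducible hirr).ne'
  obtain ⟨q, hq, hqd, hqm⟩ := Polynomial.lifts_and_natDegree_eq_and_monic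
    ((Polynomial.mem_lifts _).2 (Polynomial.map_surjective _ IsLocalRing.residue_surjective p)
      : p ∈ Polynomial.lifts (IsLocalRing.residue O)) hp
  obtain ⟨x, hx⟩ := IsAlgClosed.exists_root (q.map (algebraMap O K)) (by
    rw [hqm.degree_map]
    intro h
    apply hd
    rw [← hq, hqm.degree_map, h])
  have hi : IsIntegral O x := ⟨q, hqm, by rwa [Polynomial.eval₂_eq_eval_map]⟩
  obtain ⟨y, hy⟩ := IsIntegrallyClosed.isIntegral_iff.1 hi
  refine ⟨IsLocalRing.residue O y, ?_⟩
  rw [← hq, Polynomial.eval_map, Polynomial.eval₂_at_apply]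
  have : Polynomial.eval y q = 0 := by
    apply FaithfulSMul.algebraMap_injective O K
    rw [map_zero, ← Polynomial.eval₂_at_apply, hy, Polynomial.eval₂_eq_eval_map]
    exact hx
  rw [this, map_zero]

lemma red2 {ι C : Type} [Field C] (c : ι → C) (hc : AlgebraicIndependent ℤ c) :
    ∃ (O : ValuationSubring C) (c' : ι → O) (_ : Algebra (ZMod 2) (IsLocalRing.ResidueField O)),
      (∀ i, (c' i : C) = c i) ∧
      AlgebraicIndependent (ZMod 2) (fun i => IsLocalRing.residue O (c' i)) := by
  obtain ⟨O, hO⟩ := val (aeval c : MvPolynomial ι ℤ →ₐ[ℤ] C).toRingHom hc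
    (MvPolynomial.map (Int.castRingHom (ZMod 2)) : MvPolynomial ι ℤ →+* MvPolynomial ι (ZMod 2))
  have hci : ∀ i, c i ∈ O := fun i => by simpa using (hO (X i)).1
  have h2 : (2 : IsLocalRing.ResidueField O) = 0 := by
    have h : O.valuation (2 : C) < 1 := by
      have := (hO (MvPolynomial.C (2:ℤ))).2.2 (by rw [map_C, show (Int.castRingHom (ZMod 2)) 2 = 0 from rfl, map_zero])
      simpa using this
    have h3 : (2 : O) ∈ IsLocalRing.maximalIdeal O := (O.valuation_lt_one_iff _).2 h
    have := (IsLocalRing.residue_eq_zero_iff (2 : O)).2 h3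
    rw [← this, map_ofNat]
  haveI : CharP (IsLocalRing.ResidueField O) 2 :=
    CharTwo.of_one_ne_zero_of_two_eq_zero one_ne_zero h2
  letI al : Algebra (ZMod 2) (IsLocalRing.ResidueField O) := ZMod.algebra _ 2
  refine ⟨O, fun i => ⟨c i, hci i⟩, al, fun i => rfl, ?_⟩
  rw [algebraicIndependent_iff]
  intro p hp
  obtain ⟨q, rfl⟩ := MvPolynomial.map_surjective (Int.castRingHom (ZMod 2)) (ZMod.ringHom_surjective _) p
  refine (hO q).2.1 ?_
  have e1 : aeval (fun i => IsLocalRing.residue O (⟨c i, hci i⟩ : O)) (map (Int.castRingHom (ZMod 2)) q)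
      = IsLocalRing.residue O (aeval (fun i => (⟨c i, hci i⟩ : O)) q) := by
    simp only [aeval_def, eval₂_map, hom_eval₂]
    congr 1
    exact RingHom.ext_int _ _
  rw [e1, IsLocalRing.residue_eq_zero_iff, O.valuation_lt_one_iff] at hp
  convert hp using 2
  have : ((aeval (fun i => (⟨c i, hci i⟩ : O)) q : O) : C) = O.subtype (aeval (fun i => (⟨c i, hci i⟩ : O)) q) := rfl
  rw [this]
  simp only [aeval_def, hom_eval₂, AlgHom.toRingHom_eq_coe, RingHom.coe_coe]
  congr 1

end DC

namespace DC

abbrev QA {V A : Type} [CommRing A] (b : MvPolynomial V A) := QuadraticAlgebra (MvPolynomial V A) b 0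

noncomputable def qmap {V A B : Type} [CommRing A] [CommRing B] (f : A →+* B) (b : MvPolynomial V A)
    (b' : MvPolynomial V B) (h : map f b = b') : QA b →+* QA b' where
  toFun x := ⟨map f x.re, map f x.im⟩
  map_zero' := by ext <;> simp
  map_one' := by ext <;> simp [QuadraticAlgebra.re_one, QuadraticAlgebra.im_one]
  map_add' x y := by ext <;> simp
  map_mul' x y := by ext <;> simp [h]

lemma qa_domain {V k : Type} [Field k] [CharP k 2] (b : MvPolynomial V k) (v : V) (hb : pderiv v b ≠ 0) :
    IsDomain (QA b) := by
  have key : ∀ x : QA b, QuadraticAlgebra.norm x = 0 → x = 0 := by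
    intro x hx
    rw [QuadraticAlgebra.norm_def] at hx
    simp only [zero_mul, add_zero] at hx
    have h2 : (2 : MvPolynomial V k) = 0 := CharTwo.two_eq_zero
    have h3 := congrArg (pderiv v) hx
    simp only [map_sub, Derivation.leibniz, map_zero, smul_eq_mul] at h3
    have h4 : pderiv v b * (x.im * x.im) = 0 := by
      linear_combination (-1 : MvPolynomial V k) * h3 + (x.re * pderiv v x.re - b * x.im * pderiv v x.im) * h2
    have h5 : x.im = 0 := by
      rcases mul_eq_zero.1 h4 with h | h
      · exact absurd h hb
      · exact mul_self_eq_zero.1 h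
    have h6 : x.re = 0 := by
      rw [h5] at hx
      apply mul_self_eq_zero.1
      simpa using hx
    ext1
    · exact h6
    · exact h5
  haveI : NoZeroDivisors (QA b) := ⟨fun {x y} hxy => by
    have := congrArg QuadraticAlgebra.norm hxy
    rw [map_mul QuadraticAlgebra.norm, QuadraticAlgebra.norm_zero] at this
    rcases mul_eq_zero.1 this with h | h
    · exact Or.inl (key _ h)
    · exact Or.inr (key _ h)⟩
  exact NoZeroDivisors.to_isDomain _

section
variable {V C k : Type} [Field C] [Field k] (O : ValuationSubring C) (res : O →+* k) (bO : MvPolynomial V O)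

lemma lift_poly (a : C) (ha : a ≠ 0) (p : MvPolynomial V C) (h : ∀ e, O.valuation (p.coeff e) ≤ O.valuation a) :
    ∃ p' : MvPolynomial V O, p = MvPolynomial.C a * map O.subtype p' := by
  have hm : ∀ e, a⁻¹ * p.coeff e ∈ O := fun e => by
    rw [← O.valuation_le_one_iff, map_mul, map_inv₀]
    rw [inv_mul_le_iff₀ (zero_lt_iff.2 (by simpa using ha)), mul_one]
    exact h e
  refine ⟨∑ e ∈ p.support, monomial e ⟨a⁻¹ * p.coeff e, hm e⟩, ?_⟩
  rw [map_sum (map O.subtype)]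
  conv_lhs => rw [p.as_sum]
  rw [Finset.mul_sum]
  refine Finset.sum_congr rfl fun e _ => ?_
  rw [map_monomial, C_mul_monomial]
  congr 1
  show _ = a * (a⁻¹ * _)
  rw [mul_inv_cancel_left₀ ha]

lemma content (bC : MvPolynomial V C) (hC : map O.subtype bO = bC)
    (bk : MvPolynomial V k) (hk : map res bO = bk)
    (x : QA bC) (hx : x ≠ 0) :
    ∃ (a : C) (y : QA bO), a ≠ 0 ∧ x = algebraMap C _ a * qmap O.subtype bO bC hC y ∧
      qmap res bO bk hk y ≠ 0 := by
  classical
  obtain ⟨e0, he0⟩ : ∃ e, x.re.coeff e ≠ 0 ∨ x.im.coeff e ≠ 0 := by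
    by_contra hcon
    push Not at hcon
    apply hx
    ext e
    · simpa using (hcon e).1
    · simpa using (hcon e).2
  let g : Bool × (V →₀ ℕ) → C := fun t => if t.1 then x.re.coeff t.2 else x.im.coeff t.2
  let T : Finset (Bool × (V →₀ ℕ)) := Finset.univ ×ˢ (insert e0 (x.re.support ∪ x.im.support))
  obtain ⟨t, htT, ht⟩ := T.exists_max_image (fun t => O.valuation (g t))
    ⟨(true, e0), by simp [T]⟩
  have hg : ∀ s, O.valuation (g s) ≤ O.valuation (g t) := by
    intro s
    by_cases hs : s ∈ T
    · exact ht s hs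
    · have : g s = 0 := by
        simp only [T, Finset.mem_product, Finset.mem_univ, true_and, Finset.mem_insert, Finset.mem_union,
          mem_support_iff, not_or, not_not] at hs
        simp only [g]; split_ifs
        · exact hs.2.1
        · exact hs.2.2
      rw [this, map_zero]; exact zero_le
  have ha : g t ≠ 0 := by
    intro h
    have : ∀ s, g s = 0 := fun s => by
      have := hg s
      rw [h, map_zero] at this
      simpa using this
    rcases he0 with h | h
    · exact h (by simpa [g] using this (true, e0))
    · exact h (by simpa [g] using this (false, e0))
  obtain ⟨p, hp⟩ := lift_poly O (g t) ha x.re (fun e => hg (true, e))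
  obtain ⟨q, hq⟩ := lift_poly O (g t) ha x.im (fun e => hg (false, e))
  refine ⟨g t, ⟨p, q⟩, ha, ?_, ?_⟩
  · have : algebraMap C (QA bC) (g t) = ⟨MvPolynomial.C (g t), 0⟩ := rfl
    rw [this]
    ext1
    · simpa [qmap] using hp
    · simpa [qmap] using hq
  · intro h
    have h1 : (1 : k) = 0 := by
      have hh : ∀ (r : MvPolynomial V C) (r' : MvPolynomial V O), r = MvPolynomial.C (g t) * map O.subtype r' →
          map res r' = 0 → r.coeff t.2 = g t → (1 : k) = 0 := by
        intro r r' hr h0 hr2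
        rw [hr, coeff_C_mul, coeff_map] at hr2
        have h3 : O.subtype (r'.coeff t.2) = 1 := mul_left_cancel₀ ha (by rw [hr2, mul_one])
        have h4 : r'.coeff t.2 = 1 := Subtype.ext h3
        have h5 := congrArg (coeff t.2) h0
        rw [coeff_map, h4, map_one, coeff_zero] at h5
        exact h5
      by_cases hb : t.1 = true
      · exact hh _ _ hp (congrArg QuadraticAlgebra.re h) (by simp [g, hb])
      · exact hh _ _ hq (congrArg QuadraticAlgebra.im h) (by simp [g, hb])
    exact one_ne_zero h1

lemma qmap_inj (bC : MvPolynomial V C) (hC : map O.subtype bO = bC) :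
    Function.Injective (qmap O.subtype bO bC hC) := by
  intro x y h
  ext1
  · exact map_injective _ O.subtype_injective (congrArg QuadraticAlgebra.re h)
  · exact map_injective _ O.subtype_injective (congrArg QuadraticAlgebra.im h)

lemma qmap_surj (hs : Function.Surjective res) (bk : MvPolynomial V k) (hk : map res bO = bk) :
    Function.Surjective (qmap res bO bk hk) := by
  intro x
  obtain ⟨p, hp⟩ := map_surjective res hs x.re
  obtain ⟨q, hq⟩ := map_surjective res hs x.im
  exact ⟨⟨p, q⟩, by ext1; exacts [hp, hq]⟩

lemma qaC_domain (bC : MvPolynomial V C) (hC : map O.subtype bO = bC)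
    (bk : MvPolynomial V k) (hk : map res bO = bk)
    [IsDomain (QA bk)] : IsDomain (QA bC) := by
  haveI : NoZeroDivisors (QA bC) := ⟨fun {x y} hxy => by
    by_contra hcon
    push Not at hcon
    obtain ⟨a, x', ha, hx, hx'⟩ := content O res bO bC hC bk hk x hcon.1
    obtain ⟨a', y', ha', hy, hy'⟩ := content O res bO bC hC bk hk y hcon.2
    have h1 : qmap O.subtype bO bC hC (x' * y') = 0 := by
      have hu : IsUnit (algebraMap C (QA bC) (a * a')) := (IsUnit.mk0 _ (mul_ne_zero ha ha')).map _
      rw [← hu.mul_right_eq_zero, ← hxy, hx, hy, map_mul, map_mul (qmap O.subtype bO bC hC)]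
      ring
    have h2 : x' * y' = 0 := qmap_inj O bO bC hC (by rw [h1, map_zero])
    have h3 := congrArg (qmap res bO bk hk) h2
    rw [map_mul, map_zero] at h3
    rcases mul_eq_zero.1 h3 with h | h
    · exact hx' h
    · exact hy' h⟩
  exact NoZeroDivisors.to_isDomain _
end

end DC

namespace DC

lemma der_qa {V k m : Type} [Fintype V] [Field k] [Field m] (b : MvPolynomial V k) [Algebra k m] [Algebra (QA b) m]
    [IsScalarTower k (QA b) m] [IsFractionRing (QA b) m] (g : V → m)
    (hg : ∑ v, algebraMap (QA b) m (algebraMap (MvPolynomial V k) _ (pderiv v b)) * g v = 0) :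
    ∃ D : Derivation k m m, ∀ v, D (algebraMap (QA b) m (algebraMap (MvPolynomial V k) _ (X v))) = g v := by
  classical
  let j : MvPolynomial V k →+* m := (algebraMap (QA b) m).comp (algebraMap (MvPolynomial V k) (QA b))
  let D0 : MvPolynomial V k → m := fun p => ∑ v, j (pderiv v p) * g v
  have hDb : D0 b = 0 := hg
  have hadd : ∀ p q, D0 (p + q) = D0 p + D0 q := fun p q => by
    simp only [D0, map_add, add_mul, Finset.sum_add_distrib]
  have hmul : ∀ p q, D0 (p * q) = j p * D0 q + j q * D0 p := fun p q => by
    simp only [D0, Finset.mul_sum, ← Finset.sum_add_distrib]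
    refine Finset.sum_congr rfl fun v _ => ?_
    rw [Derivation.leibniz]
    simp only [smul_eq_mul, map_add, map_mul]
    ring
  have hC : ∀ a : k, D0 (C a) = 0 := fun a => by simp [D0]
  let z : m := algebraMap (QA b) m QuadraticAlgebra.omega
  have hz : z * z = j b := by
    simp only [z, j, ← map_mul, RingHom.comp_apply]
    congr 1
    rw [QuadraticAlgebra.omega_mul_omega_eq_mk]; rfl
  have hre : ∀ x : QA b, algebraMap (QA b) m x = j x.re + j x.im * z := fun x => by
    simp only [z, j, RingHom.comp_apply, ← map_mul, ← map_add]
    congr 1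
    ext1 <;> simp
  have hk : ∀ a : k, algebraMap k m a = j (C a) := fun a => by
    rw [IsScalarTower.algebraMap_apply k (QA b) m]
    rfl
  let L : QA b →ₗ[k] m :=
    { toFun := fun x => D0 x.re + D0 x.im * z
      map_add' := fun x y => by simp only [QuadraticAlgebra.re_add, QuadraticAlgebra.im_add, hadd]; ring
      map_smul' := fun a x => by
        show D0 (a • x.re) + D0 (a • x.im) * z = a • (D0 x.re + D0 x.im * z)
        simp only [MvPolynomial.smul_eq_C_mul, hmul, hC]
        rw [Algebra.smul_def, hk]
        ring }
  have hL : ∀ x, L x = D0 x.re + D0 x.im * z := fun x => rfl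
  let D1 : Derivation k (QA b) m := Derivation.mk' L (fun x y => by
    simp only [Algebra.smul_def, hre, hL, QuadraticAlgebra.re_mul, QuadraticAlgebra.im_mul, hadd, hmul, hDb, map_mul,
      zero_mul, add_zero, mul_zero, map_add]
    linear_combination (-(j x.im * D0 y.im) - (j y.im * D0 x.im)) * hz)
  obtain ⟨D, hD⟩ := der_ext (nonZeroDivisors (QA b)) D1
  refine ⟨D, fun v => ?_⟩
  rw [hD]
  show D0 (X v) + D0 0 * z = g v
  have : D0 (X v) = g v := by
    simp only [D0]
    rw [Finset.sum_eq_single v]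
    · simp
    · intro w _ hw
      simp [pderiv_X, Pi.single_apply, hw.symm]
    · simp
  rw [this]
  simp [D0]

lemma det_gen {n : ℕ} [NeZero n] {k m : Type} [Field k] [Field m] [Algebra k m] (D : Fin n → Derivation k m m)
    (q : Fin n ⊕ Fin 2 → m) (hq : ∀ v, q v ≠ 0)
    (hD : ∀ i, i ≠ 0 → ∀ i', D i (q (Sum.inl i')) = if i' = i then 1 else 0)
    (hD1 : ∀ i, i ≠ 0 → D i (q (Sum.inr 1)) = 0) :
    (mat D q (Pi.single (Sum.inr 0) 1)).det ≠ 0 := by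
  classical
  intro h
  obtain ⟨w, hw0, hw⟩ := Matrix.exists_mulVec_eq_zero_iff.2 h
  apply hw0
  have row : ∀ r, ∑ v, mat D q (Pi.single (Sum.inr 0) 1) r v * w v = 0 := fun r => congrFun hw r
  have h1 : w (Sum.inr 0) = 0 := by
    have := row (Sum.inl 0)
    simpa [mat, Pi.single_apply] using this
  have h2 : ∀ i, i ≠ 0 → w (Sum.inl i) = 0 := fun i hi => by
    have := row (Sum.inl i)
    simpa [mat, hi, hD i hi, hD1 i hi, h1] using this
  have h3 : w (Sum.inl 0) = 0 := by
    have := row (Sum.inr 0)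
    simp only [mat, Fintype.sum_sum_type, ty_inl, ty_inr, if_true] at this
    rw [Finset.sum_eq_single 0 (fun i _ hi => by rw [h2 i hi, mul_zero]) (by simp)] at this
    simpa [hq] using this
  have h4 : w (Sum.inr 1) = 0 := by
    have := row (Sum.inr 1)
    simpa [mat, h1, hq] using this
  ext v
  rcases v with i | j
  · by_cases hi : i = 0
    · rw [hi]; exact h3
    · exact h2 i hi
  · fin_cases j
    · exact h1
    · exact h4

lemma der_part {n : ℕ} [NeZero n] {k m : Type} [Field k] [Field m] (b : MvPolynomial (Fin n ⊕ Fin 2) k)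
    (ψ : QA b →+* m) (hinj : Function.Injective ψ) (hsurj : ∀ z, ∃ x y, z = ψ x / ψ y)
    (hb : pderiv (Sum.inr 0) b ≠ 0) :
    ∃ (_ : Algebra k m) (D : Fin n → Derivation k m m), (∀ a, algebraMap k m a = ψ (algebraMap k _ a)) ∧
      NZ D b (fun v => ψ (algebraMap (MvPolynomial (Fin n ⊕ Fin 2) k) _ (X v))) := by
  classical
  letI a1 : Algebra (QA b) m := ψ.toAlgebra
  letI a2 : Algebra k m := (ψ.comp (algebraMap k (QA b))).toAlgebra
  haveI : IsScalarTower k (QA b) m := IsScalarTower.of_algebraMap_eq fun x => rfl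
  haveI : FaithfulSMul (QA b) m := (faithfulSMul_iff_algebraMap_injective _ _).2 hinj
  haveI : IsFractionRing (QA b) m := IsFractionRing.of_field _ _ hsurj
  let j : MvPolynomial (Fin n ⊕ Fin 2) k →+* m := (algebraMap (QA b) m).comp (algebraMap _ (QA b))
  have hj : Function.Injective j := hinj.comp QuadraticAlgebra.algebraMap_injective
  have hbd : ∀ v, bd b (fun v => j (X v)) v = j (pderiv v b) := fun v => by
    have : (aeval (fun v => j (X v)) : _ →ₐ[k] m).toRingHom = j := by
      apply MvPolynomial.ringHom_ext
      · intro r; simp only [AlgHom.toRingHom_eq_coe, RingHom.coe_coe, aeval_C]; rfl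
      · intro v; simp
    exact RingHom.congr_fun this _
  have hb0 : j (pderiv (Sum.inr 0) b) ≠ 0 := fun h => hb (hj (by rw [h, map_zero]))
  have ex : ∀ i : Fin n, ∃ D : Derivation k m m, ∀ v, D (j (X v)) =
      (if v = Sum.inl i then 1 else if v = Sum.inr 0 then - (j (pderiv (Sum.inl i) b) / j (pderiv (Sum.inr 0) b)) else 0) := by
    intro i
    refine der_qa b _ ?_
    show ∑ v, j (pderiv v b) * _ = 0
    rw [Fintype.sum_sum_type, Finset.sum_eq_single i]
    · simp
      field_simp
      ring
    · intro i' _ h; simp [h]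
    · simp
  choose D hD using ex
  refine ⟨a2, D, fun a => rfl, Sum.inr 0, ?_, ?_⟩
  · exact (hbd _).trans_ne hb0
  · refine det_gen D (fun v => j (X v)) (fun v h => X_ne_zero (R := k) v (hj (by rw [h, map_zero]))) ?_ ?_
    · intro i hi i'
      rw [hD]
      simp
    · intro i hi
      rw [hD]
      simp

end DC

namespace DC

lemma frlem {M : Type} [Field M] {a b c d : M} (n1 : b ≠ 0) (n2 : d ≠ 0) :
    a * c / (b * d) * d = a / b * c := by
  field_simp

theorem stageC {n : ℕ} [NeZero n] {C k : Type} [Field C] [Field k] (O : ValuationSubring C)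
    (res : O →+* k) (hs : Function.Surjective res) (hres : ∀ a : O, O.valuation (a : C) < 1 → res a = 0)
    (bO : MvPolynomial (Fin n ⊕ Fin 2) O) (bC : MvPolynomial (Fin n ⊕ Fin 2) C) (hC : map O.subtype bO = bC)
    (bk : MvPolynomial (Fin n ⊕ Fin 2) k) (hk : map res bO = bk)
    [IsDomain (QA bC)] [IsDomain (QA bk)] (hb : pderiv (Sum.inr 0) bk ≠ 0) :
    ∃ (OM : ValuationSubring (FractionRing (QA bC))) (m : Type) (_ : Field m)
      (_ : Algebra k m) (π : OM →+* m)
      (D : Fin n → Derivation k m m),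
      (∀ x : OM, OM.valuation (x : FractionRing (QA bC)) < 1 → π x = 0) ∧
      (∀ x : FractionRing (QA bC), x ≠ 0 → ∃ a : C, OM.valuation (algebraMap C _ a) = OM.valuation x) ∧
      (∀ a : O, ∃ h : algebraMap C (FractionRing (QA bC)) a ∈ OM,
        π ⟨_, h⟩ = algebraMap _ m (res a)) ∧
      ∃ q : Fin n ⊕ Fin 2 → OM, (∀ v, (q v : FractionRing (QA bC)) =
        algebraMap (QA bC) _ (algebraMap (MvPolynomial (Fin n ⊕ Fin 2) C) _ (X v))) ∧
        NZ D bk (fun v => π (q v)) := by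
  let M := FractionRing (QA bC)
  let ι := qmap O.subtype bO bC hC
  let ρ := qmap res bO bk hk
  let F : QA bO →+* M := (algebraMap (QA bC) M).comp ι
  have hF : Function.Injective F := (IsFractionRing.injective (QA bC) M).comp (qmap_inj O bO bC hC)
  obtain ⟨OM, hOM⟩ := val F hF ρ
  have hu : ∀ y, ρ y ≠ 0 → OM.valuation (F y) = 1 := fun y hy =>
    le_antisymm ((OM.valuation_le_one_iff _).2 (hOM y).1) (not_lt.1 fun h => hy ((hOM y).2.1 h))
  have hOa : ∀ a : O, F (algebraMap O (QA bO) a) = algebraMap C M a := by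
    intro a
    rw [IsScalarTower.algebraMap_apply C (QA bC) M]
    show algebraMap (QA bC) M (ι (algebraMap O (QA bO) a)) = _
    congr 1
    have : algebraMap O (QA bO) a = ⟨MvPolynomial.C a, 0⟩ := rfl
    rw [this]
    show (⟨map O.subtype (MvPolynomial.C a), map O.subtype 0⟩ : QA bC) = ⟨MvPolynomial.C (a : C), 0⟩
    rw [map_C, map_zero]
    rfl
  have hra : ∀ a : O, ρ (algebraMap O (QA bO) a) = algebraMap _ (QA bk) (res a) := by
    intro a
    have : algebraMap O (QA bO) a = ⟨MvPolynomial.C a, 0⟩ := rfl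
    rw [this]
    show (⟨map _ (MvPolynomial.C a), map _ 0⟩ : QA bk) = ⟨MvPolynomial.C (res a), 0⟩
    rw [map_C, map_zero]
  have hCm : ∀ a : C, algebraMap C M a ∈ OM → a ∈ O := by
    intro a ha
    by_contra hn
    have h1 : O.valuation a⁻¹ < 1 := by
      rw [← O.mem_nonunits_iff, O.inv_mem_nonunits_iff]
      exact Or.inr hn
    have h2 : a⁻¹ ∈ O := (O.valuation_le_one_iff _).1 h1.le
    have h3 : ρ (algebraMap O (QA bO) ⟨a⁻¹, h2⟩) = 0 := by
      rw [hra, hres _ h1, map_zero]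
    have h4 := (hOM _).2.2 h3
    rw [hOa] at h4
    simp only [map_inv₀] at h4
    rw [← map_inv₀ OM.valuation, ← OM.mem_nonunits_iff, OM.inv_mem_nonunits_iff] at h4
    rcases h4 with h | h
    · apply hn
      rw [(map_eq_zero (algebraMap C M)).1 h]
      exact O.zero_mem
    · exact h ha
  have fr : ∀ x : M, x ≠ 0 → ∃ (a : C) (y y' : QA bO), a ≠ 0 ∧ ρ y ≠ 0 ∧ ρ y' ≠ 0 ∧ x * F y' = algebraMap C M a * F y := by
    intro x hx
    obtain ⟨s, t, ht, rfl⟩ := IsFractionRing.div_surjective (A := QA bC) x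
    have ht0 : t ≠ 0 := nonZeroDivisors.ne_zero ht
    have hs0 : s ≠ 0 := by rintro rfl; simp at hx
    obtain ⟨a, y, ha, hy, hy'⟩ := content O res bO bC hC bk hk s hs0
    obtain ⟨a', y1, ha', hy1, hy1'⟩ := content O res bO bC hC bk hk t ht0
    refine ⟨a / a', y, y1, div_ne_zero ha ha', hy', hy1', ?_⟩
    have e1 : algebraMap (QA bC) M s = algebraMap C M a * F y := by
      rw [hy, map_mul, IsScalarTower.algebraMap_apply C (QA bC) M]; rfl
    have e2 : algebraMap (QA bC) M t = algebraMap C M a' * F y1 := by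
      rw [hy1, map_mul, IsScalarTower.algebraMap_apply C (QA bC) M]; rfl
    have n1 : algebraMap C M a' ≠ 0 := by simpa using ha'
    have n2 : F y1 ≠ 0 := fun h => hy1' (by
      have : y1 = 0 := hF (by rw [h, map_zero])
      show ρ y1 = 0
      rw [this, map_zero])
    show algebraMap (QA bC) M s / algebraMap (QA bC) M t * F y1 = _
    rw [e1, e2, map_div₀]
    exact frlem n1 n2
  let m := IsLocalRing.ResidueField OM
  let F' : QA bO →+* OM := F.codRestrict OM.toSubring (fun y => (hOM y).1)
  let G : QA bO →+* m := (IsLocalRing.residue OM).comp F'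
  have hG : ∀ y, G y = 0 ↔ ρ y = 0 := fun y => by
    show IsLocalRing.residue OM (F' y) = 0 ↔ _
    rw [IsLocalRing.residue_eq_zero_iff, OM.valuation_lt_one_iff]
    exact (hOM y).2
  have hρs : Function.Surjective ρ := qmap_surj O res bO hs bk hk
  let ψ : QA bk →+* m := RingHom.liftOfSurjective ρ hρs ⟨G, fun y hy => (hG y).2 hy⟩
  have hψ : ∀ y, ψ (ρ y) = G y := fun y => RingHom.liftOfRightInverse_comp_apply ρ _ _ _ y
  have hinj : Function.Injective ψ := by
    rw [injective_iff_map_eq_zero]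
    intro x hx
    obtain ⟨y, rfl⟩ := hρs x
    rw [hψ] at hx
    exact (hG y).1 hx
  have hsurj : ∀ z, ∃ x y, z = ψ x / ψ y := by
    intro z
    obtain ⟨x, rfl⟩ := IsLocalRing.residue_surjective z
    by_cases hx : (x : M) = 0
    · refine ⟨0, 1, ?_⟩
      have : x = 0 := Subtype.ext hx
      rw [this]; simp
    · obtain ⟨a, y, y', ha, hy, hy', he⟩ := fr x hx
      have hv : algebraMap C M a ∈ OM := by
        rw [← OM.valuation_le_one_iff]
        have := congrArg OM.valuation he
        rw [map_mul, map_mul, hu _ hy, hu _ hy', mul_one, mul_one] at this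
        rw [← this]
        exact OM.valuation_le_one x
      have haO := hCm a hv
      refine ⟨ρ (algebraMap O _ ⟨a, haO⟩ * y), ρ y', ?_⟩
      rw [hψ, hψ, eq_div_iff (fun h => hy' ((hG y').1 h)), map_mul]
      show IsLocalRing.residue OM x * IsLocalRing.residue OM (F' y') = IsLocalRing.residue OM (F' _) * IsLocalRing.residue OM (F' y)
      rw [← map_mul, ← map_mul]
      congr 1
      apply Subtype.ext
      show (x : M) * F y' = F _ * F y
      rw [hOa]
      exact he
  obtain ⟨alg, D, h1, h2⟩ := der_part bk ψ hinj hsurj hb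
  refine ⟨OM, m, inferInstance, alg, IsLocalRing.residue OM, D, ?_, ?_, ?_,
    fun v => F' (algebraMap (MvPolynomial (Fin n ⊕ Fin 2) O) _ (X v)), ?_, ?_⟩
  · intro x hx
    rw [IsLocalRing.residue_eq_zero_iff, OM.valuation_lt_one_iff]
    exact hx
  · intro x hx
    obtain ⟨a, y, y', ha, hy, hy', he⟩ := fr x hx
    refine ⟨a, ?_⟩
    have := congrArg OM.valuation he
    rw [map_mul, map_mul, hu _ hy, hu _ hy', mul_one, mul_one] at this
    exact this.symm
  · intro a
    have hm : algebraMap C M a ∈ OM := by rw [← hOa]; exact (hOM _).1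
    refine ⟨hm, ?_⟩
    rw [h1, ← hra, hψ]
    show IsLocalRing.residue OM _ = IsLocalRing.residue OM (F' _)
    congr 1
    apply Subtype.ext
    exact (hOa a).symm
  · intro v
    show algebraMap (QA bC) M (ι (algebraMap _ _ (X v))) = _
    congr 1
    show (⟨map O.subtype (X v), map O.subtype 0⟩ : QA bC) = ⟨X v, 0⟩
    rw [map_X, map_zero]
  · convert h2 using 1
    funext v
    show G _ = _
    rw [← hψ]
    congr 1
    show (⟨map res (X v), map res 0⟩ : QA bk) = ⟨X v, 0⟩
    rw [map_X, map_zero]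

end DC

namespace DC

lemma red2' {ι C : Type} [Field C] [IsAlgClosed C] (c : ι → C) (hc : AlgebraicIndependent ℤ c) :
    ∃ (O : ValuationSubring C) (k : Type) (_ : Field k) (_ : Algebra (ZMod 2) k) (_ : IsAlgClosed k)
      (res : O →+* k) (c' : ι → O), Function.Surjective res ∧
      (∀ a : O, O.valuation (a : C) < 1 → res a = 0) ∧ (∀ i, (c' i : C) = c i) ∧
      AlgebraicIndependent (ZMod 2) (fun i => res (c' i)) := by
  obtain ⟨O, c', al, h1, h2⟩ := red2 c hc
  exact ⟨O, IsLocalRing.ResidueField O, inferInstance, al, res_algClosed O, IsLocalRing.residue O, c',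
    IsLocalRing.residue_surjective, fun a ha => (IsLocalRing.residue_eq_zero_iff _).2
      ((O.valuation_lt_one_iff _).2 ha), h1, h2⟩

lemma no_const {n : ℕ} [NeZero n] (hn : 2 ≤ n) {dg : Fin 2 → ℕ} {C k m M : Type} [Field C] [Field k] [Field m] [Field M]
    [Algebra C M] [Algebra k m] (O : ValuationSubring C) (res : O →+* k) (OM : ValuationSubring M) (π : OM →+* m)
    (hO : ∀ a : O, ∃ h : algebraMap C M a ∈ OM, π ⟨_, h⟩ = algebraMap k m (res a))
    (D : Fin n → Derivation k m m) (b : MvPolynomial (Fin n ⊕ Fin 2) k) (hb : BH dg b)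
    (t : Fin n ⊕ Fin 2 → C) (ht : ∀ j, ∃ v, ty v = j ∧ t v ≠ 0) :
    ¬ NZM OM π D b (fun v => algebraMap C M (t v)) := by
  classical
  rintro ⟨sc, q', hsc, hq', hNZ⟩
  have hmax : ∀ j : Fin 2, ∃ v0, ty v0 = j ∧ t v0 ≠ 0 ∧ ∀ v, ty v = j → O.valuation (t v) ≤ O.valuation (t v0) := by
    intro j
    obtain ⟨v1, hv1, hv1'⟩ := ht j
    obtain ⟨v0, hv0, hm⟩ := (Finset.univ.filter (fun v : Fin n ⊕ Fin 2 => ty v = j)).exists_max_image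
      (fun v => O.valuation (t v)) ⟨v1, by simpa using hv1⟩
    refine ⟨v0, by simpa using hv0, fun h => ?_, fun v hv => hm v (by simpa using hv)⟩
    have := hm v1 (by simpa using hv1)
    rw [h, map_zero] at this
    exact hv1' (by simpa using this)
  choose v0 hty hne hm using hmax
  have hw : ∀ v, t v / t (v0 (ty v)) ∈ O := fun v => by
    rw [← O.valuation_le_one_iff, map_div₀]
    rw [div_le_one₀ (zero_lt_iff.2 (by simpa using hne _))]
    exact hm _ v rfl
  have key : ∀ v, π (q' v) = π (q' (v0 (ty v))) * algebraMap k m (res ⟨_, hw v⟩) := by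
    intro v
    obtain ⟨h, hh⟩ := hO ⟨_, hw v⟩
    rw [← hh, ← map_mul]
    congr 1
    apply Subtype.ext
    show (q' v : M) = (q' (v0 (ty v)) : M) * algebraMap C M (t v / t (v0 (ty v)))
    rw [hq', hq', hty, map_div₀, mul_assoc, mul_div_cancel₀]
    simpa using hne (ty v)
  have hS : ∀ j, π (q' (v0 j)) ≠ 0 := by
    intro j h
    obtain ⟨v, rfl, hv⟩ := NZ_ne D _ hNZ j
    exact hv (by rw [key, h, zero_mul])
  have h2 := NZ_scale D hb _ (fun j => (π (q' (v0 j)))⁻¹) (fun j => inv_ne_zero (hS j)) hNZ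
  have e : (fun v => (π (q' (v0 (ty v))))⁻¹ * π (q' v)) = fun v => algebraMap k m (res ⟨_, hw v⟩) := by
    funext v
    rw [key v, inv_mul_cancel_left₀ (hS _)]
  simp only [e] at h2
  obtain ⟨v, -, h3⟩ := h2
  refine h3 (Matrix.det_eq_zero_of_row_eq_zero (Sum.inl ⟨1, hn⟩) fun w => ?_)
  have h1 : (⟨1, hn⟩ : Fin n) ≠ 0 := by
    intro h
    have := congrArg Fin.val h
    simp at this
  simp only [mat, if_neg h1, Derivation.map_algebraMap]

lemma pd_ne {n : ℕ} [NeZero n] (d : ℕ) {k : Type} [Field k] [Algebra (ZMod 2) k] (c : Ms n ![2 * d, 2] → k)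
    (hc : AlgebraicIndependent (ZMod 2) c) : pderiv (Sum.inr 0) (bOf c) ≠ 0 := by
  classical
  intro h
  let e : (Fin n ⊕ Fin 2) →₀ ℕ := Finsupp.single (Sum.inl 0) (2 * d) + Finsupp.single (Sum.inr 1) 1
  have h1 := congrArg (coeff e) h
  rw [coeff_pderiv, coeff_zero] at h1
  have he : ∀ j, (∑ v, if ty v = j then (e + Finsupp.single (Sum.inr 0) 1 : (Fin n ⊕ Fin 2) →₀ ℕ) v else 0) = (![2 * d, 2] : Fin 2 → ℕ) j := by
    intro j
    fin_cases j
    · simp [e, Finsupp.single_apply]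
    · simp [e, Finsupp.single_apply]
  have h2 := coeff_bOf c ⟨_, he⟩
  simp only at h2
  rw [h2] at h1
  have h3 : c ⟨_, he⟩ = 0 := by
    simpa [e, Finsupp.single_apply] using h1
  exact hc.ne_zero _ h3

theorem nocurve {n d : ℕ} [NeZero n] (hn : 3 ≤ n) (hd : n ≤ 2 * d) {C : Type} [Field C] [IsAlgClosed C]
    (c : Ms n ![2 * d, 2] → C) (hc : AlgebraicIndependent ℤ c) :
    ∃ _ : IsDomain (QA (bOf c)), ∀ (pt : Fin n ⊕ Fin 2 → Polynomial (FractionRing (QA (bOf c))))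
      (Z : Polynomial (FractionRing (QA (bOf c)))) (hZ : aeval pt (bOf c) = Z ^ 2) (N : Fin 2 → ℕ)
      (hN : ∀ v, (pt v).natDegree ≤ N (ty v)) (t : Fin n ⊕ Fin 2 → C)
      (htt : ∀ v, (pt v).coeff (N (ty v)) = algebraMap C _ (t v))
      (ht : ∀ j, ∃ v, ty v = j ∧ t v ≠ 0) (l : Fin 2 → FractionRing (QA (bOf c))) (hl : ∀ j, l j ≠ 0)
      (h0 : ∀ v, (pt v).coeff 0 = l (ty v) *
        algebraMap (QA (bOf c)) _ (algebraMap (MvPolynomial (Fin n ⊕ Fin 2) C) _ (X v))), False := by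
  obtain ⟨O, k, _, _, _, res, c', hs, hres, hc', hcc⟩ := red2' c hc
  have hC : map O.subtype (bOf c') = bOf c := by
    rw [map_bOf]; congr 1; funext i; exact hc' i
  have hk : map res (bOf c') = bOf (fun i => res (c' i)) := map_bOf _ _
  have hpd := pd_ne d _ hcc
  haveI : CharP k 2 := charP_of_injective_algebraMap (algebraMap (ZMod 2) k).injective 2
  haveI : IsDomain (QA (bOf (fun i => res (c' i)))) := qa_domain _ _ hpd
  haveI : IsDomain (QA (bOf c)) := qaC_domain O res (bOf c') (bOf c) hC _ hk
  refine ⟨inferInstance, ?_⟩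
  intro pt Z hZ N hN t htt ht l hl h0
  obtain ⟨OM, m, _, _, π, D, hπ, hval, hOO, q, hq, hNZ⟩ := stageC O res hs hres (bOf c') (bOf c) hC _ hk hpd
  choose hmem hpi using hOO
  have hbC : (aeval pt (bOf c) : Polynomial (FractionRing (QA (bOf c)))) =
      aeval pt (bOf (fun e => algebraMap C (FractionRing (QA (bOf c))) (c' e))) := by
    have := map_aeval_bOf (k1 := C) (k2 := FractionRing (QA (bOf c))) (RingHom.id (Polynomial (FractionRing (QA (bOf c))))) c
      (fun e => algebraMap C (FractionRing (QA (bOf c))) (c' e)) (fun e => by rw [hc']; rfl) pt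
    exact this
  have res1 := newton hn (by simp; omega) rfl (by
      intro j; fin_cases j <;> simp) hd OM π hπ hval (fun e => ⟨_, hmem (c' e)⟩) (fun i => res (c' i)) hcc
    (fun e => hpi (c' e)) D pt Z (hbC.symm.trans hZ) N hN (fun j => by
      obtain ⟨v, rfl, hv⟩ := ht j
      exact ⟨v, rfl, by rw [htt]; simpa using hv⟩)
    ⟨fun j => (l j)⁻¹, q, fun j => inv_ne_zero (hl j), fun v => by
      beta_reduce
      rw [hq, h0, inv_mul_cancel_left₀ (hl _)], hNZ⟩
  simp only [htt] at res1
  exact no_const (by omega) O res OM π (fun a => ⟨hmem a, hpi a⟩) D _ (BH_bOf _) t ht res1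

end DC

namespace DC

def HC {M : Type} [CommRing M] (N : ℕ) (f : Polynomial M) (a : M) : Prop := f.natDegree ≤ N ∧ f.coeff N = a

lemma HC_mul {M : Type} [CommRing M] {N N' : ℕ} {f g : Polynomial M} {a b : M} (h : HC N f a) (h' : HC N' g b) :
    HC (N + N') (f * g) (a * b) :=
  ⟨Polynomial.natDegree_mul_le_of_le h.1 h'.1, by
    rw [Polynomial.coeff_mul_add_eq_of_natDegree_le h.1 h'.1, h.2, h'.2]⟩

lemma HC_pow {M : Type} [CommRing M] {N : ℕ} {f : Polynomial M} {a : M} (h : HC N f a) (e : ℕ) :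
    HC (e * N) (f ^ e) (a ^ e) :=
  ⟨Polynomial.natDegree_pow_le_of_le e h.1, by rw [Polynomial.coeff_pow_of_natDegree_le h.1, h.2]⟩

lemma HC_prod {M ι : Type} [CommRing M] (s : Finset ι) (N : ι → ℕ) (f : ι → Polynomial M) (a : ι → M)
    (h : ∀ i, HC (N i) (f i) (a i)) : HC (∑ i ∈ s, N i) (∏ i ∈ s, f i) (∏ i ∈ s, a i) := by
  classical
  induction s using Finset.induction_on with
  | empty => simp [HC]
  | insert i s hi ih =>
    rw [Finset.sum_insert hi, Finset.prod_insert hi, Finset.prod_insert hi]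
    exact HC_mul (h i) ih

lemma line {C M : Type} [Field C] [Field M] [Algebra C M] {s : ℕ} (σ : Fin s → M) (c : Fin s → C)
    (P : MvPolynomial (Fin s) C) (N : ℕ) (hN : P.totalDegree ≤ N) :
    HC N (aeval (fun i => Polynomial.C (σ i) + Polynomial.X * Polynomial.C (algebraMap C M (c i))) P)
      (algebraMap C M (eval c (homogeneousComponent N P))) := by
  classical
  have h1 : ∀ m : Fin s →₀ ℕ, HC (∑ i, m i)
      (∏ i, (Polynomial.C (σ i) + Polynomial.X * Polynomial.C (algebraMap C M (c i))) ^ m i)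
      (∏ i, (algebraMap C M (c i)) ^ m i) := fun m => by
    refine HC_prod _ _ _ _ fun i => ?_
    have : HC 1 (Polynomial.C (σ i) + Polynomial.X * Polynomial.C (algebraMap C M (c i))) (algebraMap C M (c i)) := by
      refine ⟨?_, ?_⟩
      · compute_degree
      · simp
    simpa using HC_pow this (m i)
  have hm : ∀ m ∈ P.support, ∑ i, m i ≤ N := fun m hm => by
    have := (le_totalDegree hm).trans hN
    rwa [Finsupp.sum_fintype _ _ (fun _ => rfl)] at this
  rw [aeval_def, eval₂_eq']
  constructor
  · apply Polynomial.natDegree_sum_le_of_forall_le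
    intro m hmm
    refine (Polynomial.natDegree_mul_le).trans ?_
    have : (algebraMap C (Polynomial M) (coeff m P)).natDegree = 0 := by
      show (Polynomial.C (algebraMap C M _)).natDegree = 0
      simp
    rw [this, zero_add]
    exact (h1 m).1.trans (hm m hmm)
  · rw [Polynomial.finset_sum_coeff, homogeneousComponent_apply, map_sum, map_sum, Finset.sum_filter]
    refine Finset.sum_congr rfl fun m hmm => ?_
    have e : algebraMap C (Polynomial M) (coeff m P) = Polynomial.C (algebraMap C M (coeff m P)) := rfl
    rw [e, Polynomial.coeff_C_mul]
    have hd : m.degree = ∑ i, m i := Finsupp.degree_eq_sum m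
    split_ifs with h
    · rw [hd] at h
      rw [← h, (h1 m).2, eval_monomial, map_mul, Finsupp.prod_fintype _ _ (fun _ => pow_zero _), map_prod]
      simp
    · rw [hd] at h
      rw [Polynomial.coeff_eq_zero_of_natDegree_lt, mul_zero]
      exact lt_of_le_of_lt (h1 m).1 (lt_of_le_of_ne (hm m hmm) h)

lemma ev_ne {C ι : Type} [Field C] [Infinite C] (p : MvPolynomial ι C) (hp : p ≠ 0) : ∃ c, eval c p ≠ 0 := by
  by_contra h
  push Not at h
  exact hp (MvPolynomial.funext fun x => by rw [h, map_zero])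

lemma spec {M : Type} [Field M] [Infinite M] {r s : ℕ} (Y : Fin s → FractionRing (MvPolynomial (Fin r) M))
    (Q : MvPolynomial (Fin s) M) (hQ : aeval Y Q ≠ 0) :
    ∃ σ : Fin s → M, eval σ Q ≠ 0 ∧ ∀ F, aeval Y F = 0 → eval σ F = 0 := by
  let R := MvPolynomial (Fin r) M
  let L := FractionRing R
  obtain ⟨W, hW⟩ := IsLocalization.exist_integer_multiples_of_finite (nonZeroDivisors R) Y
  have hW0 : (W : R) ≠ 0 := nonZeroDivisors.ne_zero W.2
  choose Nn hNn using hW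
  let S := Localization.Away (W : R)
  have hWL : algebraMap R L W ≠ 0 := by
    simpa using hW0
  have hun : ∀ y : Submonoid.powers (W : R), IsUnit (algebraMap R L y) := by
    rintro ⟨y, e, rfl⟩
    simp only [map_pow]
    exact (IsUnit.mk0 _ hWL).pow e
  let θ : S →ₐ[M] L := IsLocalization.liftAlgHom (M := Submonoid.powers (W : R)) (f := Algebra.algHom M R L) hun
  have hθ : ∀ x : R, θ (algebraMap R S x) = algebraMap R L x := fun x => IsLocalization.lift_eq _ x
  have hθi : Function.Injective θ := by
    have : Function.Injective (IsLocalization.lift (S := S) hun : S →+* L) := by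
      rw [IsLocalization.lift_injective_iff]
      intro x y
      have hi : Function.Injective (algebraMap R S) := IsLocalization.injective S (M := Submonoid.powers (W : R))
        (powers_le_nonZeroDivisors_of_noZeroDivisors hW0)
      rw [hi.eq_iff, (IsFractionRing.injective R L).eq_iff]
    exact this
  let w' : S := IsLocalization.Away.invSelf (W : R)
  have hw' : algebraMap R S W * w' = 1 := IsLocalization.Away.mul_invSelf (W : R)
  let Y' : Fin s → S := fun i => algebraMap R S (Nn i) * w'
  have hY' : ∀ i, θ (Y' i) = Y i := by
    intro i
    have h1 : algebraMap R L W * θ w' = 1 := by rw [← hθ, ← map_mul, hw', map_one]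
    have h2 : algebraMap R L (Nn i) = algebraMap R L W * Y i := by
      rw [hNn, Algebra.smul_def]
    simp only [Y', map_mul, hθ]
    rw [h2]
    linear_combination (Y i) * h1
  have hae : ∀ F, θ (aeval Y' F) = aeval Y F := fun F => by
    rw [← AlgHom.comp_apply, comp_aeval]
    simp only [hY']
  have hQ' : aeval Y' Q ≠ 0 := fun h => hQ (by rw [← hae, h, map_zero])
  obtain ⟨⟨q, ⟨_, e, rfl⟩⟩, hq⟩ := IsLocalization.surj (Submonoid.powers (W : R)) (aeval Y' Q)
  simp only at hq
  have hq0 : q ≠ 0 := by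
    rintro rfl
    rw [map_zero, map_pow] at hq
    have hu : IsUnit (algebraMap R S W) := IsUnit.of_mul_eq_one _ hw'
    exact hQ' ((hu.pow e).mul_left_eq_zero.1 hq)
  obtain ⟨a, ha⟩ := ev_ne (q * (W : R)) (mul_ne_zero hq0 hW0)
  rw [map_mul] at ha
  have hun2 : ∀ y : Submonoid.powers (W : R), IsUnit ((aeval a : R →ₐ[M] M) y) := by
    rintro ⟨y, e, rfl⟩
    simp only [map_pow]
    exact (IsUnit.mk0 _ (by rw [aeval_eq_eval]; exact right_ne_zero_of_mul ha)).pow e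
  let φ : S →ₐ[M] M := IsLocalization.liftAlgHom (M := Submonoid.powers (W : R)) (f := (aeval a : R →ₐ[M] M)) hun2
  have hφ : ∀ x : R, φ (algebraMap R S x) = eval a x := fun x => by
    have : φ (algebraMap R S x) = aeval a x := IsLocalization.lift_eq _ x
    rw [this, aeval_eq_eval]
  have hφe : ∀ F, eval (fun i => φ (Y' i)) F = φ (aeval Y' F) := fun F => by
    rw [← AlgHom.comp_apply, comp_aeval, aeval_eq_eval]
  refine ⟨fun i => φ (Y' i), ?_, ?_⟩
  · rw [hφe]
    intro h
    have := congrArg φ hq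
    rw [map_mul, h, zero_mul, hφ] at this
    exact left_ne_zero_of_mul ha this.symm
  · intro F hF
    rw [hφe]
    have : aeval Y' F = 0 := hθi (by rw [hae, hF, map_zero])
    rw [this, map_zero]

end DC

namespace DC

lemma topcomp {C : Type} [Field C] {s : ℕ} (P : MvPolynomial (Fin s) C) (hP : P ≠ 0) :
    homogeneousComponent P.totalDegree P ≠ 0 := by
  classical
  obtain ⟨m, hm, h⟩ := Finset.exists_mem_eq_sup P.support (by simpa using hP) (fun s => s.sum fun _ e => e)
  intro h0
  have := congrArg (coeff m) h0
  rw [coeff_homogeneousComponent, coeff_zero, if_pos] at this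
  · exact (mem_support_iff.1 hm) this
  · rw [totalDegree, h]; rfl

theorem stageD {n d r s : ℕ} [NeZero n] {C M A : Type} [Field C] [Infinite C] [Field M] [Algebra C M]
    [CommRing A] [IsDomain A] [Algebra C A] (j : A →ₐ[C] M) (hj : Function.Injective j)
    (b : MvPolynomial (Fin n ⊕ Fin 2) C) (hb : BH ![2 * d, 2] b) (u : Fin n ⊕ Fin 2 → A) (z : A)
    (hz : aeval u b = z ^ 2) (hu0 : u (Sum.inl 0) = 1) (hu1 : u (Sum.inr 1) = 1)
    (ε : FractionRing (MvPolynomial (Fin r) A) ≃ₐ[C] FractionRing (MvPolynomial (Fin s) C)) :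
    ∃ (pt : Fin n ⊕ Fin 2 → Polynomial M) (Z : Polynomial M) (N : Fin 2 → ℕ) (t : Fin n ⊕ Fin 2 → C) (lam : M),
      aeval pt b = Z ^ 2 ∧ (∀ v, (pt v).natDegree ≤ N (ty v)) ∧
      (∀ v, (pt v).coeff (N (ty v)) = algebraMap C _ (t v)) ∧ (∀ j, ∃ v, ty v = j ∧ t v ≠ 0) ∧ lam ≠ 0 ∧
      ∀ v, (pt v).coeff 0 = lam * j (u v) := by
  classical
  have hinfM : Infinite M := Infinite.of_injective (algebraMap C M) (algebraMap C M).injective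
  let R := MvPolynomial (Fin r) A
  let F := FractionRing R
  let S := MvPolynomial (Fin s) C
  let G := FractionRing S
  let RM := MvPolynomial (Fin r) M
  let FM := FractionRing RM
  let ι : A →ₐ[C] F := (IsScalarTower.toAlgHom C R F).comp (IsScalarTower.toAlgHom C A R)
  obtain ⟨Q, hQ⟩ := IsLocalization.exist_integer_multiples_of_finite (nonZeroDivisors S)
    (fun o : Option (Fin n ⊕ Fin 2) => (o.elim (ε (ι z)) (fun v => ε (ι (u v))) : G))
  have hQ0 : (Q : S) ≠ 0 := nonZeroDivisors.ne_zero Q.2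
  choose P hP using fun v => hQ (some v)
  obtain ⟨Pz0, hPz0⟩ := hQ none
  simp only [Option.elim, Algebra.smul_def] at hP hPz0
  have hinj : Function.Injective (algebraMap S G) := IsFractionRing.injective S G
  have hP' : ∀ v, algebraMap S G (P v) = algebraMap S G Q * ε (ι (u v)) := hP
  have hPz' : algebraMap S G Pz0 = algebraMap S G Q * ε (ι z) := hPz0
  have hPb : aeval P b = ((Q : S) ^ d * Pz0) ^ 2 := by
    apply hinj
    have h1 : algebraMap S G (aeval P b) = aeval (fun v => algebraMap S G (P v)) b := by
      rw [← aeval_algebraMap_apply]; rfl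
    have h2 : aeval (fun v => ε (ι (u v))) b = ε (ι z) ^ 2 := by
      have : aeval (fun v => ε (ι (u v))) b = ((ε : F →ₐ[C] G).comp ι) (aeval u b) := by
        rw [← AlgHom.comp_apply, comp_aeval]; rfl
      rw [this, hz, map_pow]; rfl
    have h3 := bh_scale hb (fun _ => algebraMap S G Q) (fun v => ε (ι (u v)))
    rw [h1, funext hP', h3, h2, map_pow, map_mul, map_pow, hPz']
    simp only [Matrix.cons_val_zero, Matrix.cons_val_one]
    ring
  have hPbase : ∀ i : Fin 2, ∃ v, ty v = i ∧ P v ≠ 0 := by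
    have h : ∀ v, u v = 1 → P v ≠ 0 := fun v hv h => by
      have := hP' v
      rw [hv, map_one, map_one, mul_one, h] at this
      exact hQ0 (hinj this.symm)
    intro i
    fin_cases i
    · exact ⟨Sum.inl 0, rfl, h _ hu0⟩
    · exact ⟨Sum.inr 1, rfl, h _ hu1⟩
  have hmj : Function.Injective (map (σ := Fin r) (j : A →+* M)) := map_injective _ hj
  let δ : F →+* FM := IsFractionRing.map (K := F) (L := FM) hmj
  have hδ : ∀ x : R, δ (algebraMap R F x) = algebraMap RM FM (map (j : A →+* M) x) := fun x =>
    IsLocalization.map_eq _ x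
  have hδι : ∀ a, δ (ι a) = algebraMap M FM (j a) := fun a => by
    change δ (algebraMap R F (MvPolynomial.C a)) = _
    rw [hδ, map_C]; rfl
  let Y : Fin s → FM := fun i => δ (ε.symm (algebraMap S G (X i)))
  have hY : ∀ p : S, aeval Y (map (algebraMap C M) p) = δ (ε.symm (algebraMap S G p)) := by
    intro p
    have : ((aeval Y : MvPolynomial (Fin s) M →ₐ[M] FM) : MvPolynomial (Fin s) M →+* FM).comp (map (algebraMap C M))
        = (δ.comp (ε.symm : G →+* F)).comp (algebraMap S G) := by
      apply ringHom_ext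
      · intro c
        have e1 : algebraMap S G (MvPolynomial.C c) = algebraMap C G c := rfl
        have e2 : ε.symm (algebraMap C G c) = ι (algebraMap C A c) := by
          rw [AlgEquiv.commutes, AlgHom.commutes]
        simp only [RingHom.comp_apply, map_C, e1]
        change aeval Y (MvPolynomial.C _) = δ (ε.symm (algebraMap C G c))
        rw [e2, hδι, aeval_C, AlgHom.commutes]
      · intro i
        simp only [RingHom.comp_apply, map_X]
        change aeval Y (X i) = Y i
        rw [aeval_X]
    exact RingHom.congr_fun this p
  obtain ⟨σ, hσQ, hσ⟩ := spec Y (map (algebraMap C M) (Q : S)) (by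
    rw [hY]
    intro h
    rw [map_eq_zero_iff _ δ.injective, map_eq_zero_iff _ ε.symm.injective, map_eq_zero_iff _ hinj] at h
    exact hQ0 h)
  have hev : ∀ p : S, eval σ (map (algebraMap C M) p) = aeval σ p := fun p => by
    rw [eval_map, aeval_def]
  have hPσ : ∀ v, aeval σ (P v) = aeval σ (Q : S) * j (u v) := fun v => by
    have := hσ (map (algebraMap C M) (P v) - map (algebraMap C M) (Q : S) * MvPolynomial.C (j (u v))) (by
      rw [map_sub, map_mul, hY, hY, hP', map_mul, map_mul, aeval_C, AlgEquiv.symm_apply_apply, hδι, sub_self])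
    rw [map_sub, map_mul, hev, hev, eval_C] at this
    exact sub_eq_zero.1 this
  have hmax : ∀ i : Fin 2, ∃ v, ty v = i ∧ P v ≠ 0 ∧ ∀ w, ty w = i → (P w).totalDegree ≤ (P v).totalDegree := by
    intro i
    obtain ⟨v0, h0, h0'⟩ := hPbase i
    obtain ⟨v, hv, hm⟩ := Finset.exists_max_image (Finset.univ.filter fun v => ty v = i ∧ P v ≠ 0)
      (fun v => (P v).totalDegree) ⟨v0, by simp [h0, h0']⟩
    rw [Finset.mem_filter] at hv
    refine ⟨v, hv.2.1, hv.2.2, fun w hw => ?_⟩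
    by_cases hw0 : P w = 0
    · rw [hw0, totalDegree_zero]; exact Nat.zero_le _
    · exact hm w (Finset.mem_filter.2 ⟨Finset.mem_univ _, hw, hw0⟩)
  choose mv hmv hmv0 hmvm using hmax
  obtain ⟨c, hc⟩ := ev_ne (∏ i, homogeneousComponent (P (mv i)).totalDegree (P (mv i)))
    (Finset.prod_ne_zero_iff.2 fun i _ => topcomp _ (hmv0 i))
  rw [map_prod, Finset.prod_ne_zero_iff] at hc
  let ln : Fin s → Polynomial M := fun i => Polynomial.C (σ i) + Polynomial.X * Polynomial.C (algebraMap C M (c i))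
  have hl := fun v => line σ c (P v) (P (mv (ty v))).totalDegree (hmvm (ty v) v rfl)
  refine ⟨fun v => aeval ln (P v), aeval ln ((Q : S) ^ d * Pz0), fun i => (P (mv i)).totalDegree,
    fun v => eval c (homogeneousComponent (P (mv (ty v))).totalDegree (P v)), aeval σ (Q : S), ?_,
    fun v => (hl v).1, fun v => (hl v).2, fun i => ⟨mv i, hmv i, ?_⟩, ?_, fun v => ?_⟩
  · rw [← map_pow, ← hPb, ← AlgHom.comp_apply, comp_aeval]
  · beta_reduce; rw [hmv i]; exact hc i (Finset.mem_univ _)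
  · rw [← hev]; exact hσQ
  · rw [← hPσ]
    have h0 : (Polynomial.aeval (0 : M) : Polynomial M →ₐ[M] M).restrictScalars C (aeval ln (P v)) = aeval σ (P v) := by
      rw [← AlgHom.comp_apply, comp_aeval]
      congr 2
      funext i
      simp [ln]
    rw [← h0, Polynomial.coeff_zero_eq_eval_zero]
    simp [Polynomial.aeval_def, Polynomial.eval₂_eq_eval_map]
end DC

namespace DC

lemma exJ {K R M : Type} [Field K] [CommRing R] [Algebra K R] [Field M] [Algebra K M] (f : R →ₐ[K] M)
    (hf : Function.Injective f) :
    ∃ J : FractionRing R →ₐ[K] M, Function.Injective J ∧ ∀ x, J (algebraMap R _ x) = f x := by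
  haveI : IsDomain R := Function.Injective.isDomain (f : R →+* M) hf
  refine ⟨IsFractionRing.liftAlgHom hf, (IsFractionRing.liftAlgHom hf : FractionRing R →ₐ[K] M).toRingHom.injective,
    fun x => ?_⟩
  exact IsFractionRing.lift_algebraMap (g := (f : R →+* M)) hf x

abbrev emb {n : ℕ} : Fin n ⊕ Fin 2 → Fin n ⊕ Fin 3 := Sum.map id Fin.castSucc

noncomputable abbrev gg {n : ℕ} {K : Type} [Field K] (b : MvPolynomial (Fin n ⊕ Fin 2) K) :
    MvPolynomial (Fin n ⊕ Fin 3) K :=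
  X (Sum.inr 2) ^ 2 - rename (Sum.map id Fin.castSucc) b

lemma qa_omega {V A : Type} [CommRing A] (b : MvPolynomial V A) :
    (⟨0, 1⟩ : QA b) ^ 2 = algebraMap (MvPolynomial V A) (QA b) b := by
  rw [sq]
  have : algebraMap (MvPolynomial V A) (QA b) b = ⟨b, 0⟩ := rfl
  rw [this]
  ext <;> simp

lemma exTheta {n : ℕ} {K : Type} [Field K] (b : MvPolynomial (Fin n ⊕ Fin 2) K) :
    ∃ Θ : ConicBundleFormalization.coneRing K (gg b) →ₐ[K] QA b, Function.Injective Θ ∧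
      (∀ v, Θ (Ideal.Quotient.mk _ (X (emb v))) = algebraMap (MvPolynomial (Fin n ⊕ Fin 2) K) _ (X v)) ∧
      Θ (Ideal.Quotient.mk _ (X (Sum.inr 2))) = ⟨0, 1⟩ := by
  let th : Fin n ⊕ Fin 3 → QA b := Sum.elim (fun i => algebraMap (MvPolynomial (Fin n ⊕ Fin 2) K) _ (X (Sum.inl i)))
    ![algebraMap (MvPolynomial (Fin n ⊕ Fin 2) K) _ (X (Sum.inr 0)),
      algebraMap (MvPolynomial (Fin n ⊕ Fin 2) K) _ (X (Sum.inr 1)), ⟨0, 1⟩]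
  have hthe : ∀ v, th (emb v) = algebraMap (MvPolynomial (Fin n ⊕ Fin 2) K) _ (X v) := by
    rintro (i | i)
    · rfl
    · fin_cases i <;> rfl
  have hgb : aeval th (rename emb b) = algebraMap (MvPolynomial (Fin n ⊕ Fin 2) K) (QA b) b := by
    rw [aeval_rename]
    have : th ∘ emb = fun v => algebraMap (MvPolynomial (Fin n ⊕ Fin 2) K) (QA b) (X v) := funext hthe
    rw [this]
    have h2 := aeval_algebraMap_apply (R := K) (QA b) (X : Fin n ⊕ Fin 2 → MvPolynomial (Fin n ⊕ Fin 2) K) b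
    rw [aeval_X_left_apply] at h2
    exact h2
  have hg : aeval th (gg b) = 0 := by
    rw [gg, map_sub, map_pow, aeval_X]
    erw [hgb]
    rw [← qa_omega]
    exact sub_self _
  let Θ : (MvPolynomial (Fin n ⊕ Fin 3) K ⧸ Ideal.span {gg b}) →ₐ[K] QA b :=
    Ideal.Quotient.liftₐ (Ideal.span {gg b}) (aeval th) (fun a ha => by
      have : Ideal.span {gg b} ≤ RingHom.ker (aeval th : _ →ₐ[K] QA b) := by
        rw [Ideal.span_singleton_le_iff_mem]; exact hg
      exact this ha)
  let Rn := MvPolynomial (Fin n ⊕ Fin 3) K ⧸ Ideal.span {gg b}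
  let mk : MvPolynomial (Fin n ⊕ Fin 3) K →+* Rn := Ideal.Quotient.mk _
  let μ : MvPolynomial (Fin n ⊕ Fin 2) K →+* Rn := mk.comp (rename emb : _ →ₐ[K] _).toRingHom
  have hμ : mk (X (Sum.inr 2)) * mk (X (Sum.inr 2)) = μ b := by
    have : mk (X (Sum.inr 2) ^ 2 - rename emb b) = 0 := Ideal.Quotient.eq_zero_iff_mem.2 (Ideal.mem_span_singleton_self _)
    rw [map_sub, map_pow, sub_eq_zero, sq] at this
    exact this
  let Ψ : QA b →+* Rn :=
    { toFun := fun x => μ x.re + μ x.im * mk (X (Sum.inr 2))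
      map_zero' := by
        change μ 0 + μ 0 * _ = 0
        rw [map_zero, zero_mul, add_zero]
      map_one' := by
        change μ 1 + μ 0 * _ = 1
        rw [map_zero, zero_mul, add_zero, map_one]
      map_add' := fun x y => by
        simp only [QuadraticAlgebra.re_add, QuadraticAlgebra.im_add, map_add]; ring
      map_mul' := fun x y => by
        simp only [QuadraticAlgebra.re_mul, QuadraticAlgebra.im_mul, map_add, map_mul, map_zero]
        rw [← hμ]; ring }
  have hΘ : ∀ p, Θ (mk p) = aeval th p := fun p => rfl
  have hΨ : ∀ p : MvPolynomial (Fin n ⊕ Fin 2) K, Ψ (algebraMap _ _ p) = μ p := fun p => by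
    change μ p + μ 0 * _ = μ p
    rw [map_zero, zero_mul, add_zero]
  have hinv : ∀ p, Ψ (aeval th p) = mk p := by
    intro p
    have : Ψ.comp (aeval th : _ →ₐ[K] QA b).toRingHom = mk := by
      apply ringHom_ext
      · intro c
        change Ψ (aeval th (MvPolynomial.C c)) = mk (MvPolynomial.C c)
        rw [aeval_C]
        have : algebraMap K (QA b) c = algebraMap (MvPolynomial (Fin n ⊕ Fin 2) K) _ (MvPolynomial.C c) := rfl
        rw [this, hΨ]
        change mk (rename emb (MvPolynomial.C c)) = _
        rw [rename_C]
      · intro v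
        change Ψ (aeval th (X v)) = mk (X v)
        rw [aeval_X]
        have h3 : ∀ w, Ψ (th (emb w)) = mk (X (emb w)) := fun w => by
          rw [hthe, hΨ]
          change mk (rename emb (X w)) = _
          rw [rename_X]
        rcases v with i | i
        · exact h3 (Sum.inl i)
        · fin_cases i
          · exact h3 (Sum.inr 0)
          · exact h3 (Sum.inr 1)
          · change μ 0 + μ 1 * mk (X (Sum.inr 2)) = mk (X (Sum.inr 2))
            rw [map_zero, map_one, zero_add, one_mul]
    exact RingHom.congr_fun this p
  refine ⟨Θ, ?_, fun v => ?_, ?_⟩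
  · apply Function.LeftInverse.injective (g := Ψ)
    intro x
    obtain ⟨p, rfl⟩ := Ideal.Quotient.mk_surjective x
    exact hinv p
  · change aeval th (X (emb v)) = _
    rw [aeval_X, hthe]
  · change aeval th (X (Sum.inr 2)) = _
    rw [aeval_X]; rfl

lemma bihom_mon {K : Type} [Field K] {n m : ℕ} {w : Fin m → ℤ} {a : Fin m → ℕ} {α : ℤ} {β : ℕ}
    (e : Fin n ⊕ Fin m →₀ ℕ)
    (h1 : (∑ i : Fin n, (e (Sum.inl i) : ℤ)) + ∑ j : Fin m, (e (Sum.inr j) : ℤ) * w j = α)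
    (h2 : (∑ j : Fin m, e (Sum.inr j) * a j) = β) :
    ConicBundleFormalization.IsBihom K n m w a α β (monomial e 1) := by
  classical
  intro e' he'
  have := Finset.mem_singleton.1 (support_monomial_subset he')
  subst this
  exact ⟨h1, h2⟩

lemma bih_v {K : Type} [Field K] {n d : ℕ} (v : Fin n ⊕ Fin 2) :
    ConicBundleFormalization.IsBihom K n 3 ![0, 0, (d : ℤ)] (fun _ => 1) (![1, 0] (ty v)) (![0, 1] (ty v)) (X (emb v)) := by
  classical
  rcases v with i | i
  · refine bihom_mon _ ?_ ?_ <;> simp [Finsupp.single_apply]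
  · fin_cases i <;> refine bihom_mon _ ?_ ?_ <;> simp [Finsupp.single_apply, Fin.sum_univ_three]

lemma bih_z {K : Type} [Field K] {n d : ℕ} :
    ConicBundleFormalization.IsBihom K n 3 ![0, 0, (d : ℤ)] (fun _ => 1) d 1 (X (Sum.inr 2)) := by
  classical
  refine bihom_mon _ ?_ ?_ <;> simp [Finsupp.single_apply, Fin.sum_univ_three]

lemma bih_q {K : Type} [Field K] {n d : ℕ} [NeZero n] :
    ConicBundleFormalization.IsBihom K n 3 ![0, 0, (d : ℤ)] (fun _ => 1) d 1
      (X (Sum.inl 0) ^ d * X (Sum.inr 1)) := by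
  classical
  rw [X_pow_eq_monomial, X, monomial_mul, mul_one]
  refine bihom_mon _ ?_ ?_ <;> simp [Finsupp.single_apply, Fin.sum_univ_three]
end DC

namespace DC
open ConicBundleFormalization in
theorem not_stab {n d : ℕ} [NeZero n] (hn : 3 ≤ n) (hd : n ≤ 2 * d) {C : Type} [Field C] [IsAlgClosed C]
    (c : Ms n ![2 * d, 2] → C) (hc : AlgebraicIndependent ℤ c) :
    ¬ IsStablyRationalModel C ![0, 0, (d : ℤ)] (fun _ => 1) (gg (bOf c)) := by
  classical
  rintro ⟨r, s, ⟨ε⟩⟩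
  obtain ⟨hdom, hno⟩ := nocurve hn hd c hc
  have hinfC : Infinite C := inferInstance
  set b := bOf c with hbdef
  have hb : BH ![2 * d, 2] b := BH_bOf c
  obtain ⟨Θ, hΘi, hΘv, hΘz⟩ := exTheta b
  let M := FractionRing (QA b)
  let MV := MvPolynomial (Fin n ⊕ Fin 2) C
  have hιi : Function.Injective (algebraMap (QA b) M) := IsFractionRing.injective _ _
  obtain ⟨J0, hJ0i, hJ0⟩ := exJ ((IsScalarTower.toAlgHom C (QA b) M).comp Θ) (hιi.comp hΘi)
  let J : FracCone C (gg b) →ₐ[C] M := J0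
  have hJi : Function.Injective J := hJ0i
  have hJt : ∀ p, J (toFrac C (gg b) p) = algebraMap (QA b) M (Θ (Ideal.Quotient.mk _ p)) := fun p => hJ0 _
  let gen : Fin n ⊕ Fin 2 → M := fun v => algebraMap (QA b) M (algebraMap MV _ (X v))
  have hgen : ∀ v, J (toFrac C (gg b) (X (emb v))) = gen v := fun v => by rw [hJt, hΘv]
  have hgen0 : ∀ v, gen v ≠ 0 := fun v h => by
    have h1 : algebraMap MV (QA b) (X v) = 0 := hιi (by rw [map_zero]; exact h)
    have h2 : (X v : MV) = 0 := congrArg QuadraticAlgebra.re h1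
    exact X_ne_zero v h2
  let om : M := algebraMap (QA b) M ⟨0, 1⟩
  have hom : aeval gen b = om ^ 2 := by
    change _ = (algebraMap (QA b) M ⟨0, 1⟩) ^ 2
    rw [← map_pow, qa_omega]
    have h2 := aeval_algebraMap_apply (R := C) (QA b) (X : Fin n ⊕ Fin 2 → MV) b
    rw [aeval_X_left_apply] at h2
    have h3 := aeval_algebraMap_apply (R := C) M (fun v => algebraMap MV (QA b) (X v)) b
    exact h3.trans (congrArg _ h2)
  let FF := functionFieldModel C ![0, 0, (d : ℤ)] (fun _ => 1) (gg b)
  have ratio : ∀ (α : ℤ) (β : ℕ) (p q : Cox C n 3), IsBihom C n 3 ![0, 0, (d : ℤ)] (fun _ => 1) α β p →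
      IsBihom C n 3 ![0, 0, (d : ℤ)] (fun _ => 1) α β q → J (toFrac C (gg b) q) ≠ 0 →
      ∃ φ : FF, J φ = J (toFrac C (gg b) p) / J (toFrac C (gg b) q) := by
    intro α β p q hp hq h0
    have hq0 : toFrac C (gg b) q ≠ 0 := fun h => h0 (by rw [h, map_zero])
    have hdc : IsDomain (coneRing C (gg b)) := Function.Injective.isDomain (Θ : _ →+* QA b) hΘi
    have hq1 : (Ideal.Quotient.mk (Ideal.span {gg b}) q : coneRing C (gg b)) ∈ nonZeroDivisors (coneRing C (gg b)) := by
      rw [mem_nonZeroDivisors_iff_ne_zero]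
      intro h
      apply hq0
      change algebraMap (coneRing C (gg b)) (FracCone C (gg b)) (Ideal.Quotient.mk _ q) = 0
      rw [h, map_zero]
    have hsp := IsLocalization.mk'_spec (FractionRing (coneRing C (gg b))) (Ideal.Quotient.mk (Ideal.span {gg b}) p)
      ⟨_, hq1⟩
    let φ : FracCone C (gg b) := IsLocalization.mk' (FractionRing (coneRing C (gg b)))
      (Ideal.Quotient.mk (Ideal.span {gg b}) p) (⟨_, hq1⟩ : nonZeroDivisors (coneRing C (gg b)))
    have hφ : φ * toFrac C (gg b) q = toFrac C (gg b) p := hsp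
    refine ⟨⟨φ, Algebra.subset_adjoin ⟨α, β, p, q, hp, hq, hq0, hφ⟩⟩, ?_⟩
    rw [eq_div_iff h0, ← map_mul, hφ]
  let base : Fin 2 → Fin n ⊕ Fin 2 := ![Sum.inl 0, Sum.inr 1]
  have hbase : ∀ i, ty (base i) = i := fun i => by fin_cases i <;> rfl
  have hu : ∀ v, ∃ φ : FF, J φ = gen v / gen (base (ty v)) := fun v => by
    have h2 := bih_v (K := C) (d := d) (base (ty v))
    rw [hbase] at h2
    obtain ⟨φ, h⟩ := ratio _ _ _ _ (bih_v v) h2 (by rw [hgen]; exact hgen0 _)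
    exact ⟨φ, by rw [h, hgen, hgen]⟩
  choose u hu using hu
  have hq : J (toFrac C (gg b) (X (Sum.inl 0) ^ d * X (Sum.inr 1))) = gen (base 0) ^ d * gen (base 1) := by
    rw [map_mul, map_mul, map_pow, map_pow]
    have e0 := hgen (base 0)
    have e1 := hgen (base 1)
    rw [← e0, ← e1]
    rfl
  obtain ⟨z, hz⟩ := ratio _ _ _ _ bih_z bih_q (by
    rw [hq]; exact mul_ne_zero (pow_ne_zero _ (hgen0 _)) (hgen0 _))
  rw [hq, hJt, hΘz] at hz
  let j : FF →ₐ[C] M := J.comp FF.val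
  have hj : Function.Injective j := hJi.comp Subtype.val_injective
  have hju : ∀ v, j (u v) = gen v / gen (base (ty v)) := hu
  have hjz : j z = om / (gen (base 0) ^ d * gen (base 1)) := hz
  haveI : IsDomain FF := Function.Injective.isDomain (j : FF →+* M) hj
  have hub : ∀ i, u (base i) = 1 := fun i => hj (by
    rw [hju, hbase, map_one, div_self (hgen0 _)])
  have huz : aeval u b = z ^ 2 := by
    apply hj
    have h1 : j (aeval u b) = aeval (fun v => j (u v)) b := by
      rw [← AlgHom.comp_apply, comp_aeval]
    have h2 := bh_scale hb (fun i => (gen (base i))⁻¹) gen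
    have h3 : (fun v => j (u v)) = fun v => (gen (base (ty v)))⁻¹ * gen v := funext fun v => by
      rw [hju, div_eq_inv_mul]
    rw [h1, h3, h2, hom, map_pow, hjz]
    simp only [Matrix.cons_val_zero, Matrix.cons_val_one]
    rw [div_pow, mul_pow, div_eq_inv_mul, mul_inv, ← pow_mul, mul_comm d 2, inv_pow, inv_pow]
  obtain ⟨pt, Z, N, t, lam, h1, h2, h3, h4, h5, h6⟩ :=
    stageD j hj b hb u z huz (hub 0) (hub 1) ε
  refine hno pt Z h1 N h2 t h3 h4 (fun i => lam / gen (base i)) (fun i => div_ne_zero h5 (hgen0 _)) fun v => ?_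
  rw [h6, hju]
  change lam * (gen v / gen (base (ty v))) = lam / gen (base (ty v)) * gen v
  rw [div_mul_eq_mul_div, mul_div_assoc]
end DC

namespace DC
lemma cnt {ι : Type} [Countable ι] : Countable (MvPolynomial ι ℤ) := by
  have : Countable ((ι →₀ ℕ) →₀ ℤ) := inferInstance
  exact Countable.of_equiv _ (AddMonoidAlgebra.coeffEquiv (R := ℤ) (M := ι →₀ ℕ)).symm

lemma bh_iff {n d : ℕ} (p : MvPolynomial (Fin n ⊕ Fin 2) ℂ) :
    ConicBundleFormalization.IsBihom ℂ n 2 (fun _ => 0) (fun _ => 1) (2 * d : ℤ) 2 p ↔ BH ![2 * d, 2] p := by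
  classical
  unfold ConicBundleFormalization.IsBihom BH
  refine forall₂_congr fun e he => ?_
  rw [Fin.forall_fin_two]
  simp only [Fintype.sum_sum_type, ty_inl, ty_inr, Matrix.cons_val_zero, Matrix.cons_val_one, if_true,
    mul_zero, mul_one, Finset.sum_const_zero, add_zero, zero_ne_one, one_ne_zero, if_false, zero_add]
  refine and_congr ?_ Iff.rfl
  constructor
  · intro h; exact_mod_cast h
  · intro h; exact_mod_cast h
end DC

namespace ConicBundleFormalization

open MvPolynomial

/-- **Corollary 1.3.**  A double cover of `ℙ^{n-1} × ℙ¹` branched along a very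
general divisor of bidegree `(2d,2)` with `2d ≥ n ≥ 3` is not stably rational.
(The double cover is the member `z² = b` of `|𝒪_P(2d,2)|` on `P = P_n(0,0,d)`,
where `b` is the equation of the branch divisor.) -/
theorem cor_double_cover
    (n d : ℕ) (hn : 3 ≤ n) (hd : n ≤ 2 * d) :
    VeryGenerallyHolds ℂ n 2 (fun _ => 0) (fun _ => 1) (2 * d : ℤ) 2 (fun b =>
      ¬ IsStablyRationalModel ℂ ![0, 0, (d : ℤ)] (fun _ => 1)
        (X (Sum.inr 2) ^ 2 - rename (Sum.map id Fin.castSucc) b)) := by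
  haveI : NeZero n := ⟨by omega⟩
  haveI : Countable (MvPolynomial (DC.Ms n ![2 * d, 2]) ℤ) := DC.cnt
  haveI : Nonempty {q : MvPolynomial (DC.Ms n ![2 * d, 2]) ℤ // q ≠ 0} := ⟨⟨1, one_ne_zero⟩⟩
  obtain ⟨f, hf⟩ := exists_surjective_nat {q : MvPolynomial (DC.Ms n ![2 * d, 2]) ℤ // q ≠ 0}
  have key : ∀ (p : Cox ℂ n 2) (q : MvPolynomial (DC.Ms n ![2 * d, 2]) ℤ),
      evalCoeff ℂ p (rename (fun e : DC.Ms n ![2 * d, 2] => e.1) (map (Int.castRingHom ℂ) q)) =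
        eval (fun e : DC.Ms n ![2 * d, 2] => coeff e.1 p) (map (Int.castRingHom ℂ) q) := fun p q => by
    rw [evalCoeff, eval_rename]; rfl
  refine ⟨fun i => rename (fun e : DC.Ms n ![2 * d, 2] => e.1) (map (Int.castRingHom ℂ) (f i).1), fun i => ?_, fun p hp hD => ?_⟩
  · obtain ⟨c, hc⟩ := DC.ev_ne (map (Int.castRingHom ℂ) (f i).1) (fun h => (f i).2
      (map_injective _ Int.cast_injective (by rw [h, map_zero])))
    refine ⟨DC.bOf c, (DC.bh_iff _).2 (DC.BH_bOf c), ?_⟩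
    rw [key]
    simp only [DC.coeff_bOf]
    exact hc
  · have hb := DC.eq_bOf ((DC.bh_iff p).1 hp)
    have hc : AlgebraicIndependent ℤ (fun e : DC.Ms n ![2 * d, 2] => coeff e.1 p) := by
      rw [algebraicIndependent_iff]
      intro q hq
      by_contra h0
      obtain ⟨i, hi⟩ := hf ⟨q, h0⟩
      apply hD i
      beta_reduce
      rw [hi, key, eval_map]
      exact hq
    have := DC.not_stab hn hd _ hc
    rw [← hb] at this
    exact this

end ConicBundleFormalization
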